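/- The Banach spaces B(α)/L(α) and B(β)/L(β) admit GL₂(ℚ_p)-invariant norms defining their topologies (i.e., they are unitary GL₂(ℚ_p)-Banach representations), and there exists a continuous GL₂(ℚ_p)-equivariant linear map Î : B(β)/L(β) → B(α)/L(α) whose composition with the canonical map π(β) → B(β)/L(β) equals the composition of the intertwining operator I : π(β) → π(α) with the canonical map π(α) → B(α)/L(α). Moreover, if α ≠ pβ, then I and Î are topological isomorphisms. -/

import Mathlib

open Filter Topology Classical

noncomputable section

namespace Paper

variable (p : ℕ) [Fact p.Prime]
variable (L : Type) [NontriviallyNormedField L] [NormedAlgebra ℚ_[p] L]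

/-- The canonical embedding `ℚ_p → L`. -/
noncomputable def iotaL : ℚ_[p] → L := algebraMap ℚ_[p] L

/-- The binomial coefficient `binom(z, n) = z(z-1)⋯(z-n+1)/n!` of a `p`-adic
integer, computed in `ℚ_p`. -/
noncomputable def binomQ (z : ℤ_[p]) (n : ℕ) : ℚ_[p] :=
  (∏ i ∈ Finset.range n, ((z : ℚ_[p]) - (i : ℚ_[p]))) / (n.factorial : ℚ_[p])

/-- The Mahler coefficients `a_n(f) = ∑_{i=0}^n (-1)^i binom(n,i) f(n-i)`. -/
noncomputable def mahlerCoeff (f : ℤ_[p] → L) (n : ℕ) : L :=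
  ∑ i ∈ Finset.range (n + 1), (-1 : L) ^ i * (n.choose i : L) * f (((n - i : ℕ) : ℤ_[p]))

/-- `f : ℤ_p → L` is of class `C^r` : the scaled Mahler coefficients
`n^r a_n(f)` tend to `0`, and `f` is the sum of its Mahler expansion. -/
def IsCr (r : ℝ) (f : ℤ_[p] → L) : Prop :=
  Tendsto (fun n : ℕ => (n : ℝ) ^ r * ‖mahlerCoeff p L f n‖) atTop (nhds 0) ∧
  ∀ z : ℤ_[p], HasSum (fun n : ℕ => mahlerCoeff p L f n * iotaL p L (binomQ p z n)) (f z)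

/-- The norm `‖f‖_r = sup_n (n+1)^r ‖a_n(f)‖` on `C^r(ℤ_p, L)`. -/
noncomputable def crNorm (r : ℝ) (f : ℤ_[p] → L) : ℝ :=
  ⨆ n : ℕ, ((n : ℝ) + 1) ^ r * ‖mahlerCoeff p L f n‖

/-- A continuous (= bounded) linear functional on `C^r(ℤ_p, L)`, i.e. a tempered
distribution of order `r`. -/
structure CrDual (r : ℝ) where
  toFun : (ℤ_[p] → L) → L
  map_add' : ∀ f g : ℤ_[p] → L, IsCr p L r f → IsCr p L r g →
    toFun (f + g) = toFun f + toFun g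
  map_smul' : ∀ (c : L) (f : ℤ_[p] → L), IsCr p L r f → toFun (c • f) = c * toFun f
  bound' : ∃ C : ℝ, ∀ f : ℤ_[p] → L, IsCr p L r f → ‖toFun f‖ ≤ C * crNorm p L r f

/-- The function `z ↦ 1_{a + pⁿℤ_p}(z) (z - a)^j`. -/
noncomputable def indPoly (a : ℤ_[p]) (n : ℕ) (j : ℕ) : ℤ_[p] → L := fun z =>
  if ‖z - a‖ ≤ (p : ℝ) ^ (-(n : ℤ)) then (iotaL p L ((z : ℚ_[p]) - (a : ℚ_[p]))) ^ j else 0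

/-- The norm `‖μ‖_{r,d} = sup_{a, 0 ≤ j ≤ d, n} p^{n(j-r)} ‖∫_{a+pⁿℤ_p} (z-a)^j dμ‖`. -/
noncomputable def dualNormRD (r : ℝ) (d : ℕ) (μ : CrDual p L r) : ℝ :=
  ⨆ (a : ℤ_[p]) (j : Fin (d + 1)) (n : ℕ),
    (p : ℝ) ^ ((n : ℝ) * (((j : ℕ) : ℝ) - r)) * ‖μ.toFun (indPoly p L a n j)‖

/-- `f : ℤ_p → L` is locally polynomial of local degree at most `d`. -/
def IsLocPoly (d : ℕ) (f : ℤ_[p] → L) : Prop :=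
  ∃ n : ℕ, ∀ a : ℤ_[p], ∃ P : Polynomial L, P.natDegree ≤ d ∧
    ∀ z : ℤ_[p], ‖z - a‖ ≤ (p : ℝ) ^ (-(n : ℤ)) → f z = Polynomial.eval (iotaL p L (z : ℚ_[p])) P

/-- A linear functional on `Pol^d(ℤ_p, L)`. -/
structure PolDual (d : ℕ) where
  toFun : (ℤ_[p] → L) → L
  map_add' : ∀ f g : ℤ_[p] → L, IsLocPoly p L d f → IsLocPoly p L d g →
    toFun (f + g) = toFun f + toFun g
  map_smul' : ∀ (c : L) (f : ℤ_[p] → L), IsLocPoly p L d f → toFun (c • f) = c * toFun f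

/-- The valuation `val(x) = -log_p ‖x‖` on `L`, normalized by `val(p) = 1`. -/
noncomputable def valL (x : L) : ℝ := -Real.logb p ‖x‖

/-- `g : ℤ_p → L` is a class-`C^{val α}` extension of
`z ↦ (αp/β)^{val z} z^{k-2} f(1/z)` from `ℤ_p ∖ {0}` to `ℤ_p`. -/
def Ext2 (k : ℕ) (α β : L) (f : ℚ_[p] → L) (g : ℤ_[p] → L) : Prop :=
  IsCr p L (valL p L α) g ∧ ∀ z : ℤ_[p], z ≠ 0 →
    g z = (α * (p : L) / β) ^ ((z : ℚ_[p]).valuation) *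
      (iotaL p L (z : ℚ_[p])) ^ (k - 2) * f (((z : ℚ_[p]))⁻¹)

/-- Membership in the Banach space `B(α)`. -/
def MemB (k : ℕ) (α β : L) (f : ℚ_[p] → L) : Prop :=
  IsCr p L (valL p L α) (fun z : ℤ_[p] => f ((p : ℚ_[p]) * (z : ℚ_[p]))) ∧
  ∃ g : ℤ_[p] → L, Ext2 p L k α β f g

/-- The extension `f₂` of `z ↦ (αp/β)^{val z} z^{k-2} f(1/z)` to `ℤ_p`
(it is unique when it exists). -/
noncomputable def ext2 (k : ℕ) (α β : L) (f : ℚ_[p] → L) : ℤ_[p] → L :=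
  if h : ∃ g : ℤ_[p] → L, Ext2 p L k α β f g then h.choose else 0

/-- The norm `‖f‖ = max(‖f₁‖_{val α}, ‖f₂‖_{val α})` on `B(α)`. -/
noncomputable def bNorm (k : ℕ) (α β : L) (f : ℚ_[p] → L) : ℝ :=
  max (crNorm p L (valL p L α) (fun z : ℤ_[p] => f ((p : ℚ_[p]) * (z : ℚ_[p]))))
      (crNorm p L (valL p L α) (ext2 p L k α β f))

/-- Determinant of a 2×2 matrix. -/
noncomputable def det2 (m : Matrix (Fin 2) (Fin 2) ℚ_[p]) : ℚ_[p] :=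
  m 0 0 * m 1 1 - m 0 1 * m 1 0

/-- The action of `g = (a b; c d) ∈ GL₂(ℚ_p)` on `B(α)`:
`(g·f)(z) = α^{-val(ad-bc)} (αp/β)^{val(-cz+a)} (-cz+a)^{k-2} f((dz-b)/(-cz+a))`,
the value at the pole `-cz+a = 0` being the one prescribed by the extension `f₂`. -/
noncomputable def gAct (k : ℕ) (α β : L) (m : Matrix (Fin 2) (Fin 2) ℚ_[p])
    (f : ℚ_[p] → L) : ℚ_[p] → L := fun z =>
  if -(m 1 0) * z + m 0 0 = 0 then
    α ^ (-(det2 p m).valuation) * (α * (p : L) / β) ^ ((det2 p m / m 1 0).valuation) *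
      (iotaL p L (det2 p m / m 1 0)) ^ (k - 2) * ext2 p L k α β f 0
  else
    α ^ (-(det2 p m).valuation) * (α * (p : L) / β) ^ ((-(m 1 0) * z + m 0 0).valuation) *
      (iotaL p L (-(m 1 0) * z + m 0 0)) ^ (k - 2) *
      f ((m 1 1 * z - m 0 1) / (-(m 1 0) * z + m 0 0))

/-- The monomial function `z ↦ z^j` on `ℚ_p`. -/
noncomputable def monomialFun (j : ℕ) : ℚ_[p] → L := fun z => (iotaL p L z) ^ j

/-- The function `z ↦ (αp/β)^{val(z-a)} (z-a)^{k-2-j}` (extended by `0` at `z = a`). -/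
noncomputable def specFun (k : ℕ) (α β : L) (a : ℚ_[p]) (j : ℕ) : ℚ_[p] → L := fun z =>
  if z = a then 0 else
    (α * (p : L) / β) ^ ((z - a).valuation) * (iotaL p L (z - a)) ^ (k - 2 - j)

/-- The generators of `L(α)` : the functions `z^j` and
`(αp/β)^{val(z-a)}(z-a)^{k-2-j}` for `0 ≤ j < val(α)` and `a ∈ ℚ_p`. -/
def lGen (k : ℕ) (α β : L) : Set (ℚ_[p] → L) :=
  {f | ∃ j : ℕ, (j : ℝ) < valL p L α ∧
    (f = monomialFun p L j ∨ ∃ a : ℚ_[p], f = specFun p L k α β a j)}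

/-- Membership in `L(α)`, the closure in `B(α)` of the span of the special
functions. -/
def MemLalpha (k : ℕ) (α β : L) (f : ℚ_[p] → L) : Prop :=
  MemB p L k α β f ∧ ∀ ε : ℝ, 0 < ε →
    ∃ g ∈ Submodule.span L (lGen p L k α β), bNorm p L k α β (f - g) < ε

/-- The quotient (semi)norm on `Π(V) = B(α)/L(α)`. -/
noncomputable def qNorm (k : ℕ) (α β : L) (f : ℚ_[p] → L) : ℝ :=
  sInf {x : ℝ | ∃ g : ℚ_[p] → L, MemLalpha p L k α β g ∧ x = bNorm p L k α β (f - g)}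

/-- `h : ℚ_p → L` is locally constant. -/
def LocConst (h : ℚ_[p] → L) : Prop :=
  ∀ x : ℚ_[p], ∃ n : ℕ, ∀ y : ℚ_[p], ‖y - x‖ ≤ (p : ℝ) ^ (-(n : ℤ)) → h y = h x

/-- `h` belongs to the smooth induced representation: `h` is locally constant and
`z ↦ (αp/β)^{val z} h(1/z)` extends to a locally constant function on `ℚ_p`. -/
def IndCond (α β : L) (h : ℚ_[p] → L) : Prop :=
  LocConst p L h ∧ ∃ h' : ℚ_[p] → L, LocConst p L h' ∧
    ∀ z : ℚ_[p], z ≠ 0 → h' z = (α * (p : L) / β) ^ z.valuation * h z⁻¹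

/-- The generators `z ↦ P(z) h(z)` of the locally algebraic representation `π(α)`. -/
def piGen (k : ℕ) (α β : L) : Set (ℚ_[p] → L) :=
  {f | ∃ (P : Polynomial L) (h : ℚ_[p] → L), P.natDegree ≤ k - 2 ∧ IndCond p L α β h ∧
    f = fun z => Polynomial.eval (iotaL p L z) P * h z}

/-- The locally algebraic representation `π(α)`, as a subspace of functions
`ℚ_p → L`. -/
noncomputable def piRep (k : ℕ) (α β : L) : Submodule L (ℚ_[p] → L) :=
  Submodule.span L (piGen p L k α β)

/-- The standing hypotheses on `(k, α, β)` coming from an absolutely irreducible,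
`φ`-semisimple crystalline representation: `k ≥ 2`, `α ≠ β`,
`0 < val(β) ≤ val(α)` and `val(α) + val(β) = k - 1`. -/
def Hyps (k : ℕ) (α β : L) : Prop :=
  2 ≤ k ∧ α ≠ β ∧ 0 < valL p L α ∧ 0 < valL p L β ∧
    valL p L α + valL p L β = (k : ℝ) - 1 ∧ valL p L β ≤ valL p L α

/-- `Λ` is a `GL₂(ℚ_p)`-stable `𝒪_L`-lattice in `π(α)`: an `𝒪_L`-submodule of
`π(α)` generating it over `L`, containing no `L`-line and stable by the action. -/
def IsLatticeStable (k : ℕ) (α β : L) (Λ : Set (ℚ_[p] → L)) : Prop :=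
  (∀ f ∈ Λ, f ∈ piRep p L k α β) ∧ ((0 : ℚ_[p] → L) ∈ Λ) ∧
  (∀ f ∈ Λ, ∀ g ∈ Λ, f + g ∈ Λ) ∧
  (∀ c : L, ‖c‖ ≤ 1 → ∀ f ∈ Λ, c • f ∈ Λ) ∧
  (∀ f ∈ piRep p L k α β, ∃ c : L, c ≠ 0 ∧ c • f ∈ Λ) ∧
  (∀ f, f ∈ piRep p L k α β → f ≠ 0 → ¬ ∀ c : L, c • f ∈ Λ) ∧
  (∀ m : Matrix (Fin 2) (Fin 2) ℚ_[p], det2 p m ≠ 0 → ∀ f ∈ Λ, gAct p L k α β m f ∈ Λ)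

/-- The function `z ↦ z^j 1_{ℤ_p}(z)`. -/
noncomputable def genjFun (j : ℕ) : ℚ_[p] → L := fun z =>
  if ‖z‖ ≤ 1 then (iotaL p L z) ^ j else 0

/-- The explicit image `I(z^j 1_{ℤ_p})` of `z^j 1_{ℤ_p}` under the intertwining
operator `I : π(β) → π(α)`. -/
noncomputable def genjImageFun (k : ℕ) (α β : L) (j : ℕ) : ℚ_[p] → L := fun z =>
  if ‖z‖ ≤ 1 then ((1 - (p : L)⁻¹) / (1 - α / β)) * (iotaL p L z) ^ j
  else (iotaL p L z) ^ j * (α * (p : L) / β) ^ z.valuation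

/-- `Iop` is the standard intertwining operator `I : π(β) → π(α)`: it is
`L`-linear, `GL₂(ℚ_p)`-equivariant, and takes the prescribed values on the
generators `z^j 1_{ℤ_p}`. -/
def IopOk (k : ℕ) (α β : L) (Iop : (ℚ_[p] → L) → (ℚ_[p] → L)) : Prop :=
  (∀ f ∈ piRep p L k β α, Iop f ∈ piRep p L k α β) ∧
  (∀ f ∈ piRep p L k β α, ∀ g ∈ piRep p L k β α, Iop (f + g) = Iop f + Iop g) ∧
  (∀ c : L, ∀ f ∈ piRep p L k β α, Iop (c • f) = c • Iop f) ∧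
  (∀ m : Matrix (Fin 2) (Fin 2) ℚ_[p], det2 p m ≠ 0 → ∀ f ∈ piRep p L k β α,
    Iop (gAct p L k β α m f) = gAct p L k α β m (Iop f)) ∧
  (∀ j : ℕ, j ≤ k - 2 → Iop (genjFun p L j) = genjImageFun p L k α β j)

section MahlerTheory

set_option linter.unusedSectionVars false
set_option linter.style.haveILetI false

open fwdDiff

variable {p : ℕ} [hp : Fact p.Prime]
variable {L : Type} [NontriviallyNormedField L] [NormedAlgebra ℚ_[p] L]

/-- The action of an integral polynomial in the shift operator on functions `ℤ_p → L`. -/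
def shiftPoly (Q : Polynomial ℤ) (f : ℤ_[p] → L) : ℤ_[p] → L :=
  Polynomial.aeval (fwdDiff_aux.shiftₗ ℤ_[p] L 1) Q f

lemma mahlerCoeff_eq_fwdDiff (f : ℤ_[p] → L) (n : ℕ) :
    mahlerCoeff p L f n = (fwdDiff (1 : ℤ_[p]))^[n] f 0 := by
  rw [fwdDiff_iter_eq_sum_shift, mahlerCoeff, ← Finset.sum_range_reflect]
  refine Finset.sum_congr rfl fun i hi => ?_
  have hi' : i ≤ n := Nat.lt_succ_iff.mp (Finset.mem_range.mp hi)
  have e2 : n - (n - i) = i := by omega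
  simp [e2, Nat.choose_symm hi', zsmul_eq_mul]

lemma shiftPoly_mul (P Q : Polynomial ℤ) (f : ℤ_[p] → L) :
    shiftPoly (P * Q) f = shiftPoly P (shiftPoly Q f) := by
  simp [shiftPoly]

lemma shiftPoly_add (P Q : Polynomial ℤ) (f : ℤ_[p] → L) :
    shiftPoly (P + Q) f = shiftPoly P f + shiftPoly Q f := by
  simp [shiftPoly]

lemma shiftPoly_zero_fun (P : Polynomial ℤ) : shiftPoly P (0 : ℤ_[p] → L) = 0 := by
  simp [shiftPoly]

lemma shiftPoly_C_mul (c : ℤ) (P : Polynomial ℤ) (f : ℤ_[p] → L) :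
    shiftPoly (Polynomial.C c * P) f = c • shiftPoly P f := by
  simp [shiftPoly]

lemma shiftPoly_apply (Q : Polynomial ℤ) (f : ℤ_[p] → L) (x : ℤ_[p]) :
    shiftPoly Q f x = ∑ i ∈ Finset.range (Q.natDegree + 1), Q.coeff i • f (x + i) := by
  rw [shiftPoly, Polynomial.aeval_eq_sum_range]
  simp [fwdDiff_aux.shiftₗ_pow_apply, LinearMap.sum_apply, Finset.sum_apply]

lemma shiftPoly_X_pow_sub_one (n : ℕ) (f : ℤ_[p] → L) :
    shiftPoly (Polynomial.X ^ n - 1) f = fwdDiff (n : ℤ_[p]) f := by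
  ext x
  simp [shiftPoly, fwdDiff_aux.shiftₗ_pow_apply, fwdDiff]

lemma shiftPoly_X_pow_sub_one_pow (n m : ℕ) (f : ℤ_[p] → L) :
    shiftPoly ((Polynomial.X ^ n - 1) ^ m) f = (fwdDiff (n : ℤ_[p]))^[m] f := by
  induction m generalizing f with
  | zero => simp [shiftPoly]
  | succ m ih =>
    rw [pow_succ, shiftPoly_mul, shiftPoly_X_pow_sub_one, ih, Function.iterate_succ_apply]

lemma shiftPoly_X_sub_one_pow (m : ℕ) (f : ℤ_[p] → L) :
    shiftPoly ((Polynomial.X - 1) ^ m) f = (fwdDiff (1 : ℤ_[p]))^[m] f := by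
  simpa using shiftPoly_X_pow_sub_one_pow 1 m f

lemma continuous_shiftPoly (Q : Polynomial ℤ) {f : ℤ_[p] → L} (hf : Continuous f) :
    Continuous (shiftPoly Q f) := by
  have : shiftPoly Q f = fun x => ∑ i ∈ Finset.range (Q.natDegree + 1), Q.coeff i • f (x + i) :=
    funext (shiftPoly_apply Q f)
  rw [this]
  fun_prop

lemma norm_natCast_L (n : ℕ) : ‖(n : L)‖ = ‖(n : ℚ_[p])‖ := by
  rw [← norm_algebraMap' L (n : ℚ_[p]), map_natCast]

lemma norm_intCast_L (n : ℤ) : ‖(n : L)‖ = ‖(n : ℚ_[p])‖ := by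
  rw [← norm_algebraMap' L (n : ℚ_[p]), map_intCast]

lemma norm_p_L : ‖(p : L)‖ = (p : ℝ)⁻¹ := by
  rw [norm_natCast_L (p := p)]; simp

lemma norm_intCast_L_le_one (p : ℕ) [Fact p.Prime] [NormedAlgebra ℚ_[p] L] (n : ℤ) :
    ‖(n : L)‖ ≤ 1 := by
  rw [norm_intCast_L (p := p)]; exact Padic.norm_int_le_one n

lemma norm_iotaL (x : ℚ_[p]) : ‖iotaL p L x‖ = ‖x‖ := norm_algebraMap' L x

variable [IsUltrametricDist L]

lemma norm_shiftPoly_le (Q : Polynomial ℤ) {f : ℤ_[p] → L} {M : ℝ} (hM : 0 ≤ M)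
    (hf : ∀ x, ‖f x‖ ≤ M) (x : ℤ_[p]) : ‖shiftPoly Q f x‖ ≤ M := by
  rw [shiftPoly_apply]
  refine IsUltrametricDist.norm_sum_le_of_forall_le_of_nonneg hM fun i _ => ?_
  rw [zsmul_eq_mul, norm_mul]
  calc _ ≤ 1 * M := mul_le_mul (norm_intCast_L_le_one p _) (hf _) (norm_nonneg _) zero_le_one
    _ = M := one_mul _

lemma norm_fwdDiff_iter_le {f : ℤ_[p] → L} {M : ℝ} (hM : 0 ≤ M) (hf : ∀ x, ‖f x‖ ≤ M)
    (h : ℕ) (m : ℕ) (x : ℤ_[p]) : ‖(fwdDiff (h : ℤ_[p]))^[m] f x‖ ≤ M := by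
  rw [← shiftPoly_X_pow_sub_one_pow]
  exact norm_shiftPoly_le _ hM hf x

lemma binomQ_eq_choose (z : ℤ_[p]) (n : ℕ) : binomQ p z n = ((Ring.choose z n : ℤ_[p]) : ℚ_[p]) := by
  have h := Ring.descPochhammer_eq_factorial_smul_choose z n
  have h2 := congrArg (fun t : ℤ_[p] => (t : ℚ_[p])) h
  rw [binomQ, div_eq_iff (by exact_mod_cast n.factorial_ne_zero)]
  rw [← Polynomial.aeval_eq_smeval, Polynomial.aeval_def, Polynomial.eval₂_eq_eval_map,
    descPochhammer_map, descPochhammer_eval_eq_prod_range] at h2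
  simp only [nsmul_eq_mul, PadicInt.coe_mul, PadicInt.coe_natCast] at h2
  rw [mul_comm, ← h2, show ((∏ j ∈ Finset.range n, (z - (j : ℤ_[p])) : ℤ_[p]) : ℚ_[p]) =
    PadicInt.Coe.ringHom (∏ j ∈ Finset.range n, (z - (j : ℤ_[p]))) from rfl, map_prod]
  exact Finset.prod_congr rfl fun i _ => by rw [map_sub, map_natCast]; rfl

lemma norm_binomQ_le_one (z : ℤ_[p]) (n : ℕ) : ‖binomQ p z n‖ ≤ 1 := by
  rw [binomQ_eq_choose]; exact PadicInt.norm_le_one _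

variable [CompleteSpace L]

/-- The `ℤ_p`-module structure on `L`. -/
abbrev moduleZp : Module ℤ_[p] L := Module.compHom L (algebraMap ℤ_[p] ℚ_[p])

variable (p) in
lemma exists_mahler_series (a : ℕ → L) (ha : Tendsto a atTop (𝓝 0)) :
    ∃ f : ℤ_[p] → L, Continuous f ∧ (∀ n, mahlerCoeff p L f n = a n) ∧
      ∀ z, HasSum (fun n => a n * iotaL p L (binomQ p z n)) (f z) := by
  letI := moduleZp (p := p) (L := L)
  have hs : ∀ (x : ℤ_[p]) (y : L), x • y = iotaL p L x * y := fun x y =>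
    Algebra.smul_def (x : ℚ_[p]) y
  haveI : IsBoundedSMul ℤ_[p] L := IsBoundedSMul.of_norm_smul_le fun x y => by
    rw [hs, norm_mul, norm_iotaL]; rfl
  refine ⟨PadicInt.mahlerSeries a, (PadicInt.mahlerSeries a).continuous, fun n => ?_, fun z => ?_⟩
  · rw [mahlerCoeff_eq_fwdDiff]
    exact PadicInt.fwdDiff_mahlerSeries ha n
  · have := ContinuousMap.hasSum_apply (PadicInt.hasSum_mahlerSeries (p := p) ha) z
    have e : (fun n => a n * iotaL p L (binomQ p z n)) =
        fun n => (PadicInt.mahlerTerm (a n) n : C(ℤ_[p], L)) z := by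
      ext n
      rw [PadicInt.mahlerTerm_apply, hs, mahler_apply, binomQ_eq_choose, mul_comm]
    rw [e]
    exact this

lemma mahlerCoeff_tendsto {f : ℤ_[p] → L} (hf : Continuous f) :
    Tendsto (mahlerCoeff p L f) atTop (𝓝 0) := by
  letI := moduleZp (p := p) (L := L)
  have hs : ∀ (x : ℤ_[p]) (y : L), x • y = iotaL p L x * y := fun x y =>
    Algebra.smul_def (x : ℚ_[p]) y
  haveI : IsBoundedSMul ℤ_[p] L := IsBoundedSMul.of_norm_smul_le fun x y => by
    rw [hs, norm_mul, norm_iotaL]; rfl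
  have := PadicInt.fwdDiff_tendsto_zero (⟨f, hf⟩ : C(ℤ_[p], L))
  refine this.congr fun n => ?_
  rw [mahlerCoeff_eq_fwdDiff]; rfl

lemma mahlerCoeff_injective {f g : ℤ_[p] → L} (hf : Continuous f) (hg : Continuous g)
    (h : ∀ n, mahlerCoeff p L f n = mahlerCoeff p L g n) : f = g := by
  refine Continuous.ext_on PadicInt.denseRange_natCast hf hg ?_
  rintro _ ⟨n, rfl⟩
  have h1 := shift_eq_sum_fwdDiff_iter (1 : ℤ_[p]) f n 0
  have h2 := shift_eq_sum_fwdDiff_iter (1 : ℤ_[p]) g n 0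
  simp only [← mahlerCoeff_eq_fwdDiff, zero_add, nsmul_eq_mul, mul_one] at h1 h2
  rw [h1, h2]; simp [h]

lemma hasSum_mahler {f : ℤ_[p] → L} (hf : Continuous f) (z : ℤ_[p]) :
    HasSum (fun n => mahlerCoeff p L f n * iotaL p L (binomQ p z n)) (f z) := by
  obtain ⟨g, hg, hc, hs⟩ := exists_mahler_series p _ (mahlerCoeff_tendsto hf)
  rw [mahlerCoeff_injective hf hg fun n => (hc n).symm]
  convert hs z using 3 with n
  rw [mahlerCoeff_injective hf hg fun n => (hc n).symm]

lemma norm_le_of_hasSum {ι : Type*} {a : ι → L} {s : L} (h : HasSum a s) {M : ℝ} (hM : 0 ≤ M)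
    (ha : ∀ i, ‖a i‖ ≤ M) : ‖s‖ ≤ M :=
  le_of_tendsto h.norm (Eventually.of_forall fun _ =>
    IsUltrametricDist.norm_sum_le_of_forall_le_of_nonneg hM fun i _ => ha i)

lemma norm_le_of_mahlerCoeff_le {f : ℤ_[p] → L} (hf : Continuous f) {M : ℝ}
    (h : ∀ n, ‖mahlerCoeff p L f n‖ ≤ M) (z : ℤ_[p]) : ‖f z‖ ≤ M := by
  have hM : 0 ≤ M := (norm_nonneg _).trans (h 0)
  refine norm_le_of_hasSum (hasSum_mahler hf z) hM fun n => ?_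
  rw [norm_mul, norm_iotaL]
  exact (mul_le_mul (h n) (norm_binomQ_le_one z n) (norm_nonneg _) hM).trans_eq (mul_one M)

end MahlerTheory

section CrSpace

set_option linter.unusedSectionVars false

variable {p : ℕ} [hp : Fact p.Prime]
variable {L : Type} [NontriviallyNormedField L] [NormedAlgebra ℚ_[p] L]

lemma mahlerCoeff_add (f g : ℤ_[p] → L) (n : ℕ) :
    mahlerCoeff p L (f + g) n = mahlerCoeff p L f n + mahlerCoeff p L g n := by
  simp [mahlerCoeff, mul_add, Finset.sum_add_distrib]

lemma mahlerCoeff_smul (c : L) (f : ℤ_[p] → L) (n : ℕ) :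
    mahlerCoeff p L (c • f) n = c * mahlerCoeff p L f n := by
  simp only [mahlerCoeff, Finset.mul_sum, Pi.smul_apply, smul_eq_mul]
  exact Finset.sum_congr rfl fun i _ => by ring

lemma mahlerCoeff_sub (f g : ℤ_[p] → L) (n : ℕ) :
    mahlerCoeff p L (f - g) n = mahlerCoeff p L f n - mahlerCoeff p L g n := by
  simp [mahlerCoeff, mul_sub, Finset.sum_sub_distrib]

lemma mahlerCoeff_zero (n : ℕ) : mahlerCoeff p L (0 : ℤ_[p] → L) n = 0 := by
  simp [mahlerCoeff]

variable [IsUltrametricDist L] [CompleteSpace L] {r : ℝ}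

lemma IsCr.coeff_tendsto {f : ℤ_[p] → L} (hr : 0 < r) (h : IsCr p L r f) :
    Tendsto (mahlerCoeff p L f) atTop (𝓝 0) := by
  rw [tendsto_zero_iff_norm_tendsto_zero]
  refine squeeze_zero' (Eventually.of_forall fun _ => norm_nonneg _) ?_ h.1
  filter_upwards [eventually_ge_atTop 1] with n hn
  have : (1 : ℝ) ≤ (n : ℝ) ^ r := Real.one_le_rpow (by exact_mod_cast hn) hr.le
  nlinarith [norm_nonneg (mahlerCoeff p L f n)]

lemma IsCr.continuous {f : ℤ_[p] → L} (hr : 0 < r) (h : IsCr p L r f) : Continuous f := by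
  obtain ⟨g, hg, _, hs⟩ := exists_mahler_series p _ (h.coeff_tendsto hr)
  have : f = g := funext fun z => (h.2 z).unique (hs z)
  rwa [this]

lemma IsCr.tendsto {f : ℤ_[p] → L} (hr : 0 < r) (h : IsCr p L r f) :
    Tendsto (fun n : ℕ => ((n : ℝ) + 1) ^ r * ‖mahlerCoeff p L f n‖) atTop (𝓝 0) := by
  have h1 := h.1.const_mul ((2 : ℝ) ^ r)
  rw [mul_zero] at h1
  refine squeeze_zero' (Eventually.of_forall fun n => by positivity) ?_ h1
  filter_upwards [eventually_ge_atTop 1] with n hn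
  rw [← mul_assoc, ← Real.mul_rpow (by norm_num) (by positivity)]
  have hn' : (1 : ℝ) ≤ n := by exact_mod_cast hn
  gcongr
  linarith

lemma isCr_of_tendsto {f : ℤ_[p] → L} (hr : 0 < r) (hf : Continuous f)
    (h : Tendsto (fun n : ℕ => ((n : ℝ) + 1) ^ r * ‖mahlerCoeff p L f n‖) atTop (𝓝 0)) :
    IsCr p L r f := by
  refine ⟨squeeze_zero (fun n => by positivity) (fun n => ?_) h, hasSum_mahler hf⟩
  gcongr
  linarith

lemma IsCr.bddAbove {f : ℤ_[p] → L} (hr : 0 < r) (h : IsCr p L r f) :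
    BddAbove (Set.range fun n : ℕ => ((n : ℝ) + 1) ^ r * ‖mahlerCoeff p L f n‖) :=
  (h.tendsto hr).bddAbove_range

lemma IsCr.le_crNorm {f : ℤ_[p] → L} (hr : 0 < r) (h : IsCr p L r f) (n : ℕ) :
    ((n : ℝ) + 1) ^ r * ‖mahlerCoeff p L f n‖ ≤ crNorm p L r f :=
  le_ciSup (h.bddAbove hr) n

lemma crNorm_le {f : ℤ_[p] → L} {M : ℝ}
    (h : ∀ n : ℕ, ((n : ℝ) + 1) ^ r * ‖mahlerCoeff p L f n‖ ≤ M) : crNorm p L r f ≤ M :=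
  ciSup_le h

lemma crNorm_nonneg (f : ℤ_[p] → L) : 0 ≤ crNorm p L r f :=
  Real.iSup_nonneg fun _ => by positivity

lemma IsCr.norm_coeff_le {f : ℤ_[p] → L} (hr : 0 < r) (h : IsCr p L r f) (n : ℕ) :
    ‖mahlerCoeff p L f n‖ ≤ crNorm p L r f := by
  refine le_trans ?_ (h.le_crNorm hr n)
  exact le_mul_of_one_le_left (norm_nonneg _) (Real.one_le_rpow (by simp) hr.le)

lemma IsCr.norm_apply_le {f : ℤ_[p] → L} (hr : 0 < r) (h : IsCr p L r f) (z : ℤ_[p]) :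
    ‖f z‖ ≤ crNorm p L r f :=
  norm_le_of_mahlerCoeff_le (h.continuous hr) (h.norm_coeff_le hr) z

lemma IsCr.add {f g : ℤ_[p] → L} (hf : IsCr p L r f) (hg : IsCr p L r g) :
    IsCr p L r (f + g) := by
  constructor
  · have := hf.1.add hg.1
    rw [add_zero] at this
    refine squeeze_zero (fun n => by positivity) (fun n => ?_) this
    rw [mahlerCoeff_add, ← mul_add]
    gcongr
    exact norm_add_le _ _
  · intro z
    simpa [mahlerCoeff_add, add_mul] using (hf.2 z).add (hg.2 z)

lemma IsCr.smul {f : ℤ_[p] → L} (c : L) (hf : IsCr p L r f) : IsCr p L r (c • f) := by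
  constructor
  · have := hf.1.const_mul ‖c‖
    rw [mul_zero] at this
    refine this.congr fun n => ?_
    rw [mahlerCoeff_smul, norm_mul]; ring
  · intro z
    simpa [mahlerCoeff_smul, mul_assoc] using (hf.2 z).mul_left c

lemma isCr_zero : IsCr p L r 0 := by
  constructor
  · simp [mahlerCoeff_zero]
  · intro z
    simp [mahlerCoeff_zero]

variable (p L r)

/-- The subspace of class-`C^r` functions. -/
def crSub : Submodule L (ℤ_[p] → L) where
  carrier := {f | IsCr p L r f}
  add_mem' := IsCr.add
  zero_mem' := isCr_zero
  smul_mem' c _ h := h.smul c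

/-- The Banach space of class-`C^r` functions. -/
def CrSp : Type := ↥(crSub p L r)

instance : AddCommGroup (CrSp p L r) := inferInstanceAs (AddCommGroup ↥(crSub p L r))

instance : Module L (CrSp p L r) := inferInstanceAs (Module L ↥(crSub p L r))

instance : Norm (CrSp p L r) := ⟨fun f => crNorm p L r f.1⟩

variable {p L r}

/-- The underlying function of an element of `CrSp`. -/
def CrSp.fn (f : CrSp p L r) : ℤ_[p] → L := f.1

lemma CrSp.isCr (f : CrSp p L r) : IsCr p L r f.fn := f.2

lemma CrSp.fn_add (f g : CrSp p L r) : (f + g).fn = f.fn + g.fn := rfl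

lemma CrSp.fn_sub (f g : CrSp p L r) : (f - g).fn = f.fn - g.fn := rfl

lemma CrSp.fn_smul (c : L) (f : CrSp p L r) : (c • f).fn = c • f.fn := rfl

lemma CrSp.fn_zero : (0 : CrSp p L r).fn = 0 := rfl

lemma CrSp.norm_def (f : CrSp p L r) : ‖f‖ = crNorm p L r f.fn := rfl

lemma CrSp.fn_injective : Function.Injective (CrSp.fn : CrSp p L r → _) := Subtype.val_injective

/-- Constructor for `CrSp`. -/
def CrSp.mk (f : ℤ_[p] → L) (h : IsCr p L r f) : CrSp p L r := ⟨f, h⟩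

@[simp] lemma CrSp.fn_mk (f : ℤ_[p] → L) (h : IsCr p L r f) : (CrSp.mk f h).fn = f := rfl

variable [hr : Fact (0 < r)]

lemma CrSp.add_le_max (f g : CrSp p L r) : ‖f + g‖ ≤ max ‖f‖ ‖g‖ := by
  refine crNorm_le fun n => ?_
  change _ * ‖mahlerCoeff p L (f.fn + g.fn) n‖ ≤ _
  rw [mahlerCoeff_add]
  calc _ ≤ ((n : ℝ) + 1) ^ r * max ‖mahlerCoeff p L f.fn n‖ ‖mahlerCoeff p L g.fn n‖ := by
        gcongr; exact IsUltrametricDist.norm_add_le_max _ _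
    _ ≤ _ := by
        rw [mul_max_of_nonneg _ _ (by positivity)]
        exact max_le_max (f.isCr.le_crNorm hr.out n) (g.isCr.le_crNorm hr.out n)

lemma CrSp.core : NormedSpace.Core L (CrSp p L r) where
  norm_nonneg f := crNorm_nonneg _
  norm_smul c f := by
    change crNorm p L r (c • f.fn) = ‖c‖ * crNorm p L r f.fn
    rw [crNorm, crNorm, Real.mul_iSup_of_nonneg (norm_nonneg c)]
    congr 1
    ext n
    rw [mahlerCoeff_smul, norm_mul]; ring
  norm_triangle f g := (CrSp.add_le_max f g).trans
    (max_le_add_of_nonneg (crNorm_nonneg _) (crNorm_nonneg _))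
  norm_eq_zero_iff f := by
    constructor
    · intro h
      refine CrSp.fn_injective (funext fun z => ?_)
      have := f.isCr.norm_apply_le hr.out z
      rw [← CrSp.norm_def, h] at this
      simpa [CrSp.fn_zero] using this
    · rintro rfl
      refine le_antisymm (crNorm_le fun n => ?_) (crNorm_nonneg _)
      change _ * ‖mahlerCoeff p L 0 n‖ ≤ _
      simp [mahlerCoeff_zero]

instance : NormedAddCommGroup (CrSp p L r) := NormedAddCommGroup.ofCore CrSp.core

instance : NormedSpace L (CrSp p L r) := NormedSpace.ofCore CrSp.core

instance : IsUltrametricDist (CrSp p L r) :=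
  IsUltrametricDist.isUltrametricDist_of_forall_norm_add_le_max_norm CrSp.add_le_max

lemma CrSp.norm_apply_le (f : CrSp p L r) (z : ℤ_[p]) : ‖f.fn z‖ ≤ ‖f‖ :=
  f.isCr.norm_apply_le hr.out z

lemma CrSp.norm_le {f : CrSp p L r} {M : ℝ}
    (h : ∀ n : ℕ, ((n : ℝ) + 1) ^ r * ‖mahlerCoeff p L f.fn n‖ ≤ M) : ‖f‖ ≤ M := crNorm_le h

lemma CrSp.le_norm (f : CrSp p L r) (n : ℕ) :
    ((n : ℝ) + 1) ^ r * ‖mahlerCoeff p L f.fn n‖ ≤ ‖f‖ := f.isCr.le_crNorm hr.out n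

/-- Evaluation at a point as a continuous linear functional. -/
def CrSp.evalL (z : ℤ_[p]) : CrSp p L r →L[L] L :=
  LinearMap.mkContinuous
    { toFun := fun f => f.fn z, map_add' := fun _ _ => rfl, map_smul' := fun _ _ => rfl } 1
    fun f => by rw [one_mul]; exact f.norm_apply_le z

instance : CompleteSpace (CrSp p L r) := by
  refine Metric.complete_of_cauchySeq_tendsto fun u hu => ?_
  have hmu : ∀ (m l n : ℕ), ((n : ℝ) + 1) ^ r *
      ‖mahlerCoeff p L (u m).fn n - mahlerCoeff p L (u l).fn n‖ ≤ ‖u m - u l‖ := by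
    intro m l n
    rw [← mahlerCoeff_sub]
    exact (u m - u l).le_norm n
  have hc : ∀ n, CauchySeq fun m => mahlerCoeff p L (u m).fn n := by
    intro n
    rw [Metric.cauchySeq_iff] at hu ⊢
    intro ε hε
    obtain ⟨N, hN⟩ := hu ε hε
    refine ⟨N, fun m hm l hl => lt_of_le_of_lt ?_ (hN m hm l hl)⟩
    rw [dist_eq_norm, dist_eq_norm]
    refine le_trans ?_ (hmu m l n)
    exact le_mul_of_one_le_left (norm_nonneg _) (Real.one_le_rpow (by simp) hr.out.le)
  choose b hb using fun n => cauchySeq_tendsto_of_complete (hc n)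
  have key : ∀ ε > 0, ∃ N, ∀ m ≥ N, ∀ n : ℕ,
      ((n : ℝ) + 1) ^ r * ‖mahlerCoeff p L (u m).fn n - b n‖ ≤ ε := by
    intro ε hε
    obtain ⟨N, hN⟩ := Metric.cauchySeq_iff.1 hu ε hε
    refine ⟨N, fun m hm n => ?_⟩
    have ht : Tendsto (fun l => ((n : ℝ) + 1) ^ r *
        ‖mahlerCoeff p L (u m).fn n - mahlerCoeff p L (u l).fn n‖) atTop
        (𝓝 (((n : ℝ) + 1) ^ r * ‖mahlerCoeff p L (u m).fn n - b n‖)) :=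
      ((tendsto_const_nhds.sub (hb n)).norm).const_mul _
    refine le_of_tendsto ht ?_
    filter_upwards [eventually_ge_atTop N] with l hl
    have := hN m hm l hl
    rw [dist_eq_norm] at this
    exact (hmu m l n).trans this.le
  have hbt : Tendsto (fun n : ℕ => ((n : ℝ) + 1) ^ r * ‖b n‖) atTop (𝓝 0) := by
    rw [Metric.tendsto_atTop]
    intro ε hε
    obtain ⟨N, hN⟩ := key (ε / 2) (half_pos hε)
    obtain ⟨M, hM⟩ := Metric.tendsto_atTop.1 ((u N).isCr.tendsto hr.out) (ε / 2) (half_pos hε)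
    refine ⟨M, fun n hn => ?_⟩
    have h1 := hN N le_rfl n
    have h2 := hM n hn
    rw [Real.dist_eq, sub_zero, abs_of_nonneg (by positivity)] at h2 ⊢
    have h3 : ‖b n‖ ≤ ‖mahlerCoeff p L (u N).fn n - b n‖ + ‖mahlerCoeff p L (u N).fn n‖ := by
      rw [norm_sub_rev]
      simpa using norm_add_le (b n - mahlerCoeff p L (u N).fn n) (mahlerCoeff p L (u N).fn n)
    have h4 : (0 : ℝ) ≤ ((n : ℝ) + 1) ^ r := by positivity
    nlinarith [mul_le_mul_of_nonneg_left h3 h4]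
  have hb0 : Tendsto b atTop (𝓝 0) := by
    rw [tendsto_zero_iff_norm_tendsto_zero]
    refine squeeze_zero (fun _ => norm_nonneg _) (fun n => ?_) hbt
    exact le_mul_of_one_le_left (norm_nonneg _) (Real.one_le_rpow (by simp) hr.out.le)
  obtain ⟨f, hf, hfb, _⟩ := exists_mahler_series p b hb0
  refine ⟨CrSp.mk f (isCr_of_tendsto hr.out hf (by simpa only [hfb] using hbt)), ?_⟩
  rw [Metric.tendsto_atTop]
  intro ε hε
  obtain ⟨N, hN⟩ := key (ε / 2) (half_pos hε)
  refine ⟨N, fun m hm => lt_of_le_of_lt ?_ (half_lt_self hε)⟩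
  rw [dist_eq_norm]
  refine CrSp.norm_le fun n => ?_
  rw [CrSp.fn_sub, mahlerCoeff_sub, CrSp.fn_mk, hfb]
  exact hN m hm n

end CrSpace

section LocPoly

set_option linter.unusedSectionVars false

open Polynomial

lemma exists_X_sub_one_pow_prime_pow (p : ℕ) [Fact p.Prime] (h : ℕ) :
    ∃ Q : ℤ[X], (X - 1 : ℤ[X]) ^ p ^ h = (X ^ p ^ h - 1) + C (p : ℤ) * Q := by
  have : C (p : ℤ) ∣ (X - 1 : ℤ[X]) ^ p ^ h - (X ^ p ^ h - 1) := by
    rw [C_dvd_iff_dvd_coeff]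
    intro i
    rw [← ZMod.intCast_zmod_eq_zero_iff_dvd _ p, ← eq_intCast (Int.castRingHom (ZMod p)), ← coeff_map]
    have : Polynomial.map (Int.castRingHom (ZMod p)) ((X - 1 : ℤ[X]) ^ p ^ h - (X ^ p ^ h - 1)) = 0 := by
      simp [sub_pow_char_pow]
    rw [this, coeff_zero]
  obtain ⟨Q, hQ⟩ := this
  exact ⟨Q, by rw [← hQ]; ring⟩

lemma exists_X_sub_one_pow (p : ℕ) [Fact p.Prime] (h e q m : ℕ) (hm : q * (e * p ^ h) ≤ m) :
    ∃ R S : ℤ[X], (X - 1 : ℤ[X]) ^ m = C ((p : ℤ) ^ q) * R + S * (X ^ p ^ h - 1) ^ e := by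
  obtain ⟨Q, hQ⟩ := exists_X_sub_one_pow_prime_pow p h
  obtain ⟨Q', hQ'⟩ : ∃ Q' : ℤ[X], (X - 1 : ℤ[X]) ^ (e * p ^ h) =
      (X ^ p ^ h - 1) ^ e + C (p : ℤ) * Q' := by
    obtain ⟨T, hT⟩ := sub_dvd_pow_sub_pow ((X - 1 : ℤ[X]) ^ p ^ h) (X ^ p ^ h - 1) e
    refine ⟨Q * T, ?_⟩
    rw [mul_comm e, pow_mul]
    rw [hQ] at hT ⊢
    linear_combination hT
  obtain ⟨T, hT⟩ := sub_dvd_pow_sub_pow ((X - 1 : ℤ[X]) ^ (e * p ^ h)) (C (p : ℤ) * Q') q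
  refine ⟨(X - 1) ^ (m - q * (e * p ^ h)) * Q' ^ q, (X - 1) ^ (m - q * (e * p ^ h)) * T, ?_⟩
  have e1 : (X - 1 : ℤ[X]) ^ m =
      (X - 1) ^ (m - q * (e * p ^ h)) * ((X - 1) ^ (e * p ^ h)) ^ q := by
    rw [← pow_mul, ← pow_add]; congr 1; rw [mul_comm (e * p ^ h) q]; omega
  rw [e1, C_pow]
  rw [hQ'] at hT ⊢
  linear_combination ((X - 1 : ℤ[X]) ^ (m - q * (e * p ^ h))) * hT

variable {p : ℕ} [hp : Fact p.Prime]
variable {L : Type} [NontriviallyNormedField L] [NormedAlgebra ℚ_[p] L]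

/-- `f` is polynomial of degree less than `e` on every ball of radius `p^{-h}`. -/
def LP (e h : ℕ) (f : ℤ_[p] → L) : Prop :=
  ∀ z : ℤ_[p], ∃ P : L[X], P.natDegree < e ∧
    ∀ s : ℤ_[p], f (z + (p : ℤ_[p]) ^ h * s) = P.eval (iotaL p L s)

lemma iotaL_natCast (n : ℕ) : iotaL p L (n : ℚ_[p]) = n := map_natCast _ n

lemma LP.fwdDiff_eq_zero {e h : ℕ} {f : ℤ_[p] → L} (hf : LP e h f) :
    (fwdDiff ((p ^ h : ℕ) : ℤ_[p]))^[e] f = 0 := by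
  ext z
  obtain ⟨P, hP, hs⟩ := hf z
  have h1 := congrFun (Polynomial.fwdDiff_iter_eq_zero_of_degree_lt hP) 0
  rw [fwdDiff_iter_eq_sum_shift] at h1 ⊢
  rw [Pi.zero_apply] at h1 ⊢
  rw [← h1]
  refine Finset.sum_congr rfl fun i _ => ?_
  congr 1
  have := hs (i : ℤ_[p])
  rw [PadicInt.coe_natCast, iotaL_natCast] at this
  simpa [mul_comm] using this

lemma padicInt_dvd_iff {h : ℕ} {x : ℤ_[p]} :
    (p : ℤ_[p]) ^ h ∣ x ↔ ‖x‖ ≤ (p : ℝ) ^ (-(h : ℤ)) := by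
  rw [PadicInt.norm_le_pow_iff_mem_span_pow, Ideal.mem_span_singleton]

lemma continuous_iotaL : Continuous (iotaL p L) := continuous_algebraMap ℚ_[p] L

lemma LP.continuous {e h : ℕ} {f : ℤ_[p] → L} (hf : LP e h f) : Continuous f := by
  rw [continuous_iff_continuousAt]
  intro z
  obtain ⟨P, -, hs⟩ := hf z
  -- on the ball around `z` the function is a polynomial in `y`
  have hp0 : (p : ℚ_[p]) ≠ 0 := by exact_mod_cast hp.out.ne_zero
  have hev : f =ᶠ[𝓝 z] fun y : ℤ_[p] =>
      P.eval (iotaL p L (((y : ℚ_[p]) - z) / (p : ℚ_[p]) ^ h)) := by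
    filter_upwards [Metric.closedBall_mem_nhds z (ε := (p : ℝ) ^ (-(h : ℤ)))
      (zpow_pos (by exact_mod_cast hp.out.pos) _)] with y hy
    rw [mem_closedBall_iff_norm, ← padicInt_dvd_iff] at hy
    obtain ⟨s, hs'⟩ := hy
    have : y = z + (p : ℤ_[p]) ^ h * s := by rw [← hs']; ring
    rw [this, hs]
    congr 2
    push_cast
    field_simp
    ring
  refine ContinuousAt.congr ?_ hev.symm
  refine Continuous.continuousAt ?_
  refine P.continuous.comp (continuous_iotaL.comp ?_)
  fun_prop

lemma LP.mono_level {e h h' : ℕ} (hh : h ≤ h') {f : ℤ_[p] → L} (hf : LP e h f) : LP e h' f := by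
  intro z
  obtain ⟨P, hP, hs⟩ := hf z
  refine ⟨P.comp (C ((p : L) ^ (h' - h)) * X), ?_, fun s => ?_⟩
  · refine lt_of_le_of_lt natDegree_comp_le (lt_of_le_of_lt ?_ hP)
    exact (Nat.mul_le_mul_left _ ((natDegree_C_mul_le _ _).trans natDegree_X_le)).trans_eq (mul_one _)
  · have := hs ((p : ℤ_[p]) ^ (h' - h) * s)
    rw [← mul_assoc, ← pow_add, Nat.add_sub_cancel' hh] at this
    rw [this]
    simp [iotaL]

lemma LP.mono_degree {e e' h : ℕ} (hh : e ≤ e') {f : ℤ_[p] → L} (hf : LP e h f) : LP e' h f := by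
  intro z
  obtain ⟨P, hP, hs⟩ := hf z
  exact ⟨P, hP.trans_le hh, hs⟩

lemma LP.sub {e h : ℕ} {f g : ℤ_[p] → L} (hf : LP e h f) (hg : LP e h g) : LP e h (f - g) := by
  intro z
  obtain ⟨P, hP, hs⟩ := hf z
  obtain ⟨Q, hQ, ht⟩ := hg z
  refine ⟨P - Q, lt_of_le_of_lt (natDegree_sub_le _ _) (max_lt hP hQ), fun s => ?_⟩
  rw [Pi.sub_apply, hs, ht, eval_sub]

lemma LP.add {e h : ℕ} {f g : ℤ_[p] → L} (hf : LP e h f) (hg : LP e h g) : LP e h (f + g) := by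
  intro z
  obtain ⟨P, hP, hs⟩ := hf z
  obtain ⟨Q, hQ, ht⟩ := hg z
  refine ⟨P + Q, lt_of_le_of_lt (natDegree_add_le _ _) (max_lt hP hQ), fun s => ?_⟩
  rw [Pi.add_apply, hs, ht, eval_add]

lemma LP.smul {e h : ℕ} {f : ℤ_[p] → L} (c : L) (hf : LP e h f) : LP e h (c • f) := by
  intro z
  obtain ⟨P, hP, hs⟩ := hf z
  refine ⟨c • P, lt_of_le_of_lt (natDegree_smul_le _ _) hP, fun s => ?_⟩
  rw [Pi.smul_apply, hs, eval_smul]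

variable [IsUltrametricDist L]

lemma norm_mahlerCoeff_le_of_fwdDiff_eq_zero {e h : ℕ} {f : ℤ_[p] → L}
    (hf : (fwdDiff ((p ^ h : ℕ) : ℤ_[p]))^[e] f = 0) {M : ℝ} (hM : ∀ x, ‖f x‖ ≤ M) (m : ℕ) :
    ‖mahlerCoeff p L f m‖ ≤ ((p : ℝ)⁻¹) ^ (m / (e * p ^ h)) * M := by
  obtain ⟨R, S, hRS⟩ := exists_X_sub_one_pow p h e (m / (e * p ^ h)) m (Nat.div_mul_le_self _ _)
  have hM0 : 0 ≤ M := (norm_nonneg _).trans (hM 0)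
  rw [mahlerCoeff_eq_fwdDiff, ← shiftPoly_X_sub_one_pow, hRS, shiftPoly_add, shiftPoly_mul S,
    shiftPoly_X_pow_sub_one_pow, hf, shiftPoly_zero_fun, add_zero, shiftPoly_C_mul,
    Pi.smul_apply, zsmul_eq_mul, norm_mul]
  push_cast
  rw [norm_pow, norm_p_L]
  gcongr
  exact norm_shiftPoly_le _ hM0 hM 0

lemma tendsto_rpow_mul_inv_pow (p : ℕ) [hp : Fact p.Prime] (r : ℝ) :
    Tendsto (fun q : ℕ => ((q : ℝ) + 1) ^ r * ((p : ℝ)⁻¹) ^ q) atTop (𝓝 0) := by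
  have hp1 : (1 : ℝ) < p := by exact_mod_cast hp.out.one_lt
  obtain ⟨N, hN⟩ := exists_nat_ge r
  have h1 : Tendsto (fun q : ℕ => (q : ℝ) ^ N * ((p : ℝ)⁻¹) ^ q) atTop (𝓝 0) :=
    tendsto_pow_const_mul_const_pow_of_abs_lt_one N
      (by rw [abs_of_pos (by positivity)]; exact inv_lt_one_of_one_lt₀ hp1)
  have h2 := (((tendsto_add_atTop_iff_nat 1).2 h1)).const_mul (p : ℝ)
  rw [mul_zero] at h2
  refine squeeze_zero (fun q => by positivity) (fun q => ?_) h2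
  have : ((q : ℝ) + 1) ^ r ≤ ((q : ℝ) + 1) ^ N := by
    rw [← Real.rpow_natCast]
    exact Real.rpow_le_rpow_of_exponent_le (by simp) hN
  push_cast
  rw [pow_succ ((p : ℝ)⁻¹)]
  have e : (p : ℝ) * (((q : ℝ) + 1) ^ N * ((p : ℝ)⁻¹ ^ q * (p : ℝ)⁻¹)) =
    ((q : ℝ) + 1) ^ N * (p : ℝ)⁻¹ ^ q := by field_simp
  rw [e]
  gcongr

variable [CompleteSpace L]

theorem isCr_of_fwdDiff_eq_zero (p : ℕ) [hp : Fact p.Prime] (L : Type) [NontriviallyNormedField L]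
    [NormedAlgebra ℚ_[p] L] [IsUltrametricDist L] [CompleteSpace L]
    {r : ℝ} (hr : 0 < r) {e : ℕ} (he : 0 < e) : ∃ C : ℝ, 0 < C ∧
    ∀ (h : ℕ) (f : ℤ_[p] → L) (M : ℝ), Continuous f →
      (fwdDiff ((p ^ h : ℕ) : ℤ_[p]))^[e] f = 0 → (∀ x, ‖f x‖ ≤ M) →
      IsCr p L r f ∧ crNorm p L r f ≤ C * ((p : ℝ) ^ h) ^ r * M := by
  obtain ⟨K, hK⟩ := (tendsto_rpow_mul_inv_pow p r).bddAbove_range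
  have hK' : ∀ q : ℕ, ((q : ℝ) + 1) ^ r * ((p : ℝ)⁻¹) ^ q ≤ K := fun q => hK ⟨q, rfl⟩
  have hp0 : (0 : ℝ) < p := by exact_mod_cast hp.out.pos
  have he0 : (0 : ℝ) < e := by exact_mod_cast he
  have hKpos : 0 < K := lt_of_lt_of_le (by positivity) (hK' 0)
  refine ⟨(e : ℝ) ^ r * K, by positivity, fun h f M hc hf hM => ?_⟩
  have hM0 : 0 ≤ M := (norm_nonneg _).trans (hM 0)
  have hD : 0 < e * p ^ h := Nat.mul_pos he (pow_pos hp.out.pos h)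
  have key : ∀ m : ℕ, ((m : ℝ) + 1) ^ r * ‖mahlerCoeff p L f m‖ ≤
      ((e : ℝ) * (p : ℝ) ^ h) ^ r * M *
        ((((m / (e * p ^ h) : ℕ) : ℝ) + 1) ^ r * ((p : ℝ)⁻¹) ^ (m / (e * p ^ h))) := by
    intro m
    have h1 : ((m : ℝ) + 1) ≤ ((e : ℝ) * (p : ℝ) ^ h) * (((m / (e * p ^ h) : ℕ) : ℝ) + 1) := by
      have : m + 1 ≤ (e * p ^ h) * (m / (e * p ^ h) + 1) := Nat.lt_mul_div_succ m hD
      exact_mod_cast this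
    calc _ ≤ (((e : ℝ) * (p : ℝ) ^ h) * (((m / (e * p ^ h) : ℕ) : ℝ) + 1)) ^ r *
          (((p : ℝ)⁻¹) ^ (m / (e * p ^ h)) * M) := by
          gcongr
          exact norm_mahlerCoeff_le_of_fwdDiff_eq_zero hf hM m
      _ = _ := by
          rw [Real.mul_rpow (by positivity) (by positivity)]; ring
  constructor
  · refine isCr_of_tendsto hr hc ?_
    have hdiv : Tendsto (fun m : ℕ => m / (e * p ^ h)) atTop atTop :=
      Nat.tendsto_div_const_atTop hD.ne'
    have := ((tendsto_rpow_mul_inv_pow p r).comp hdiv).const_mul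
      (((e : ℝ) * (p : ℝ) ^ h) ^ r * M)
    rw [mul_zero] at this
    exact squeeze_zero (fun m => by positivity) key this
  · refine crNorm_le fun m => (key m).trans ?_
    calc _ ≤ ((e : ℝ) * (p : ℝ) ^ h) ^ r * M * K := by gcongr; exact hK' _
      _ = _ := by rw [Real.mul_rpow (by positivity) (by positivity)]; ring

end LocPoly

section Interpolation

set_option linter.unusedSectionVars false

open Polynomial

variable {p : ℕ} [hp : Fact p.Prime]

lemma norm_choose_prime_pow_le (h j : ℕ) :
    ‖((p ^ h).choose j : ℚ_[p])‖ * (p : ℝ) ^ h ≤ j ∨ j = 0 := by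
  rcases Nat.eq_zero_or_pos j with hj | hj
  · exact Or.inr hj
  left
  obtain ⟨i, rfl⟩ := Nat.exists_eq_succ_of_ne_zero hj.ne'
  have hp0 : (0 : ℝ) < p := by exact_mod_cast hp.out.pos
  have h1 : (p ^ h) * (p ^ h - 1).choose i = (p ^ h).choose (i + 1) * (i + 1) := by
    have := Nat.add_one_mul_choose_eq (p ^ h - 1) i
    rwa [Nat.sub_add_cancel (Nat.one_le_pow _ _ hp.out.pos)] at this
  have h2 := congrArg (fun n : ℕ => ‖(n : ℚ_[p])‖) h1
  simp only [Nat.cast_mul, norm_mul, Nat.cast_pow, norm_pow, Padic.norm_p] at h2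
  have h3 : ‖(((p ^ h - 1).choose i : ℕ) : ℚ_[p])‖ ≤ 1 := by
    exact_mod_cast Padic.norm_int_le_one ((p ^ h - 1).choose i)
  have h4 : ‖((i + 1 : ℕ) : ℚ_[p])‖ * ((i + 1 : ℕ) : ℝ) ≥ 1 := by
    rw [Padic.norm_eq_zpow_neg_valuation (by exact_mod_cast hj.ne'), Padic.valuation_natCast]
    have : (p : ℝ) ^ (padicValNat p (i + 1)) ≤ ((i + 1 : ℕ) : ℝ) := by
      exact_mod_cast Nat.le_of_dvd hj pow_padicValNat_dvd
    rw [zpow_neg, zpow_natCast, ge_iff_le, inv_mul_eq_div, one_le_div (by positivity)]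
    exact this
  set A := ‖((p ^ h).choose (i + 1) : ℚ_[p])‖
  set B := ‖((i + 1 : ℕ) : ℚ_[p])‖
  have hpp : (0 : ℝ) < (p : ℝ) ^ h := by positivity
  have h5 : A * B * (p : ℝ) ^ h ≤ 1 := by
    rw [← h2, inv_pow, mul_assoc, mul_comm, mul_assoc, mul_inv_cancel₀ hpp.ne', mul_one]
    exact h3
  have hA : 0 ≤ A := norm_nonneg _
  have hn : (0 : ℝ) ≤ ((i + 1 : ℕ) : ℝ) := by positivity
  calc A * (p : ℝ) ^ h = A * (p : ℝ) ^ h * 1 := by ring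
    _ ≤ A * (p : ℝ) ^ h * (B * ((i + 1 : ℕ) : ℝ)) := by gcongr
    _ = (A * B * (p : ℝ) ^ h) * ((i + 1 : ℕ) : ℝ) := by ring
    _ ≤ 1 * ((i + 1 : ℕ) : ℝ) := by gcongr
    _ = _ := one_mul _

lemma norm_coeff_one_add_X_pow_sub_one_pow_le (h e m : ℕ) :
    ‖(((((X : ℤ[X]) + 1) ^ p ^ h - 1) ^ e).coeff m : ℚ_[p])‖ ≤
      (min 1 ((m : ℝ) / (p : ℝ) ^ h)) ^ e := by
  have hp0 : (0 : ℝ) < p := by exact_mod_cast hp.out.pos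
  induction e generalizing m with
  | zero => simpa using Padic.norm_int_le_one _
  | succ e ih =>
    rw [pow_succ, coeff_mul]
    push_cast
    refine IsUltrametricDist.norm_sum_le_of_forall_le_of_nonneg (by positivity) fun x hx => ?_
    rw [Finset.HasAntidiagonal.mem_antidiagonal] at hx
    have hx1 : (x.1 : ℝ) ≤ m := by exact_mod_cast (by omega : x.1 ≤ m)
    have hx2 : (x.2 : ℝ) ≤ m := by exact_mod_cast (by omega : x.2 ≤ m)
    rw [norm_mul, pow_succ]
    have h1 : ‖(((X + 1 : ℤ[X]) ^ p ^ h - 1).coeff x.2 : ℚ_[p])‖ ≤ min 1 ((m : ℝ) / (p : ℝ) ^ h) := by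
      refine le_min (Padic.norm_int_le_one _) ?_
      rw [coeff_sub, coeff_X_add_one_pow]
      rcases norm_choose_prime_pow_le (p := p) h x.2 with h0 | h0
      · rcases Nat.eq_zero_or_pos x.2 with h00 | h00
        · rw [h00]; simp; positivity
        · rw [coeff_one, if_neg h00.ne', sub_zero, le_div_iff₀ (by positivity)]
          refine le_trans ?_ hx2
          exact_mod_cast h0
      · rw [h0]; simp; positivity
    refine mul_le_mul ((ih x.1).trans ?_) h1 (norm_nonneg _) (by positivity)
    gcongr

variable {L : Type} [NontriviallyNormedField L] [NormedAlgebra ℚ_[p] L]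

lemma shiftPoly_comp (P : ℤ[X]) (f : ℤ_[p] → L) (x : ℤ_[p]) :
    shiftPoly (P.comp (X - 1)) f x =
      ∑ i ∈ Finset.range (P.natDegree + 1), P.coeff i • (fwdDiff (1 : ℤ_[p]))^[i] f x := by
  have : shiftPoly (P.comp (X - 1)) f = ∑ i ∈ Finset.range (P.natDegree + 1),
      P.coeff i • shiftPoly ((X - 1) ^ i) f := by
    simp only [shiftPoly, aeval_comp, map_pow]
    rw [Polynomial.aeval_eq_sum_range]
    simp [LinearMap.sum_apply]
  rw [this, Finset.sum_apply]
  simp [shiftPoly_X_sub_one_pow]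

variable [IsUltrametricDist L] [CompleteSpace L] {r : ℝ}

lemma IsCr.norm_fwdDiff_iter_le {f : ℤ_[p] → L} (hr : 0 < r) (h : IsCr p L r f) (l : ℕ)
    (x : ℤ_[p]) : ((l : ℝ) + 1) ^ r * ‖(fwdDiff (1 : ℤ_[p]))^[l] f x‖ ≤ crNorm p L r f := by
  have hl : (0 : ℝ) < ((l : ℝ) + 1) ^ r := by positivity
  rw [← le_div_iff₀' hl]
  rw [← shiftPoly_X_sub_one_pow]
  refine norm_le_of_mahlerCoeff_le (continuous_shiftPoly _ (h.continuous hr)) (fun n => ?_) x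
  rw [mahlerCoeff_eq_fwdDiff, shiftPoly_X_sub_one_pow, ← Function.iterate_add_apply,
    ← mahlerCoeff_eq_fwdDiff, le_div_iff₀' hl]
  refine le_trans ?_ (h.le_crNorm hr (n + l))
  push_cast
  gcongr
  have : (0 : ℝ) ≤ n := by positivity
  linarith

lemma IsCr.norm_fwdDiff_prime_pow_le {f : ℤ_[p] → L} (hr : 0 < r) (hf : IsCr p L r f) {e : ℕ}
    (he : r ≤ e) (h : ℕ) (x : ℤ_[p]) :
    ((p : ℝ) ^ h) ^ r * ‖(fwdDiff ((p ^ h : ℕ) : ℤ_[p]))^[e] f x‖ ≤ crNorm p L r f := by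
  have hp0 : (0 : ℝ) < p := by exact_mod_cast hp.out.pos
  have hl : (0 : ℝ) < ((p : ℝ) ^ h) ^ r := by positivity
  rw [← le_div_iff₀' hl, ← shiftPoly_X_pow_sub_one_pow]
  have e1 : ((X : ℤ[X]) ^ p ^ h - 1) ^ e = (((X + 1 : ℤ[X]) ^ p ^ h - 1) ^ e).comp (X - 1) := by
    simp
  rw [e1, shiftPoly_comp]
  have hN := crNorm_nonneg (p := p) (L := L) (r := r) f
  refine IsUltrametricDist.norm_sum_le_of_forall_le_of_nonneg (by positivity) fun m _ => ?_
  rw [zsmul_eq_mul, norm_mul, norm_intCast_L (p := p)]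
  have h1 := norm_coeff_one_add_X_pow_sub_one_pow_le (p := p) h e m
  have h2 := hf.norm_fwdDiff_iter_le hr m x
  have hm : (0 : ℝ) < ((m : ℝ) + 1) ^ r := by positivity
  rw [← le_div_iff₀' hm] at h2
  have h3 : (min 1 ((m : ℝ) / (p : ℝ) ^ h)) ^ e ≤ ((m : ℝ) + 1) ^ r / ((p : ℝ) ^ h) ^ r := by
    rw [← Real.div_rpow (by positivity) (by positivity)]
    rcases Nat.eq_zero_or_pos m with hm0 | hm0
    · have : e ≠ 0 := by
        rintro rfl
        simp only [Nat.cast_zero] at he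
        linarith
      rw [hm0]; simp [this]; positivity
    have hm1 : (0 : ℝ) < m := by exact_mod_cast hm0
    have hmin : 0 < min 1 ((m : ℝ) / (p : ℝ) ^ h) := lt_min one_pos (by positivity)
    calc _ = (min 1 ((m : ℝ) / (p : ℝ) ^ h)) ^ (e : ℝ) := (Real.rpow_natCast _ _).symm
      _ ≤ (min 1 ((m : ℝ) / (p : ℝ) ^ h)) ^ r :=
        Real.rpow_le_rpow_of_exponent_ge hmin (min_le_left _ _) he
      _ ≤ ((m : ℝ) / (p : ℝ) ^ h) ^ r := by gcongr; exact min_le_right _ _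
      _ ≤ _ := by gcongr; linarith
  calc _ ≤ (((m : ℝ) + 1) ^ r / ((p : ℝ) ^ h) ^ r) * (crNorm p L r f / ((m : ℝ) + 1) ^ r) :=
        mul_le_mul (h1.trans h3) h2 (norm_nonneg _) (by positivity)
    _ = _ := by field_simp

end Interpolation

section Expansion

set_option linter.unusedSectionVars false

open Polynomial

variable {p : ℕ} [hp : Fact p.Prime]

lemma exists_eq_appr_add (h : ℕ) (z : ℤ_[p]) :
    ∃ t : ℤ_[p], z = (z.appr h : ℤ_[p]) + (p : ℤ_[p]) ^ h * t := by
  obtain ⟨t, ht⟩ := Ideal.mem_span_singleton.1 (PadicInt.appr_spec h z)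
  exact ⟨t, by rw [← ht]; ring⟩

/-- The quotient of `z` by `p^h`. -/
def quoZ (h : ℕ) (z : ℤ_[p]) : ℤ_[p] := (exists_eq_appr_add h z).choose

lemma eq_appr_add_quoZ (h : ℕ) (z : ℤ_[p]) :
    z = (z.appr h : ℤ_[p]) + (p : ℤ_[p]) ^ h * quoZ h z := (exists_eq_appr_add h z).choose_spec

lemma eq_of_dvd_sub_of_lt {h x y : ℕ} (hx : x < p ^ h) (hy : y < p ^ h)
    (hd : (p : ℤ_[p]) ^ h ∣ (x : ℤ_[p]) - y) : x = y := by
  have h1 : ((p : ℤ) ^ h) ∣ (x : ℤ) - y := by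
    rw [padicInt_dvd_iff] at hd
    exact_mod_cast (PadicInt.norm_int_le_pow_iff_dvd (p := p) (k := (x : ℤ) - y) (n := h)).1 (by push_cast; exact hd)
  have h2 : (y : ℕ) ≡ x [MOD p ^ h] := (Nat.modEq_iff_dvd).2 (by exact_mod_cast h1)
  exact (Nat.ModEq.eq_of_lt_of_lt h2 hy hx).symm

lemma appr_eq_of_dvd {h x : ℕ} (hx : x < p ^ h) {z : ℤ_[p]} (hd : (p : ℤ_[p]) ^ h ∣ z - x) :
    z.appr h = x := by
  refine eq_of_dvd_sub_of_lt (PadicInt.appr_lt z h) hx ?_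
  have := dvd_sub hd (Ideal.mem_span_singleton.1 (PadicInt.appr_spec h z))
  convert this using 1; ring

lemma appr_add_mul (h : ℕ) (z s : ℤ_[p]) : (z + (p : ℤ_[p]) ^ h * s).appr h = z.appr h := by
  refine appr_eq_of_dvd (PadicInt.appr_lt z h) ⟨quoZ h z + s, ?_⟩
  conv_lhs => rw [eq_appr_add_quoZ h z]
  rw [← eq_appr_add_quoZ h z]
  nth_rewrite 1 [eq_appr_add_quoZ h z]
  ring

lemma prime_pow_ne_zero_padicInt (h : ℕ) : (p : ℤ_[p]) ^ h ≠ 0 :=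
  pow_ne_zero _ (by exact_mod_cast hp.out.ne_zero)

lemma quoZ_add_mul (h : ℕ) (z s : ℤ_[p]) : quoZ h (z + (p : ℤ_[p]) ^ h * s) = quoZ h z + s := by
  have h1 := eq_appr_add_quoZ h (z + (p : ℤ_[p]) ^ h * s)
  have h2 := eq_appr_add_quoZ h z
  rw [appr_add_mul] at h1
  refine mul_left_cancel₀ (prime_pow_ne_zero_padicInt h) ?_
  linear_combination h2 - h1

variable {L : Type} [NontriviallyNormedField L] [NormedAlgebra ℚ_[p] L]

variable (L) in
/-- The binomial coefficient polynomial. -/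
def binPoly (i : ℕ) : L[X] := C ((i.factorial : L)⁻¹) * (descPochhammer ℤ i).map (Int.castRingHom L)

lemma natDegree_binPoly_le (i : ℕ) : (binPoly L i).natDegree ≤ i :=
  (natDegree_C_mul_le _ _).trans (natDegree_map_le.trans (descPochhammer_natDegree ℤ i).le)

lemma eval_binPoly (i : ℕ) (t : ℤ_[p]) :
    (binPoly L i).eval (iotaL p L t) = iotaL p L (binomQ p t i) := by
  rw [binPoly, descPochhammer_map, eval_C_mul, descPochhammer_eval_eq_prod_range, binomQ, iotaL,
    map_div₀, map_prod]
  simp [div_eq_inv_mul]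

lemma norm_factorial_le {i e : ℕ} (h : i ≤ e) : ‖(e.factorial : ℚ_[p])‖ ≤ ‖(i.factorial : ℚ_[p])‖ := by
  obtain ⟨c, hc⟩ := Nat.factorial_dvd_factorial h
  rw [hc, Nat.cast_mul, norm_mul]
  refine mul_le_of_le_one_right (norm_nonneg _) ?_
  exact_mod_cast Padic.norm_int_le_one c

lemma norm_coeff_binPoly_le {i e : ℕ} (h : i ≤ e) (j : ℕ) :
    ‖(binPoly L i).coeff j‖ ≤ ‖(e.factorial : ℚ_[p])‖⁻¹ := by
  rw [binPoly, coeff_C_mul, coeff_map, norm_mul, norm_inv, norm_natCast_L (p := p)]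
  have h1 : ‖(Int.castRingHom L) ((descPochhammer ℤ i).coeff j)‖ ≤ 1 :=
    norm_intCast_L_le_one p _
  have h2 : 0 < ‖(e.factorial : ℚ_[p])‖ := norm_pos_iff.2 (by exact_mod_cast e.factorial_ne_zero)
  calc _ ≤ ‖(i.factorial : ℚ_[p])‖⁻¹ * 1 := by gcongr
    _ ≤ _ := by rw [mul_one]; exact inv_anti₀ h2 (norm_factorial_le h)

/-- Newton interpolation of `f` with `e` nodes on every ball of radius `p^{-h}`. -/
def interp (e h : ℕ) (f : ℤ_[p] → L) : ℤ_[p] → L := fun z =>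
  ∑ i ∈ Finset.range e, (fwdDiff ((p ^ h : ℕ) : ℤ_[p]))^[i] f (z.appr h : ℤ_[p]) *
    (binPoly L i).eval (iotaL p L (quoZ h z))

/-- The function `((z - x)/p^h)^j` on the ball `x + p^h ℤ_p`, extended by zero. -/
def ballMon (h : ℕ) (x : ℤ_[p]) (j : ℕ) : ℤ_[p] → L := fun z =>
  if (p : ℤ_[p]) ^ h ∣ z - x then
    iotaL p L (((z : ℚ_[p]) - (x : ℚ_[p])) / (p : ℚ_[p]) ^ h) ^ j else 0

lemma interp_LP {e : ℕ} (he : 0 < e) (h : ℕ) (f : ℤ_[p] → L) : LP e h (interp e h f) := by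
  intro z
  refine ⟨∑ i ∈ Finset.range e, C ((fwdDiff ((p ^ h : ℕ) : ℤ_[p]))^[i] f (z.appr h : ℤ_[p])) *
    (binPoly L i).comp (X + C (iotaL p L (quoZ h z))), ?_, fun s => ?_⟩
  · refine lt_of_le_of_lt (natDegree_sum_le_of_forall_le (n := e - 1) _ _ fun i hi => ?_)
      (Nat.sub_lt he one_pos)
    refine (natDegree_C_mul_le _ _).trans (natDegree_comp_le.trans ?_)
    rw [natDegree_X_add_C, mul_one]
    exact (natDegree_binPoly_le i).trans (by have := Finset.mem_range.1 hi; omega)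
  · rw [interp, appr_add_mul, quoZ_add_mul, eval_finsetSum]
    refine Finset.sum_congr rfl fun i _ => ?_
    rw [eval_C_mul, eval_comp, eval_add, eval_X, eval_C, PadicInt.coe_add]
    congr 2
    rw [iotaL, map_add, add_comm]

lemma interp_eq_sum (e h : ℕ) (f : ℤ_[p] → L) :
    interp e h f = ∑ x ∈ Finset.range (p ^ h), ∑ i ∈ Finset.range e, ∑ j ∈ Finset.range e,
      ((fwdDiff ((p ^ h : ℕ) : ℤ_[p]))^[i] f (x : ℤ_[p]) * (binPoly L i).coeff j) •
        ballMon h (x : ℤ_[p]) j := by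
  ext z
  have hp0 : (p : ℚ_[p]) ≠ 0 := by exact_mod_cast hp.out.ne_zero
  simp only [Finset.sum_apply, Pi.smul_apply, smul_eq_mul]
  rw [Finset.sum_eq_single_of_mem (z.appr h) (Finset.mem_range.2 (PadicInt.appr_lt z h))]
  · refine Finset.sum_congr rfl fun i hi => ?_
    have hd : (p : ℤ_[p]) ^ h ∣ z - (z.appr h : ℤ_[p]) :=
      Ideal.mem_span_singleton.1 (PadicInt.appr_spec h z)
    have hq : ((z : ℚ_[p]) - ((z.appr h : ℤ_[p]) : ℚ_[p])) / (p : ℚ_[p]) ^ h = quoZ h z := by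
      rw [div_eq_iff (pow_ne_zero _ hp0)]
      have := congrArg (fun t : ℤ_[p] => (t : ℚ_[p])) (eq_appr_add_quoZ h z)
      push_cast at this ⊢
      linear_combination this
    rw [eval_eq_sum_range' (lt_of_le_of_lt (natDegree_binPoly_le i) (Finset.mem_range.1 hi)),
      Finset.mul_sum]
    refine Finset.sum_congr rfl fun j _ => ?_
    rw [ballMon, if_pos hd, hq, mul_assoc]
  · intro x hx hne
    refine Finset.sum_eq_zero fun i _ => Finset.sum_eq_zero fun j _ => ?_
    rw [ballMon, if_neg, mul_zero]
    intro hd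
    exact hne (appr_eq_of_dvd (Finset.mem_range.1 hx) hd).symm

variable [IsUltrametricDist L]

lemma interp_mem {e : ℕ} (h : ℕ) {f : ℤ_[p] → L} {M : ℝ} (hf : ∀ x, ‖f x‖ ≤ M) :
    interp e h f ∈ AddSubgroup.closure {g : ℤ_[p] → L | ∃ (x : ℕ) (j : ℕ) (c : L), j < e ∧
      ‖c‖ ≤ ‖(e.factorial : ℚ_[p])‖⁻¹ * M ∧ g = c • ballMon h (x : ℤ_[p]) j} := by
  have hM : 0 ≤ M := (norm_nonneg _).trans (hf 0)
  rw [interp_eq_sum]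
  refine sum_mem fun x _ => sum_mem fun i hi => sum_mem fun j hj => AddSubgroup.subset_closure ?_
  refine ⟨x, j, _, Finset.mem_range.1 hj, ?_, rfl⟩
  rw [norm_mul, mul_comm]
  exact mul_le_mul (norm_coeff_binPoly_le (Finset.mem_range.1 hi).le j)
    (norm_fwdDiff_iter_le hM hf _ _ _) (norm_nonneg _) (by positivity)

variable [CompleteSpace L]

lemma norm_sub_interp_le {e h : ℕ} {f : ℤ_[p] → L} (hf : Continuous f) {M : ℝ}
    (hM : ∀ x, ‖(fwdDiff ((p ^ h : ℕ) : ℤ_[p]))^[e] f x‖ ≤ M) (z : ℤ_[p]) :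
    ‖f z - interp e h f z‖ ≤ M := by
  have hM0 : 0 ≤ M := (norm_nonneg _).trans (hM 0)
  set x : ℤ_[p] := (z.appr h : ℤ_[p]) with hx
  set g : ℤ_[p] → L := fun t => f (x + (p : ℤ_[p]) ^ h * t) with hg
  have hgc : Continuous g := hf.comp (by fun_prop)
  have hcoef : ∀ i, mahlerCoeff p L g i = (fwdDiff ((p ^ h : ℕ) : ℤ_[p]))^[i] f x := by
    intro i
    rw [mahlerCoeff_eq_fwdDiff, fwdDiff_iter_eq_sum_shift, fwdDiff_iter_eq_sum_shift]
    refine Finset.sum_congr rfl fun j _ => ?_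
    simp [hg, mul_comm]
  have hs := hasSum_mahler hgc (quoZ h z)
  have hgz : g (quoZ h z) = f z := by rw [hg]; simp only; rw [hx, ← eq_appr_add_quoZ]
  rw [hgz] at hs
  have hs' := (hasSum_nat_add_iff' e).2 hs
  have : interp e h f z = ∑ i ∈ Finset.range e,
      mahlerCoeff p L g i * iotaL p L (binomQ p (quoZ h z) i) := by
    rw [interp]
    refine Finset.sum_congr rfl fun i _ => ?_
    rw [hcoef, eval_binPoly]
  rw [this]
  refine norm_le_of_hasSum hs' hM0 fun n => ?_
  rw [norm_mul, norm_iotaL, hcoef]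
  refine (mul_le_of_le_one_right (norm_nonneg _) (norm_binomQ_le_one _ _)).trans ?_
  rw [Function.iterate_add_apply]
  exact norm_fwdDiff_iter_le hM0 hM _ _ _

lemma interp_eq_self {e h : ℕ} {f : ℤ_[p] → L} (hf : LP e h f) : interp e h f = f := by
  ext z
  have := norm_sub_interp_le (e := e) (h := h) hf.continuous (M := 0)
    (fun x => by rw [hf.fwdDiff_eq_zero]; simp) z
  rw [norm_le_zero_iff, sub_eq_zero] at this
  exact this.symm

lemma fwdDiff_iter_sub {M G : Type*} [AddCommMonoid M] [AddCommGroup G] (h : M) (f g : M → G)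
    (n : ℕ) : (fwdDiff h)^[n] (f - g) = (fwdDiff h)^[n] f - (fwdDiff h)^[n] g := by
  have := fwdDiff_iter_add h (f - g) g n
  rw [sub_add_cancel] at this
  rw [this, add_sub_cancel_right]

lemma interp_sub (e h : ℕ) (f g : ℤ_[p] → L) :
    interp e h (f - g) = interp e h f - interp e h g := by
  ext z
  simp only [interp, Pi.sub_apply, fwdDiff_iter_sub, sub_mul, Finset.sum_sub_distrib]

variable {r : ℝ}

/-- The set of scaled ball monomials with coefficients of weighted norm at most `M`. -/
def ballMonSet (p : ℕ) [Fact p.Prime] (L : Type) [NontriviallyNormedField L]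
    [NormedAlgebra ℚ_[p] L] (r : ℝ) (e : ℕ) (M : ℝ) : Set (ℤ_[p] → L) :=
  {g | ∃ (h x j : ℕ) (c : L), 1 ≤ h ∧ j < e ∧ ‖c‖ * ((p : ℝ) ^ h) ^ r ≤ M ∧
    g = c • ballMon h (x : ℤ_[p]) j}

lemma interp_mem_ballMonSet {e h : ℕ} (hh : 1 ≤ h) {f : ℤ_[p] → L} {M : ℝ}
    (hf : ∀ x, ‖f x‖ ≤ M) : interp e h f ∈ AddSubgroup.closure
      (ballMonSet p L r e (‖(e.factorial : ℚ_[p])‖⁻¹ * M * ((p : ℝ) ^ h) ^ r)) := by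
  refine AddSubgroup.closure_mono ?_ (interp_mem h hf)
  rintro _ ⟨x, j, c, hj, hc, rfl⟩
  exact ⟨h, x, j, c, hh, hj, by gcongr, rfl⟩

theorem IsCr.mem_closure_ballMonSet (hr : 0 < r) {e : ℕ} (he : r ≤ e) {f : ℤ_[p] → L}
    (hf : IsCr p L r f) {H : ℕ} (hH : LP e H f) :
    f ∈ AddSubgroup.closure (ballMonSet p L r e
      (‖(e.factorial : ℚ_[p])‖⁻¹ * (p : ℝ) ^ r * crNorm p L r f)) := by
  have hp0 : (0 : ℝ) < p := by exact_mod_cast hp.out.pos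
  have he0 : 0 < e := by
    have : (0 : ℝ) < e := hr.trans_le he
    exact_mod_cast this
  have key : ∀ n, interp e (n + 1) f ∈ AddSubgroup.closure (ballMonSet p L r e
      (‖(e.factorial : ℚ_[p])‖⁻¹ * (p : ℝ) ^ r * crNorm p L r f)) := by
    intro n
    induction n with
    | zero =>
      have := interp_mem_ballMonSet (r := r) (e := e) (h := 1) le_rfl (hf.norm_apply_le hr)
      convert this using 3
      rw [pow_one]; ring
    | succ n ih =>
      have h1 : interp e (n + 1 + 1) (interp e (n + 1) f) = interp e (n + 1) f :=
        interp_eq_self ((interp_LP he0 (n + 1) f).mono_level (Nat.le_succ _))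
      have h2 : interp e (n + 1 + 1) f =
          interp e (n + 1) f + interp e (n + 1 + 1) (f - interp e (n + 1) f) := by
        rw [interp_sub, h1]; ring
      rw [h2]
      refine add_mem ih ?_
      have hb : ∀ x, ‖(f - interp e (n + 1) f) x‖ ≤ crNorm p L r f / ((p : ℝ) ^ (n + 1)) ^ r := by
        refine norm_sub_interp_le (hf.continuous hr) fun x => ?_
        rw [le_div_iff₀' (by positivity)]
        exact hf.norm_fwdDiff_prime_pow_le hr he (n + 1) x
      have := interp_mem_ballMonSet (r := r) (e := e) (h := n + 1 + 1) (by omega) hb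
      convert this using 3
      rw [pow_succ (p : ℝ) (n + 1), Real.mul_rpow (by positivity) (by positivity)]
      field_simp
  have : interp e (H + 1) f = f := interp_eq_self (hH.mono_level (Nat.le_succ H))
  rw [← this]
  convert key H using 4
  rw [this]

theorem exists_LP_near (hr : 0 < r) {e : ℕ} (he : r < e) {f : ℤ_[p] → L} (hf : IsCr p L r f)
    {ε : ℝ} (hε : 0 < ε) : ∃ (g : ℤ_[p] → L) (H : ℕ), LP e H g ∧ IsCr p L r g ∧
      crNorm p L r (f - g) < ε := by
  have hp0 : (0 : ℝ) < p := by exact_mod_cast hp.out.pos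
  have hp1 : (1 : ℝ) < p := by exact_mod_cast hp.out.one_lt
  have he0 : 0 < e := by
    have : (0 : ℝ) < e := hr.trans he
    exact_mod_cast this
  have : Fact (0 < r) := ⟨hr⟩
  -- truncate the Mahler expansion
  obtain ⟨N, hN⟩ := Metric.tendsto_atTop.1 (hf.tendsto hr) (ε / 2) (half_pos hε)
  set q : L[X] := ∑ n ∈ Finset.range N, C (mahlerCoeff p L f n) * binPoly L n with hq
  set f0 : ℤ_[p] → L := fun z => q.eval (iotaL p L z) with hf0
  set e' := max e (q.natDegree + 1) with he'
  have hLP : LP e' 0 f0 := by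
    intro z
    refine ⟨q.comp (X + C (iotaL p L z)), ?_, fun s => ?_⟩
    · refine lt_of_le_of_lt natDegree_comp_le ?_
      rw [natDegree_X_add_C, mul_one]
      exact lt_of_lt_of_le (Nat.lt_succ_self _) (le_max_right _ _)
    · rw [eval_comp, eval_add, eval_X, eval_C, hf0]
      simp [iotaL, add_comm]
  have he'0 : 0 < e' := he0.trans_le (le_max_left _ _)
  obtain ⟨K, hK0, hK⟩ := isCr_of_fwdDiff_eq_zero p L hr he'0
  obtain ⟨K', hK'0, hK'⟩ := isCr_of_fwdDiff_eq_zero p L (r := (e : ℝ)) (by exact_mod_cast he0) he'0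
  have hf0c := hLP.continuous
  obtain ⟨M, hM⟩ : ∃ M, ∀ x, ‖f0 x‖ ≤ M :=
    (isCompact_univ.exists_bound_of_continuousOn hf0c.continuousOn).imp fun M h x => h x trivial
  have hf0r := (hK 0 f0 M hf0c (by simpa using hLP.fwdDiff_eq_zero) hM).1
  have hf0e := (hK' 0 f0 M hf0c (by simpa using hLP.fwdDiff_eq_zero) hM).1
  have hcoef : ∀ n, mahlerCoeff p L f0 n = if n < N then mahlerCoeff p L f n else 0 := by
    have ht : Tendsto (fun n => if n < N then mahlerCoeff p L f n else 0) atTop (𝓝 0) := by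
      refine tendsto_const_nhds.congr' ?_
      filter_upwards [eventually_ge_atTop N] with n hn
      rw [if_neg (not_lt.2 hn)]
    obtain ⟨g, hg, hgc, hgs⟩ := exists_mahler_series p _ ht
    have : f0 = g := by
      ext z
      refine HasSum.unique ?_ (hgs z)
      have h1 := hasSum_sum_of_ne_finset_zero (L := .unconditional ℕ) (s := Finset.range N)
        (f := fun n => (if n < N then mahlerCoeff p L f n else 0) * iotaL p L (binomQ p z n)) (by
          intro b hb
          rw [Finset.mem_range] at hb
          rw [if_neg hb, zero_mul])
      convert h1 using 1
      rw [hf0, hq]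
      simp only [eval_finsetSum, eval_mul, eval_C, eval_binPoly]
      refine Finset.sum_congr rfl fun n hn => ?_
      rw [if_pos (Finset.mem_range.1 hn)]
    rw [this]; exact hgc
  have hff0 : crNorm p L r (f - f0) ≤ ε / 2 := by
    refine crNorm_le fun n => ?_
    rw [mahlerCoeff_sub, hcoef]
    split_ifs with hn
    · simp; positivity
    · rw [sub_zero]
      have := hN n (not_lt.1 hn)
      rw [Real.dist_eq, sub_zero, abs_of_nonneg (by positivity)] at this
      exact this.le
  have hbd : ∀ h : ℕ, LP e h (interp e h f0) ∧ IsCr p L r (f0 - interp e h f0) ∧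
      crNorm p L r (f0 - interp e h f0) ≤
        K * crNorm p L e f0 * ((p : ℝ) ^ (r - e)) ^ h := by
    intro h
    have h1 := interp_LP he0 h f0
    have h2 : LP e' h (f0 - interp e h f0) :=
      (hLP.mono_level (Nat.zero_le h)).sub (h1.mono_degree (le_max_left _ _))
    have h3 : ∀ x, ‖(f0 - interp e h f0) x‖ ≤ crNorm p L e f0 / ((p : ℝ) ^ h) ^ (e : ℝ) := by
      refine norm_sub_interp_le hf0c fun x => ?_
      rw [le_div_iff₀' (by positivity)]
      exact hf0e.norm_fwdDiff_prime_pow_le (by exact_mod_cast he0) le_rfl h x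
    have h4 := hK h _ _ h2.continuous h2.fwdDiff_eq_zero h3
    refine ⟨h1, h4.1, h4.2.trans_eq ?_⟩
    have e1 : ((p : ℝ) ^ (r - e)) ^ h = ((p : ℝ) ^ h) ^ r / ((p : ℝ) ^ h) ^ (e : ℝ) := by
      rw [← Real.rpow_sub (by positivity), ← Real.rpow_natCast, ← Real.rpow_natCast,
        ← Real.rpow_mul hp0.le, ← Real.rpow_mul hp0.le, mul_comm]
    rw [e1]; ring
  have hlim : Tendsto (fun h : ℕ => K * crNorm p L e f0 * ((p : ℝ) ^ (r - e)) ^ h) atTop (𝓝 0) := by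
    have : (p : ℝ) ^ (r - e) < 1 := Real.rpow_lt_one_of_one_lt_of_neg hp1 (by linarith)
    have := (tendsto_pow_atTop_nhds_zero_of_lt_one (by positivity) this).const_mul
      (K * crNorm p L e f0)
    rwa [mul_zero] at this
  obtain ⟨h, hh⟩ := (hlim.eventually (gt_mem_nhds (half_pos hε))).exists
  obtain ⟨b1, b2, b3⟩ := hbd h
  have hg : IsCr p L r (interp e h f0) := by
    have := hf0r.add (b2.smul (-1))
    rwa [show f0 + (-1 : L) • (f0 - interp e h f0) = interp e h f0 by
      ext z; simp] at this
  refine ⟨_, h, b1, hg, ?_⟩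
  have := norm_add_le (CrSp.mk f hf - CrSp.mk f0 hf0r) (CrSp.mk _ b2)
  have e2 : CrSp.mk f hf - CrSp.mk f0 hf0r + CrSp.mk _ b2 = CrSp.mk f hf - CrSp.mk _ hg := by
    apply CrSp.fn_injective
    ext z
    simp [CrSp.fn_add, CrSp.fn_sub]
  rw [e2] at this
  change crNorm p L r (f - interp e h f0) ≤ crNorm p L r (f - f0) + crNorm p L r (f0 - interp e h f0) at this
  linarith

end Expansion

section Lift

set_option linter.unusedSectionVars false

variable {p : ℕ} [hp : Fact p.Prime]
variable {L : Type} [NontriviallyNormedField L] [NormedAlgebra ℚ_[p] L]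

lemma iotaL_add (x y : ℚ_[p]) : iotaL p L (x + y) = iotaL p L x + iotaL p L y := map_add _ x y
lemma iotaL_sub (x y : ℚ_[p]) : iotaL p L (x - y) = iotaL p L x - iotaL p L y := map_sub _ x y
lemma iotaL_neg (x : ℚ_[p]) : iotaL p L (-x) = -iotaL p L x := map_neg _ x
lemma iotaL_mul (x y : ℚ_[p]) : iotaL p L (x * y) = iotaL p L x * iotaL p L y := map_mul _ x y
lemma iotaL_div (x y : ℚ_[p]) : iotaL p L (x / y) = iotaL p L x / iotaL p L y := map_div₀ _ x y
lemma iotaL_inv (x : ℚ_[p]) : iotaL p L x⁻¹ = (iotaL p L x)⁻¹ := map_inv₀ _ x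
lemma iotaL_pow (x : ℚ_[p]) (n : ℕ) : iotaL p L (x ^ n) = iotaL p L x ^ n := map_pow _ x n
lemma iotaL_one : iotaL p L 1 = 1 := map_one _
lemma iotaL_p : iotaL p L (p : ℚ_[p]) = (p : L) := map_natCast _ p
lemma iotaL_eq_zero {x : ℚ_[p]} : iotaL p L x = 0 ↔ x = 0 := map_eq_zero _

lemma prime_cast_ne_zero : (p : ℚ_[p]) ≠ 0 := by exact_mod_cast hp.out.ne_zero

variable (p) in
lemma prime_cast_ne_zero' : (p : L) ≠ 0 := by
  rw [← iotaL_p]; exact fun h => prime_cast_ne_zero (iotaL_eq_zero.1 h)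

variable (p L) in
/-- The hypotheses on `(k, α, β)` that are symmetric in `α` and `β`. -/
structure HypS (k : ℕ) (α β : L) : Prop where
  two_le : 2 ≤ k
  ne : α ≠ β
  pos_left : 0 < valL p L α
  pos_right : 0 < valL p L β
  sum : valL p L α + valL p L β = (k : ℝ) - 1

lemma HypS.symm {k : ℕ} {α β : L} (h : HypS p L k α β) : HypS p L k β α :=
  ⟨h.two_le, h.ne.symm, h.pos_right, h.pos_left, by rw [add_comm, h.sum]⟩

lemma ne_zero_of_valL_pos {α : L} (h : 0 < valL p L α) : α ≠ 0 := by
  rintro rfl; simp [valL] at h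

lemma HypS.left_ne_zero {k : ℕ} {α β : L} (h : HypS p L k α β) : α ≠ 0 :=
  ne_zero_of_valL_pos h.pos_left

lemma HypS.right_ne_zero {k : ℕ} {α β : L} (h : HypS p L k α β) : β ≠ 0 :=
  ne_zero_of_valL_pos h.pos_right

lemma norm_eq_rpow_valL {α : L} (h : α ≠ 0) : ‖α‖ = (p : ℝ) ^ (-valL p L α) := by
  rw [valL, neg_neg, Real.rpow_logb (by exact_mod_cast hp.out.pos)
    (by exact_mod_cast hp.out.one_lt.ne') (norm_pos_iff.2 h)]

/-- The character `c ↦ (αp/β)^{val c} c^{k-2}`. -/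
def psi (k : ℕ) (α β : L) (c : ℚ_[p]) : L :=
  (α * (p : L) / β) ^ c.valuation * iotaL p L c ^ (k - 2)

lemma HypS.chi_ne_zero {k : ℕ} {α β : L} (h : HypS p L k α β) : α * (p : L) / β ≠ 0 :=
  div_ne_zero (mul_ne_zero h.left_ne_zero (prime_cast_ne_zero' p)) h.right_ne_zero

lemma HypS.psi_mul {k : ℕ} {α β : L} (h : HypS p L k α β) {c d : ℚ_[p]} (hc : c ≠ 0) (hd : d ≠ 0) :
    psi k α β (c * d) = psi k α β c * psi k α β d := by
  rw [psi, psi, psi, Padic.valuation_mul hc hd, zpow_add₀ h.chi_ne_zero, iotaL_mul]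
  ring

lemma psi_one (k : ℕ) (α β : L) : psi k α β (1 : ℚ_[p]) = 1 := by simp [psi, iotaL_one]

lemma HypS.psi_ne_zero {k : ℕ} {α β : L} (h : HypS p L k α β) {c : ℚ_[p]} (hc : c ≠ 0) :
    psi k α β c ≠ 0 :=
  mul_ne_zero (zpow_ne_zero _ h.chi_ne_zero) (pow_ne_zero _ fun h => hc (iotaL_eq_zero.1 h))

lemma HypS.norm_psi {k : ℕ} {α β : L} (h : HypS p L k α β) {c : ℚ_[p]} (hc : c ≠ 0) :
    ‖psi k α β c‖ = ‖c‖ ^ (2 * valL p L α) := by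
  have hp0 : (0 : ℝ) < p := by exact_mod_cast hp.out.pos
  rw [psi, norm_mul, norm_zpow, norm_div, norm_mul, norm_p_L,
    norm_eq_rpow_valL (p := p) h.left_ne_zero, norm_eq_rpow_valL (p := p) h.right_ne_zero, norm_pow, norm_iotaL, Padic.norm_eq_zpow_neg_valuation hc]
  have hk : ((k - 2 : ℕ) : ℝ) = k - 2 := by rw [Nat.cast_sub h.two_le]; norm_num
  have e1 : (p : ℝ) ^ (-valL p L α) * (p : ℝ)⁻¹ / (p : ℝ) ^ (-valL p L β) =
      (p : ℝ) ^ (-valL p L α - 1 + valL p L β) := by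
    rw [Real.rpow_add hp0, Real.rpow_sub hp0, Real.rpow_neg hp0.le (valL p L β), Real.rpow_one]
    simp [div_eq_mul_inv]
  rw [e1, ← Real.rpow_intCast, ← Real.rpow_intCast, ← Real.rpow_natCast, ← Real.rpow_mul hp0.le,
    ← Real.rpow_mul hp0.le, ← Real.rpow_mul hp0.le, ← Real.rpow_add hp0, hk]
  congr 1
  push_cast
  have := h.sum
  have e2 : valL p L β = k - 1 - valL p L α := by linarith
  rw [e2]; ring

/-- Truncation to a `p`-adic integer. -/
def toZ (x : ℚ_[p]) : ℤ_[p] := if h : ∃ z : ℤ_[p], (z : ℚ_[p]) = x then h.choose else 0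

lemma coe_toZ {x : ℚ_[p]} (h : ‖x‖ ≤ 1) : ((toZ x : ℤ_[p]) : ℚ_[p]) = x := by
  have h1 : ∃ z : ℤ_[p], (z : ℚ_[p]) = x := ⟨⟨x, h⟩, rfl⟩
  rw [toZ, dif_pos h1]
  exact h1.choose_spec

lemma toZ_coe (z : ℤ_[p]) : toZ (z : ℚ_[p]) = z := by
  have h : ‖(z : ℚ_[p])‖ ≤ 1 := z.norm_le_one
  exact PadicInt.ext (coe_toZ h)

/-- Functions on `ℚ_p²` that are homogeneous of character `psi`. -/
def Homog (k : ℕ) (α β : L) (H : ℚ_[p] → ℚ_[p] → L) : Prop :=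
  (∀ c : ℚ_[p], c ≠ 0 → ∀ x y, H (c * x) (c * y) = psi k α β c * H x y) ∧ H 0 0 = 0

section
variable [IsUltrametricDist L] [CompleteSpace L] {r : ℝ}

/-- The homogeneous function on `ℚ_p²` with charts `u.1` and `u.2`. -/
def lift (k : ℕ) (α β : L) : (CrSp p L r × CrSp p L r) →ₗ[L] (ℚ_[p] → ℚ_[p] → L) where
  toFun u := fun x y =>
    if ‖x‖ < ‖y‖ then psi k α β y * u.1.fn (toZ (x / (p * y)))
    else if x = 0 then 0 else psi k α β x * u.2.fn (toZ (y / x))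
  map_add' u v := by
    ext x y
    simp only [Prod.fst_add, Prod.snd_add, CrSp.fn_add, Pi.add_apply]
    split_ifs <;> ring
  map_smul' c u := by
    ext x y
    simp only [Prod.smul_fst, Prod.smul_snd, CrSp.fn_smul, Pi.smul_apply, smul_eq_mul,
      RingHom.id_apply]
    split_ifs <;> ring

lemma lift_apply (k : ℕ) (α β : L) (u : CrSp p L r × CrSp p L r) (x y : ℚ_[p]) :
    lift k α β u x y = if ‖x‖ < ‖y‖ then psi k α β y * u.1.fn (toZ (x / (p * y)))
    else if x = 0 then 0 else psi k α β x * u.2.fn (toZ (y / x)) := rfl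

lemma norm_p_mul_lt (z : ℤ_[p]) : ‖(p : ℚ_[p]) * z‖ < 1 := by
  rw [norm_mul, Padic.norm_p]
  have h1 : (1 : ℝ) < p := by exact_mod_cast hp.out.one_lt
  have h2 : ‖(z : ℚ_[p])‖ ≤ 1 := z.norm_le_one
  calc (p : ℝ)⁻¹ * ‖(z : ℚ_[p])‖ ≤ (p : ℝ)⁻¹ * 1 := by gcongr
    _ < 1 := by rw [mul_one]; exact inv_lt_one_of_one_lt₀ h1

lemma lift_chart₁ (k : ℕ) (α β : L) (u : CrSp p L r × CrSp p L r) (z : ℤ_[p]) :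
    lift k α β u (p * z) 1 = u.1.fn z := by
  rw [lift_apply, if_pos (by simpa using norm_p_mul_lt z), psi_one, mul_one,
    mul_div_cancel_left₀ _ prime_cast_ne_zero, toZ_coe, one_mul]

lemma lift_chart₂ (k : ℕ) (α β : L) (u : CrSp p L r × CrSp p L r) (z : ℤ_[p]) :
    lift k α β u 1 z = u.2.fn z := by
  rw [lift_apply, if_neg (by simpa using z.norm_le_one), if_neg one_ne_zero, psi_one, div_one,
    toZ_coe, one_mul]

lemma lift_injective (k : ℕ) (α β : L) :
    Function.Injective (lift k α β : (CrSp p L r × CrSp p L r) →ₗ[L] _) := by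
  intro u v huv
  refine Prod.ext (CrSp.fn_injective ?_) (CrSp.fn_injective ?_)
  · ext z; rw [← lift_chart₁ k α β, huv, lift_chart₁]
  · ext z; rw [← lift_chart₂ k α β, huv, lift_chart₂]

lemma norm_div_le_one_of_lt {x y : ℚ_[p]} (h : ‖x‖ < ‖y‖) : ‖x / (p * y)‖ ≤ 1 := by
  have hp1 : (0 : ℝ) < p := by exact_mod_cast hp.out.pos
  have hy : y ≠ 0 := by rintro rfl; simp at h; linarith [norm_nonneg x]
  have h1 : ‖x / y‖ < (p : ℝ) ^ ((0 : ℤ)) := by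
    rw [norm_div, zpow_zero]; exact (div_lt_one (norm_pos_iff.2 hy)).2 h
  rw [Padic.norm_lt_pow_iff_norm_le_pow_sub_one] at h1
  rw [mul_comm, ← div_div, norm_div, Padic.norm_p, div_inv_eq_mul]
  calc ‖x / y‖ * p ≤ (p : ℝ) ^ ((0 : ℤ) - 1) * p := by gcongr
    _ = 1 := by rw [zero_sub, zpow_neg_one, inv_mul_cancel₀ hp1.ne']

lemma lift_eq_of_charts {k : ℕ} {α β : L} {H : ℚ_[p] → ℚ_[p] → L} (hH : Homog k α β H)
    {u : CrSp p L r × CrSp p L r} (h1 : ∀ z : ℤ_[p], H (p * z) 1 = u.1.fn z)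
    (h2 : ∀ z : ℤ_[p], H 1 z = u.2.fn z) : lift k α β u = H := by
  ext x y
  rw [lift_apply]
  split_ifs with hxy hx
  · have hy : y ≠ 0 := by rintro rfl; simp at hxy; linarith [norm_nonneg x]
    rw [← h1, coe_toZ (norm_div_le_one_of_lt hxy), ← hH.1 y hy]
    congr 1
    · field_simp [prime_cast_ne_zero (p := p)]
    · rw [mul_one]
  · subst hx
    have : y = 0 := by simpa using hxy
    subst this
    exact hH.2.symm
  · have h3 : ‖y / x‖ ≤ 1 := by
      rw [norm_div]; exact (div_le_one (norm_pos_iff.2 hx)).2 (not_lt.1 hxy)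
    rw [← h2, coe_toZ h3, ← hH.1 x hx, mul_one, mul_div_cancel₀ _ hx]

lemma HypS.lift_homog {k : ℕ} {α β : L} (h : HypS p L k α β) (u : CrSp p L r × CrSp p L r) :
    Homog k α β (lift k α β u) := by
  refine ⟨fun c hc x y => ?_, by simp [lift_apply]⟩
  simp only [lift_apply, norm_mul, mul_lt_mul_iff_right₀ (norm_pos_iff.2 hc), mul_eq_zero, hc,
    false_or]
  split_ifs with hxy hx
  · have hy : y ≠ 0 := by rintro rfl; simp at hxy; linarith [norm_nonneg x]
    rw [h.psi_mul hc hy, show c * x / (p * (c * y)) = x / (p * y) by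
      field_simp [prime_cast_ne_zero (p := p)], mul_assoc]
  · simp
  · rw [h.psi_mul hc hx, mul_div_mul_left _ _ hc, mul_assoc]

variable [Fact (0 < r)]

/-- Evaluation of the lift at a point as a continuous linear functional. -/
def liftEval (k : ℕ) (α β : L) (x y : ℚ_[p]) : (CrSp p L r × CrSp p L r) →L[L] L :=
  if ‖x‖ < ‖y‖ then
    psi k α β y • (CrSp.evalL (toZ (x / ((p : ℚ_[p]) * y)))).comp (ContinuousLinearMap.fst L _ _)
  else if x = 0 then 0 else
    psi k α β x • (CrSp.evalL (toZ (y / x))).comp (ContinuousLinearMap.snd L _ _)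

lemma liftEval_apply (k : ℕ) (α β : L) (x y : ℚ_[p]) (u : CrSp p L r × CrSp p L r) :
    liftEval k α β x y u = lift k α β u x y := by
  rw [liftEval, lift_apply]
  split_ifs <;> rfl
end

/-- The twisted action of a matrix on functions on `ℚ_p²`. -/
def act (α : L) (m : Matrix (Fin 2) (Fin 2) ℚ_[p]) :
    (ℚ_[p] → ℚ_[p] → L) →ₗ[L] (ℚ_[p] → ℚ_[p] → L) where
  toFun H := fun x y => α ^ (-(det2 p m).valuation) *
    H (m 1 1 * x - m 0 1 * y) (-(m 1 0) * x + m 0 0 * y)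
  map_add' H G := by ext x y; simp [mul_add]
  map_smul' c H := by ext x y; simp only [Pi.smul_apply, smul_eq_mul, RingHom.id_apply]; ring

lemma act_apply (α : L) (m : Matrix (Fin 2) (Fin 2) ℚ_[p]) (H : ℚ_[p] → ℚ_[p] → L)
    (x y : ℚ_[p]) : act α m H x y = α ^ (-(det2 p m).valuation) *
    H (m 1 1 * x - m 0 1 * y) (-(m 1 0) * x + m 0 0 * y) := rfl

lemma det2_mul (m n : Matrix (Fin 2) (Fin 2) ℚ_[p]) : det2 p (m * n) = det2 p m * det2 p n := by
  simp only [det2, Matrix.mul_apply, Fin.sum_univ_two]; ring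

lemma det2_eq_det (m : Matrix (Fin 2) (Fin 2) ℚ_[p]) : det2 p m = m.det := by
  rw [Matrix.det_fin_two]; rfl

lemma act_mul {α : L} (hα : α ≠ 0) {m n : Matrix (Fin 2) (Fin 2) ℚ_[p]} (hm : det2 p m ≠ 0)
    (hn : det2 p n ≠ 0) (H : ℚ_[p] → ℚ_[p] → L) : act α (m * n) H = act α m (act α n H) := by
  ext x y
  simp only [act_apply, det2_mul, Padic.valuation_mul hm hn, neg_add, zpow_add₀ hα,
    Matrix.mul_apply, Fin.sum_univ_two, ← mul_assoc]
  congr 2 <;> ring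

lemma act_one (α : L) (H : ℚ_[p] → ℚ_[p] → L) : act α 1 H = H := by
  ext x y; simp [act_apply, det2]

lemma Homog.act {k : ℕ} {α β : L} {H : ℚ_[p] → ℚ_[p] → L} (hH : Homog k α β H)
    (m : Matrix (Fin 2) (Fin 2) ℚ_[p]) : Homog k α β (act α m H) := by
  refine ⟨fun c hc x y => ?_, by simp [act_apply, hH.2]⟩
  rw [act_apply, act_apply, show m 1 1 * (c * x) - m 0 1 * (c * y) = c * (m 1 1 * x - m 0 1 * y) by
    ring, show -(m 1 0) * (c * x) + m 0 0 * (c * y) = c * (-(m 1 0) * x + m 0 0 * y) by ring,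
    hH.1 c hc]
  ring

/-- Scalar matrices act by a constant on homogeneous functions. -/
lemma Homog.act_scalar {k : ℕ} {α β : L} {H : ℚ_[p] → ℚ_[p] → L} (hH : Homog k α β H)
    {c : ℚ_[p]} (hc : c ≠ 0) :
    Paper.act α !![c, 0; 0, c] H = (α ^ (-(c * c).valuation) * psi k α β c) • H := by
  ext x y
  simp [act_apply, det2, hH.1 c hc, mul_assoc]

lemma HypS.norm_scalar {k : ℕ} {α β : L} (h : HypS p L k α β) {c : ℚ_[p]} (hc : c ≠ 0) :
    ‖α ^ (-(c * c).valuation) * psi k α β c‖ = 1 := by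
  have hp0 : (0 : ℝ) < p := by exact_mod_cast hp.out.pos
  rw [norm_mul, h.norm_psi hc, norm_zpow, norm_eq_rpow_valL (p := p) h.left_ne_zero,
    Padic.valuation_mul hc hc, Padic.norm_eq_zpow_neg_valuation hc, ← Real.rpow_intCast,
    ← Real.rpow_intCast, ← Real.rpow_mul hp0.le, ← Real.rpow_mul hp0.le, ← Real.rpow_add hp0]
  push_cast
  ring_nf
  simp

end Lift

section Atoms

set_option linter.unusedSectionVars false

open Polynomial

variable {p : ℕ} [hp : Fact p.Prime]
variable {L : Type} [NontriviallyNormedField L] [NormedAlgebra ℚ_[p] L]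

/-- The homogeneous function whose restriction to `y = 1` is `x^i` on `ℤ_p`. -/
def eh (k : ℕ) (α β : L) (i : ℕ) : ℚ_[p] → ℚ_[p] → L := fun x y =>
  if ‖x‖ ≤ ‖y‖ ∧ y ≠ 0 then
    (α * (p : L) / β) ^ y.valuation * iotaL p L y ^ (k - 2 - i) * iotaL p L x ^ i else 0

/-- The diagonal matrix `(p^n, 1)`. -/
def Dm (n : ℕ) : Matrix (Fin 2) (Fin 2) ℚ_[p] := !![(p : ℚ_[p]) ^ n, 0; 0, 1]

lemma det2_Dm (n : ℕ) : det2 p (Dm n) = (p : ℚ_[p]) ^ n := by simp [det2, Dm]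

lemma det2_Dm_ne_zero (n : ℕ) : det2 p (Dm n) ≠ 0 := by
  rw [det2_Dm]; exact pow_ne_zero _ prime_cast_ne_zero

lemma valuation_p_pow' (n : ℕ) : ((p : ℚ_[p]) ^ n).valuation = n := by
  simp

lemma act_Dm (α : L) (n : ℕ) (H : ℚ_[p] → ℚ_[p] → L) (x y : ℚ_[p]) :
    act α (Dm n) H x y = α ^ (-(n : ℤ)) * H x ((p : ℚ_[p]) ^ n * y) := by
  rw [act_apply, det2_Dm, valuation_p_pow']
  simp [Dm]

lemma Dm_mul (m n : ℕ) : (Dm m * Dm n : Matrix (Fin 2) (Fin 2) ℚ_[p]) = Dm (m + n) := by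
  ext i j; fin_cases i <;> fin_cases j <;> simp [Dm, pow_add]

variable {k : ℕ} {α β : L}

lemma eh_term_eq {i : ℕ} (hi : i ≤ k - 2) (x : ℚ_[p]) {y : ℚ_[p]} (hy : y ≠ 0) :
    (α * (p : L) / β) ^ y.valuation * iotaL p L y ^ (k - 2 - i) * iotaL p L x ^ i =
      psi k α β y * iotaL p L (x / y) ^ i := by
  have hy' : iotaL p L y ≠ 0 := fun h => hy (iotaL_eq_zero.1 h)
  rw [psi, iotaL_div, div_pow]
  nth_rewrite 2 [← Nat.sub_add_cancel hi]
  rw [pow_add]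
  field_simp

lemma HypS.eh_homog (h : HypS p L k α β) {i : ℕ} (hi : i ≤ k - 2) :
    Homog k α β (eh k α β i : ℚ_[p] → ℚ_[p] → L) := by
  refine ⟨fun c hc x y => ?_, by simp [eh]⟩
  have hc' := norm_pos_iff.2 hc
  simp only [eh, norm_mul, mul_le_mul_iff_right₀ hc', ne_eq, mul_eq_zero, hc, false_or]
  split_ifs with hxy
  · rw [eh_term_eq hi _ hxy.2, eh_term_eq hi _ (mul_ne_zero hc hxy.2), mul_div_mul_left _ _ hc,
      h.psi_mul hc hxy.2, mul_assoc]
  · simp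

lemma HypS.norm_eh_le (h : HypS p L k α β) {i : ℕ} (hi : i ≤ k - 2) (x y : ℚ_[p]) :
    ‖eh k α β i x y‖ ≤ ‖y‖ ^ (2 * valL p L α) := by
  rw [eh]
  split_ifs with hxy
  · rw [eh_term_eq hi _ hxy.2, norm_mul, h.norm_psi hxy.2, norm_pow, norm_iotaL, norm_div]
    refine mul_le_of_le_one_right (by positivity) (pow_le_one₀ (by positivity) ?_)
    exact (div_le_one (norm_pos_iff.2 hxy.2)).2 hxy.1
  · rw [norm_zero]; positivity

lemma HypS.norm_left_pow (h : HypS p L k α β) (n : ℕ) :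
    ((p : ℝ) ^ n) ^ valL p L α = (‖α‖ ^ n)⁻¹ := by
  have hp0 : (0 : ℝ) < p := by exact_mod_cast hp.out.pos
  rw [norm_eq_rpow_valL (p := p) h.left_ne_zero, ← Real.rpow_natCast, ← Real.rpow_natCast,
    ← Real.rpow_mul hp0.le, ← Real.rpow_mul hp0.le, ← Real.rpow_neg hp0.le]
  congr 1; ring

lemma HypS.norm_act_Dm_eh_le (h : HypS p L k α β) {i : ℕ} (hi : i ≤ k - 2) (n : ℕ)
    (x y : ℚ_[p]) : ‖act α (Dm n) (eh k α β i) x y‖ ≤ ‖α‖ ^ n * ‖y‖ ^ (2 * valL p L α) := by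
  have hp0 : (0 : ℝ) < p := by exact_mod_cast hp.out.pos
  have hα : 0 < ‖α‖ := norm_pos_iff.2 h.left_ne_zero
  rw [act_Dm, norm_mul]
  refine (mul_le_mul_of_nonneg_left (h.norm_eh_le hi _ _) (norm_nonneg _)).trans_eq ?_
  rw [norm_mul, Real.mul_rpow (norm_nonneg _) (norm_nonneg _), norm_pow, Padic.norm_p, inv_pow,
    Real.inv_rpow (by positivity), mul_comm 2, Real.rpow_mul (by positivity), h.norm_left_pow,
    norm_zpow, zpow_neg, zpow_natCast, Real.rpow_two, Real.rpow_mul (norm_nonneg _), Real.rpow_two]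
  field_simp

lemma valuation_eq_of_norm_eq {x y : ℚ_[p]} (hx : x ≠ 0) (h : ‖x‖ = ‖y‖) :
    x.valuation = y.valuation := by
  have hy : y ≠ 0 := by rintro rfl; simp [hx] at h
  rw [Padic.norm_eq_zpow_neg_valuation hx, Padic.norm_eq_zpow_neg_valuation hy] at h
  have := zpow_right_injective₀ (by exact_mod_cast hp.out.pos)
    (by exact_mod_cast hp.out.one_lt.ne') h
  linarith

lemma norm_add_eq_of_lt {x y : ℚ_[p]} (h : ‖y‖ < ‖x‖) : ‖x + y‖ = ‖x‖ := by
  rw [Padic.add_eq_max_of_ne h.ne', max_eq_left h.le]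

/-- Stability of the support of `eh` under small perturbations. -/
lemma support_stable {x y dx dy : ℚ_[p]} (h : ‖x‖ ≤ ‖y‖ ∧ y ≠ 0) (hx : ‖dx‖ ≤ ‖y‖)
    (hy : ‖dy‖ < ‖y‖) :
    (‖x + dx‖ ≤ ‖y + dy‖ ∧ y + dy ≠ 0) ∧ (y + dy).valuation = y.valuation := by
  have h1 := norm_add_eq_of_lt hy
  have h2 : y + dy ≠ 0 := by
    rw [← norm_pos_iff, h1]; exact norm_pos_iff.2 h.2
  refine ⟨⟨?_, h2⟩, valuation_eq_of_norm_eq h2 h1⟩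
  rw [h1]
  exact (Padic.nonarchimedean _ _).trans (max_le h.1 hx)

lemma norm_p_pow (n : ℕ) : ‖(p : ℚ_[p]) ^ n‖ = ((p : ℝ) ^ n)⁻¹ := by
  rw [norm_pow, Padic.norm_p, inv_pow]

/-- On the support, `act (Dm n) eh` is stable under perturbations of size `p^{-(n+A)}`. -/
lemma eh_support_stable {A n : ℕ} {X Y dx dy : ℚ_[p]} (hXY : ((p : ℝ) ^ A)⁻¹ ≤ max ‖X‖ ‖Y‖)
    (hdx : ‖dx‖ < ((p : ℝ) ^ (n + A))⁻¹) (hdy : ‖dy‖ < ((p : ℝ) ^ A)⁻¹)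
    (h : ‖X‖ ≤ ‖(p : ℚ_[p]) ^ n * Y‖ ∧ (p : ℚ_[p]) ^ n * Y ≠ 0) :
    (‖X + dx‖ ≤ ‖(p : ℚ_[p]) ^ n * (Y + dy)‖ ∧ (p : ℚ_[p]) ^ n * (Y + dy) ≠ 0) ∧
      ((p : ℚ_[p]) ^ n * (Y + dy)).valuation = ((p : ℚ_[p]) ^ n * Y).valuation := by
  have hp0 : (0 : ℝ) < p := by exact_mod_cast hp.out.pos
  have hp1 : (1 : ℝ) ≤ p := by exact_mod_cast hp.out.one_lt.le
  have h1 : ‖X‖ ≤ ‖Y‖ := by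
    refine h.1.trans ?_
    rw [norm_mul, norm_p_pow]
    exact mul_le_of_le_one_left (norm_nonneg _) (inv_le_one_of_one_le₀ (one_le_pow₀ hp1))
  rw [max_eq_right h1] at hXY
  rw [mul_add]
  refine support_stable h ?_ ?_
  · rw [norm_mul, norm_p_pow]
    refine hdx.le.trans ?_
    rw [pow_add, mul_inv]
    gcongr
  · rw [norm_mul, norm_mul, norm_p_pow]
    exact mul_lt_mul_of_pos_left (hdy.trans_le hXY) (by positivity)

lemma HypS.chart_LP (h : HypS p L k α β) {i : ℕ} (hi : i ≤ k - 2) (A n : ℕ) {a b c d : ℚ_[p]}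
    (ha : ‖a‖ ≤ (p : ℝ) ^ A) (hc : ‖c‖ ≤ (p : ℝ) ^ A)
    (hm : ∀ z : ℤ_[p], ((p : ℝ) ^ A)⁻¹ ≤ max ‖a * z + b‖ ‖c * z + d‖) :
    LP (k - 1) (n + 2 * A + 1)
      (fun z : ℤ_[p] => act α (Dm n) (eh k α β i) (a * (z : ℚ_[p]) + b) (c * (z : ℚ_[p]) + d)) := by
  have hp0 : (0 : ℝ) < p := by exact_mod_cast hp.out.pos
  have hp1 : (1 : ℝ) < p := by exact_mod_cast hp.out.one_lt
  have hk := h.two_le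
  intro z
  have small : ∀ (a : ℚ_[p]), ‖a‖ ≤ (p : ℝ) ^ A → ∀ s : ℤ_[p],
      ‖a * ((p : ℚ_[p]) ^ (n + 2 * A + 1) * s)‖ < ((p : ℝ) ^ (n + A))⁻¹ := by
    intro a ha s
    have hs : ‖(s : ℚ_[p])‖ ≤ 1 := s.norm_le_one
    rw [norm_mul, norm_mul, norm_p_pow]
    calc ‖a‖ * (((p : ℝ) ^ (n + 2 * A + 1))⁻¹ * ‖(s : ℚ_[p])‖)
        ≤ (p : ℝ) ^ A * (((p : ℝ) ^ (n + 2 * A + 1))⁻¹ * 1) := by gcongr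
      _ = ((p : ℝ) ^ (n + A))⁻¹ * (p : ℝ)⁻¹ := by
        rw [show n + 2 * A + 1 = A + (n + A) + 1 by ring, pow_succ, pow_add _ A]; field_simp
      _ < _ := mul_lt_of_lt_one_right (by positivity) (inv_lt_one_of_one_lt₀ hp1)
  have small' : ∀ (a : ℚ_[p]), ‖a‖ ≤ (p : ℝ) ^ A → ∀ s : ℤ_[p],
      ‖a * ((p : ℚ_[p]) ^ (n + 2 * A + 1) * s)‖ < ((p : ℝ) ^ A)⁻¹ := fun a ha s =>
    (small a ha s).trans_le (by gcongr; exacts [hp1.le, by omega])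
  have expand : ∀ (a b : ℚ_[p]) (s : ℤ_[p]),
      a * ((z + (p : ℤ_[p]) ^ (n + 2 * A + 1) * s : ℤ_[p]) : ℚ_[p]) + b =
      (a * z + b) + a * ((p : ℚ_[p]) ^ (n + 2 * A + 1) * s) := fun a b s => by push_cast; ring
  by_cases hS : ‖a * z + b‖ ≤ ‖(p : ℚ_[p]) ^ n * (c * z + d)‖ ∧ (p : ℚ_[p]) ^ n * (c * z + d) ≠ 0
  · refine ⟨C (α ^ (-(n : ℤ)) * (α * (p : L) / β) ^ ((p : ℚ_[p]) ^ n * (c * z + d)).valuation) *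
      (C (iotaL p L ((p : ℚ_[p]) ^ n * (c * z + d))) + C (iotaL p L ((p : ℚ_[p]) ^ n * (c *
        (p : ℚ_[p]) ^ (n + 2 * A + 1)))) * X) ^ (k - 2 - i) *
      (C (iotaL p L (a * z + b)) + C (iotaL p L (a * (p : ℚ_[p]) ^ (n + 2 * A + 1))) * X) ^ i,
      ?_, fun s => ?_⟩
    · have lin : ∀ u v : L, (C u + C v * X).natDegree ≤ 1 := fun u v => by compute_degree
      refine lt_of_le_of_lt (natDegree_mul_le_of_le (natDegree_mul_le_of_le (natDegree_C _).le
        (natDegree_pow_le_of_le _ (lin _ _))) (natDegree_pow_le_of_le _ (lin _ _))) ?_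
      omega
    · have hst := eh_support_stable (hm z) (small a ha s) (small' c hc s) hS
      simp only [act_Dm]
      rw [expand, expand, eh, if_pos hst.1, hst.2]
      simp only [eval_mul, eval_C, eval_pow, eval_add, eval_X, ← iotaL_mul, ← iotaL_add]
      rw [mul_assoc, mul_assoc, mul_assoc, mul_assoc]
      congr 4 <;> ring_nf
  · refine ⟨0, by simp; omega, fun s => ?_⟩
    have hS' : ¬ (‖a * ((z + (p : ℤ_[p]) ^ (n + 2 * A + 1) * s : ℤ_[p]) : ℚ_[p]) + b‖ ≤
        ‖(p : ℚ_[p]) ^ n * (c * ((z + (p : ℤ_[p]) ^ (n + 2 * A + 1) * s : ℤ_[p]) : ℚ_[p]) + d)‖ ∧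
        (p : ℚ_[p]) ^ n * (c * ((z + (p : ℤ_[p]) ^ (n + 2 * A + 1) * s : ℤ_[p]) : ℚ_[p]) + d)
          ≠ 0) := by
      intro hS'
      have hst := eh_support_stable (hm _) (small a ha (-s)) (small' c hc (-s)) hS'
      apply hS
      convert hst.1 using 3 <;> push_cast <;> ring
    simp only [act_Dm]
    rw [eh, if_neg hS', mul_zero, eval_zero]

variable [IsUltrametricDist L] [CompleteSpace L]

lemma HypS.chart_bound (h : HypS p L k α β) (A : ℕ) : ∃ C : ℝ, 0 < C ∧
    ∀ (n i : ℕ), i ≤ k - 2 → ∀ (a b c d : ℚ_[p]), ‖a‖ ≤ (p : ℝ) ^ A → ‖c‖ ≤ (p : ℝ) ^ A →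
    ‖d‖ ≤ (p : ℝ) ^ A → (∀ z : ℤ_[p], ((p : ℝ) ^ A)⁻¹ ≤ max ‖a * z + b‖ ‖c * z + d‖) →
    LP (k - 1) (n + 2 * A + 1)
      (fun z : ℤ_[p] => act α (Dm n) (eh k α β i) (a * (z : ℚ_[p]) + b) (c * (z : ℚ_[p]) + d)) ∧
    IsCr p L (valL p L α)
      (fun z : ℤ_[p] => act α (Dm n) (eh k α β i) (a * (z : ℚ_[p]) + b) (c * (z : ℚ_[p]) + d)) ∧
    crNorm p L (valL p L α)
      (fun z : ℤ_[p] => act α (Dm n) (eh k α β i) (a * (z : ℚ_[p]) + b) (c * (z : ℚ_[p]) + d)) ≤ C := by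
  have hp0 : (0 : ℝ) < p := by exact_mod_cast hp.out.pos
  have hα : 0 < ‖α‖ := norm_pos_iff.2 h.left_ne_zero
  have hk := h.two_le
  obtain ⟨C, hC, hb⟩ := isCr_of_fwdDiff_eq_zero p L h.pos_left (e := k - 1) (by omega)
  refine ⟨C * ((p : ℝ) ^ (2 * A + 1)) ^ valL p L α * ((p : ℝ) ^ A) ^ (2 * valL p L α),
    by positivity, fun n i hi a b c d ha hc hd hm => ?_⟩
  have hLP := h.chart_LP hi A n ha hc hm
  have hbd : ∀ z : ℤ_[p],
      ‖act α (Dm n) (eh k α β i) (a * (z : ℚ_[p]) + b) (c * (z : ℚ_[p]) + d)‖ ≤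
        ‖α‖ ^ n * ((p : ℝ) ^ A) ^ (2 * valL p L α) := fun z => by
    refine (h.norm_act_Dm_eh_le hi n _ _).trans ?_
    have := h.pos_left
    have hz : ‖(z : ℚ_[p])‖ ≤ 1 := z.norm_le_one
    gcongr
    refine (Padic.nonarchimedean _ _).trans (max_le ?_ hd)
    rw [norm_mul]
    exact (mul_le_of_le_one_right (norm_nonneg _) hz).trans hc
  obtain ⟨h1, h2⟩ := hb (n + 2 * A + 1) _ (‖α‖ ^ n * ((p : ℝ) ^ A) ^ (2 * valL p L α))
    hLP.continuous hLP.fwdDiff_eq_zero hbd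
  refine ⟨hLP, h1, h2.trans_eq ?_⟩
  rw [add_assoc, pow_add, Real.mul_rpow (by positivity) (by positivity), h.norm_left_pow]
  field_simp

variable [Fact (0 < valL p L α)]

variable (p L α) in
/-- The Banach space of pairs of charts. -/
abbrev BX : Type := CrSp p L (valL p L α) × CrSp p L (valL p L α)

lemma norm_max_adj_ge {A : ℕ} {g : Matrix (Fin 2) (Fin 2) ℚ_[p]} (hg : ∀ i j, ‖g i j‖ ≤ (p : ℝ) ^ A)
    (hd : ((p : ℝ) ^ A)⁻¹ ≤ ‖det2 p g‖) {x y : ℚ_[p]} (hxy : 1 ≤ max ‖x‖ ‖y‖) :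
    ((p : ℝ) ^ (2 * A))⁻¹ ≤ max ‖g 1 1 * x - g 0 1 * y‖ ‖-(g 1 0) * x + g 0 0 * y‖ := by
  have hp0 : (0 : ℝ) < p := by exact_mod_cast hp.out.pos
  set X := g 1 1 * x - g 0 1 * y
  set Y := -(g 1 0) * x + g 0 0 * y
  have key : ∀ i j i' j', ‖g i j * X + g i' j' * Y‖ ≤ (p : ℝ) ^ A * max ‖X‖ ‖Y‖ := by
    intro i j i' j'
    refine (Padic.nonarchimedean _ _).trans (max_le ?_ ?_) <;> rw [norm_mul]
    · exact mul_le_mul (hg _ _) (le_max_left _ _) (norm_nonneg _) (by positivity)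
    · exact mul_le_mul (hg _ _) (le_max_right _ _) (norm_nonneg _) (by positivity)
  have h1 : ‖det2 p g‖ ≤ (p : ℝ) ^ A * max ‖X‖ ‖Y‖ := by
    rcases le_max_iff.1 hxy with hx | hy
    · refine le_trans ?_ (key 0 0 0 1)
      rw [show g 0 0 * X + g 0 1 * Y = det2 p g * x by simp only [X, Y, det2]; ring, norm_mul]
      exact le_mul_of_one_le_right (norm_nonneg _) hx
    · refine le_trans ?_ (key 1 0 1 1)
      rw [show g 1 0 * X + g 1 1 * Y = det2 p g * y by simp only [X, Y, det2]; ring, norm_mul]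
      exact le_mul_of_one_le_right (norm_nonneg _) hy
  have h2 := hd.trans h1
  rw [two_mul, pow_add, mul_inv]
  rw [← inv_mul_le_iff₀ (by positivity)] at h2
  exact h2

lemma HypS.norm_zpow_valuation (h : HypS p L k α β) {x : ℚ_[p]} (hx : x ≠ 0) :
    ‖α ^ (-x.valuation)‖ = ‖x‖⁻¹ ^ valL p L α := by
  have hp0 : (0 : ℝ) < p := by exact_mod_cast hp.out.pos
  rw [norm_zpow, norm_eq_rpow_valL (p := p) h.left_ne_zero, Padic.norm_eq_zpow_neg_valuation hx,
    ← zpow_neg, ← Real.rpow_intCast, ← Real.rpow_intCast, ← Real.rpow_mul hp0.le,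
    ← Real.rpow_mul hp0.le]
  congr 1; push_cast; ring

/-- Uniform boundedness of the translates of the elementary functions by matrices in a bounded
subset of `GL₂(ℚ_p)`. -/
theorem HypS.exists_lift_atom (h : HypS p L k α β) (A : ℕ) : ∃ C : ℝ, 0 < C ∧
    ∀ g : Matrix (Fin 2) (Fin 2) ℚ_[p], (∀ i j, ‖g i j‖ ≤ (p : ℝ) ^ A) →
    ((p : ℝ) ^ A)⁻¹ ≤ ‖det2 p g‖ → ∀ n i : ℕ, i ≤ k - 2 →
    ∃ u : BX p L α, lift k α β u = act α g (act α (Dm n) (eh k α β i)) ∧ ‖u‖ ≤ C ∧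
      ∃ H, LP (k - 1) H u.1.fn ∧ LP (k - 1) H u.2.fn := by
  have hp0 : (0 : ℝ) < p := by exact_mod_cast hp.out.pos
  have hp1 : (1 : ℝ) ≤ p := by exact_mod_cast hp.out.one_lt.le
  obtain ⟨C, hC, hb⟩ := h.chart_bound (2 * A)
  refine ⟨((p : ℝ) ^ A) ^ valL p L α * C, by positivity, fun g hg hd n i hi => ?_⟩
  have hg' : ∀ i j, ‖g i j‖ ≤ (p : ℝ) ^ (2 * A) := fun i j =>
    (hg i j).trans (pow_le_pow_right₀ hp1 (by omega))
  have hdet : det2 p g ≠ 0 := norm_pos_iff.1 (lt_of_lt_of_le (by positivity) hd)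
  have hc : ‖α ^ (-(det2 p g).valuation)‖ ≤ ((p : ℝ) ^ A) ^ valL p L α := by
    rw [h.norm_zpow_valuation hdet]
    have := h.pos_left
    gcongr
    exact inv_le_of_inv_le₀ (by positivity) hd
  have hpn : ‖(p : ℚ_[p])‖ ≤ 1 := by
    rw [Padic.norm_p]; exact inv_le_one_of_one_le₀ hp1
  obtain ⟨a1, a2, a3⟩ := hb n i hi (g 1 1 * p) (-(g 0 1)) (-(g 1 0) * p) (g 0 0)
    (by rw [norm_mul]; exact (mul_le_of_le_one_right (norm_nonneg _) hpn).trans (hg' _ _))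
    (by rw [norm_mul, norm_neg]; exact (mul_le_of_le_one_right (norm_nonneg _) hpn).trans (hg' _ _))
    (hg' _ _) (fun z => by
      have := norm_max_adj_ge hg hd (x := p * z) (y := 1) (by simp)
      convert this using 3 <;> ring_nf)
  obtain ⟨b1, b2, b3⟩ := hb n i hi (-(g 0 1)) (g 1 1) (g 0 0) (-(g 1 0))
    (by rw [norm_neg]; exact hg' _ _) (hg' _ _)
    (by rw [norm_neg]; exact hg' _ _) (fun z => by
      have := norm_max_adj_ge hg hd (x := 1) (y := z) (by simp)
      convert this using 3 <;> ring_nf)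
  refine ⟨(α ^ (-(det2 p g).valuation)) • (CrSp.mk _ a2, CrSp.mk _ b2), ?_, ?_, _, a1.smul _,
    b1.smul _⟩
  · refine lift_eq_of_charts (((h.eh_homog hi).act _).act g) (fun z => ?_) (fun z => ?_)
    · rw [act_apply]
      simp only [Prod.smul_fst, CrSp.fn_smul, CrSp.fn_mk, Pi.smul_apply, smul_eq_mul]
      congr 2; ring_nf
    · rw [act_apply]
      simp only [Prod.smul_snd, CrSp.fn_smul, CrSp.fn_mk, Pi.smul_apply, smul_eq_mul]
      congr 2; ring_nf
  · rw [norm_smul]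
    exact mul_le_mul hc (max_le a3 b3) (norm_nonneg _) (by positivity)

end Atoms

section Extension

set_option linter.unusedSectionVars false

variable {p : ℕ} [hp : Fact p.Prime]
variable {L : Type} [NontriviallyNormedField L] [NormedAlgebra ℚ_[p] L]

/-- Membership in `GL₂(ℤ_p)`. -/
def IsK (g : Matrix (Fin 2) (Fin 2) ℚ_[p]) : Prop := (∀ i j, ‖g i j‖ ≤ 1) ∧ ‖det2 p g‖ = 1

lemma IsK.det_ne_zero {g : Matrix (Fin 2) (Fin 2) ℚ_[p]} (hg : IsK g) : det2 p g ≠ 0 :=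
  norm_pos_iff.1 (by rw [hg.2]; exact one_pos)

lemma IsK.mul {g g' : Matrix (Fin 2) (Fin 2) ℚ_[p]} (hg : IsK g) (hg' : IsK g') :
    IsK (g * g') := by
  refine ⟨fun i j => ?_, by rw [det2_mul, norm_mul, hg.2, hg'.2, one_mul]⟩
  rw [Matrix.mul_apply, Fin.sum_univ_two]
  refine (Padic.nonarchimedean _ _).trans (max_le ?_ ?_) <;> rw [norm_mul] <;>
    exact mul_le_one₀ (hg.1 _ _) (norm_nonneg _) (hg'.1 _ _)

/-- The upper unipotent matrix. -/
def unip (b : ℚ_[p]) : Matrix (Fin 2) (Fin 2) ℚ_[p] := !![1, b; 0, 1]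

/-- The swap of the two coordinates, with sign chosen to act by `H(x, y) ↦ H(y, x)`. -/
def sw : Matrix (Fin 2) (Fin 2) ℚ_[p] := !![0, -1; -1, 0]

lemma det2_unip (b : ℚ_[p]) : det2 p (unip b) = 1 := by simp [det2, unip]
lemma det2_sw : det2 p sw = -1 := by simp [det2, sw]

lemma isK_unip {b : ℚ_[p]} (hb : ‖b‖ ≤ 1) : IsK (unip b) := by
  refine ⟨fun i j => ?_, by rw [det2_unip, norm_one]⟩
  fin_cases i <;> fin_cases j <;> simp [unip, hb]

lemma isK_sw : IsK (sw : Matrix (Fin 2) (Fin 2) ℚ_[p]) := by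
  refine ⟨fun i j => ?_, by rw [det2_sw, norm_neg, norm_one]⟩
  fin_cases i <;> fin_cases j <;> simp [sw]

lemma isK_one : IsK (1 : Matrix (Fin 2) (Fin 2) ℚ_[p]) := by
  refine ⟨fun i j => ?_, by simp [det2]⟩
  fin_cases i <;> fin_cases j <;> simp

lemma act_unip (α : L) (b : ℚ_[p]) (H : ℚ_[p] → ℚ_[p] → L) (x y : ℚ_[p]) :
    act α (unip b) H x y = H (x - b * y) y := by
  rw [act_apply, det2_unip]; simp [unip]

lemma valuation_neg_one : (-1 : ℚ_[p]).valuation = 0 := by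
  rw [valuation_eq_of_norm_eq (y := 1) (by simp) (by simp), Padic.valuation_one]

lemma act_sw (α : L) (H : ℚ_[p] → ℚ_[p] → L) (x y : ℚ_[p]) :
    act α sw H x y = H y x := by
  rw [act_apply, det2_sw, valuation_neg_one]; simp [sw]

variable (p) in
/-- The elementary locally algebraic functions. -/
def atoms (k : ℕ) (α β : L) : Set (ℚ_[p] → ℚ_[p] → L) :=
  {H | ∃ (g : Matrix (Fin 2) (Fin 2) ℚ_[p]) (n i : ℕ), IsK g ∧ i ≤ k - 2 ∧
    H = act α g (act α (Dm n) (eh k α β i))}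

variable (p) in
/-- The span of the elementary functions. -/
def SS (k : ℕ) (α β : L) : Submodule L (ℚ_[p] → ℚ_[p] → L) := Submodule.span L (atoms p k α β)

/-- The part of `lift` supported on the first chart. -/
def chartLift₁ (k : ℕ) (α β : L) : (ℤ_[p] → L) →ₗ[L] (ℚ_[p] → ℚ_[p] → L) where
  toFun f := fun x y => if ‖x‖ < ‖y‖ then psi k α β y * f (toZ (x / ((p : ℚ_[p]) * y))) else 0
  map_add' f g := by ext x y; simp only [Pi.add_apply]; split_ifs <;> ring
  map_smul' c f := by
    ext x y; simp only [Pi.smul_apply, smul_eq_mul, RingHom.id_apply]; split_ifs <;> ring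

/-- The part of `lift` supported on the second chart. -/
def chartLift₂ (k : ℕ) (α β : L) : (ℤ_[p] → L) →ₗ[L] (ℚ_[p] → ℚ_[p] → L) where
  toFun f := fun x y => if ‖x‖ < ‖y‖ then 0 else
    if x = 0 then 0 else psi k α β x * f (toZ (y / x))
  map_add' f g := by ext x y; simp only [Pi.add_apply]; split_ifs <;> ring
  map_smul' c f := by
    ext x y; simp only [Pi.smul_apply, smul_eq_mul, RingHom.id_apply]; split_ifs <;> ring

variable {k : ℕ} {α β : L}

lemma dvd_iff_norm_le {h : ℕ} {z : ℤ_[p]} :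
    (p : ℤ_[p]) ^ h ∣ z ↔ ‖(z : ℚ_[p])‖ ≤ ((p : ℝ) ^ h)⁻¹ := by
  rw [← PadicInt.norm_le_pow_iff_mem_span_pow z h |>.trans Ideal.mem_span_singleton,
    zpow_neg, zpow_natCast]
  rfl

lemma HypS.act_unip_Dm_eh (h : HypS p L k α β) {j : ℕ} (hj : j ≤ k - 2) (n : ℕ) (b x y : ℚ_[p]) :
    (α ^ n * (psi k α β ((p : ℚ_[p]) ^ n))⁻¹) *
      act α (unip b) (act α (Dm n) (eh k α β j)) x y =
    if ‖x - b * y‖ ≤ ((p : ℝ) ^ n)⁻¹ * ‖y‖ ∧ y ≠ 0 then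
      psi k α β y * iotaL p L ((x - b * y) / ((p : ℚ_[p]) ^ n * y)) ^ j else 0 := by
  have hpn : (p : ℚ_[p]) ^ n ≠ 0 := pow_ne_zero _ prime_cast_ne_zero
  have h1 := h.psi_ne_zero hpn
  have h2 := h.left_ne_zero
  rw [act_unip, act_Dm, eh, norm_mul, norm_p_pow]
  simp only [mul_ne_zero_iff, and_iff_right hpn]
  split_ifs with hxy
  · rw [eh_term_eq hj _ (mul_ne_zero hpn hxy.2), h.psi_mul hpn hxy.2, zpow_neg, zpow_natCast]
    field_simp
  · simp

lemma HypS.chartLift₁_ballMon (h : HypS p L k α β) {j : ℕ} (hj : j ≤ k - 2) (n : ℕ) (x : ℤ_[p]) :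
    chartLift₁ k α β (ballMon n x j) =
      (α ^ (n + 1) * (psi k α β ((p : ℚ_[p]) ^ (n + 1)))⁻¹) •
        act α (unip ((p : ℚ_[p]) * (x : ℚ_[p]))) (act α (Dm (n + 1)) (eh k α β j)) := by
  have hp0 : (0 : ℝ) < p := by exact_mod_cast hp.out.pos
  have hp1 : (1 : ℝ) < p := by exact_mod_cast hp.out.one_lt
  ext X Y
  rw [Pi.smul_apply, Pi.smul_apply, smul_eq_mul, h.act_unip_Dm_eh hj]
  change (if ‖X‖ < ‖Y‖ then _ else _) = _
  by_cases hXY : ‖X‖ < ‖Y‖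
  · have hY : Y ≠ 0 := by rintro rfl; simp at hXY; linarith [norm_nonneg X]
    have hz := coe_toZ (norm_div_le_one_of_lt hXY)
    have e1 : X / ((p : ℚ_[p]) * Y) - x = (X - (p : ℚ_[p]) * x * Y) / (p * Y) := by
      field_simp [prime_cast_ne_zero (p := p)]
    have e2 : (p : ℤ_[p]) ^ n ∣ toZ (X / ((p : ℚ_[p]) * Y)) - x ↔
        ‖X - (p : ℚ_[p]) * x * Y‖ ≤ ((p : ℝ) ^ (n + 1))⁻¹ * ‖Y‖ ∧ Y ≠ 0 := by
      rw [dvd_iff_norm_le, PadicInt.coe_sub, hz, e1, norm_div, norm_mul, Padic.norm_p,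
        div_le_iff₀ (by have := norm_pos_iff.2 hY; positivity), pow_succ, mul_inv,
        and_iff_left hY, mul_assoc ((p : ℝ) ^ n)⁻¹]
    rw [if_pos hXY, ballMon]
    by_cases hd : (p : ℤ_[p]) ^ n ∣ toZ (X / ((p : ℚ_[p]) * Y)) - x
    · rw [if_pos hd, if_pos (e2.1 hd), hz, e1, div_div, pow_succ]
      ring_nf
    · rw [if_neg hd, if_neg (fun h => hd (e2.2 h)), mul_zero]
  · rw [if_neg hXY, if_neg]
    rintro ⟨h1, hY⟩
    have hY' := norm_pos_iff.2 hY
    apply hXY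
    rw [show X = (X - (p : ℚ_[p]) * x * Y) + (p : ℚ_[p]) * x * Y by ring]
    refine (Padic.nonarchimedean _ _).trans_lt (max_lt (h1.trans_lt ?_) ?_)
    · exact mul_lt_of_lt_one_left hY' (inv_lt_one_of_one_lt₀ (one_lt_pow₀ hp1 (by omega)))
    · rw [norm_mul]; exact mul_lt_of_lt_one_left hY' (norm_p_mul_lt x)

lemma HypS.chartLift₂_ballMon (h : HypS p L k α β) {j : ℕ} (hj : j ≤ k - 2) (n : ℕ) (x : ℤ_[p]) :
    chartLift₂ k α β (ballMon n x j) =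
      (α ^ n * (psi k α β ((p : ℚ_[p]) ^ n))⁻¹) •
        act α sw (act α (unip (x : ℚ_[p])) (act α (Dm n) (eh k α β j))) := by
  have hp0 : (0 : ℝ) < p := by exact_mod_cast hp.out.pos
  have hp1 : (1 : ℝ) ≤ p := by exact_mod_cast hp.out.one_lt.le
  ext X Y
  rw [Pi.smul_apply, Pi.smul_apply, smul_eq_mul, act_sw, h.act_unip_Dm_eh hj]
  change (if ‖X‖ < ‖Y‖ then _ else _) = _
  by_cases hXY : ‖X‖ < ‖Y‖
  · rw [if_pos hXY, if_neg]
    rintro ⟨h1, hX⟩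
    refine hXY.not_ge ?_
    rw [show Y = (Y - x * X) + x * X by ring]
    refine (Padic.nonarchimedean _ _).trans (max_le (h1.trans ?_) ?_)
    · exact mul_le_of_le_one_left (norm_nonneg _) (inv_le_one_of_one_le₀ (one_le_pow₀ hp1))
    · rw [norm_mul]; exact mul_le_of_le_one_left (norm_nonneg _) x.norm_le_one
  · rw [if_neg hXY]
    by_cases hX : X = 0
    · rw [if_pos hX, if_neg (by simp [hX])]
    have hz : ((toZ (Y / X) : ℤ_[p]) : ℚ_[p]) = Y / X := coe_toZ (by
      rw [norm_div]; exact (div_le_one (norm_pos_iff.2 hX)).2 (not_lt.1 hXY))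
    have e1 : Y / X - x = (Y - x * X) / X := by field_simp
    have e2 : (p : ℤ_[p]) ^ n ∣ toZ (Y / X) - x ↔
        ‖Y - x * X‖ ≤ ((p : ℝ) ^ n)⁻¹ * ‖X‖ ∧ X ≠ 0 := by
      rw [dvd_iff_norm_le, PadicInt.coe_sub, hz, e1, norm_div,
        div_le_iff₀ (norm_pos_iff.2 hX), and_iff_left hX]
    rw [if_neg hX, ballMon]
    by_cases hd : (p : ℤ_[p]) ^ n ∣ toZ (Y / X) - x
    · rw [if_pos hd, if_pos (e2.1 hd), hz, e1, div_div, mul_comm X]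
    · rw [if_neg hd, if_neg (fun h => hd (e2.2 h)), mul_zero]

lemma HypS.norm_coeff (h : HypS p L k α β) (n : ℕ) :
    ‖α ^ n * (psi k α β ((p : ℚ_[p]) ^ n))⁻¹‖ = ((p : ℝ) ^ n) ^ valL p L α := by
  have hα := norm_pos_iff.2 h.left_ne_zero
  rw [norm_mul, norm_inv, h.norm_psi (pow_ne_zero _ prime_cast_ne_zero), norm_p_pow,
    mul_comm 2, Real.rpow_mul (by positivity), Real.inv_rpow (by positivity), h.norm_left_pow,
    norm_pow, Real.rpow_two]
  field_simp

lemma HypS.lt_natCast (h : HypS p L k α β) : valL p L α < (k - 1 : ℕ) := by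
  have := h.sum
  have := h.pos_right
  rw [Nat.cast_sub (by linarith [h.two_le])]
  push_cast; linarith

variable (p) in
/-- Multiples of elementary functions with bounded coefficients. -/
def smallAtoms (k : ℕ) (α β : L) (M : ℝ) : Set (ℚ_[p] → ℚ_[p] → L) :=
  {F | ∃ (c : L), ∃ a ∈ atoms p k α β, ‖c‖ ≤ M ∧ F = c • a}

lemma smallAtoms_subset (M : ℝ) : smallAtoms p k α β M ⊆ SS p k α β := by
  rintro _ ⟨c, a, ha, -, rfl⟩
  exact Submodule.smul_mem _ _ (Submodule.subset_span ha)

lemma closure_smallAtoms_le (M : ℝ) :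
    AddSubgroup.closure (smallAtoms p k α β M) ≤ (SS p k α β).toAddSubgroup :=
  (AddSubgroup.closure_le _).2 (smallAtoms_subset M)

lemma atom_unip {b : ℚ_[p]} (hb : ‖b‖ ≤ 1) (n : ℕ) {j : ℕ} (hj : j ≤ k - 2) :
    act α (unip b) (act α (Dm n) (eh k α β j)) ∈ atoms p k α β :=
  ⟨_, n, j, isK_unip hb, hj, rfl⟩

lemma act_mem_atoms (hα : α ≠ 0) {g : Matrix (Fin 2) (Fin 2) ℚ_[p]} (hg : IsK g)
    {H : ℚ_[p] → ℚ_[p] → L} (hH : H ∈ atoms p k α β) : act α g H ∈ atoms p k α β := by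
  obtain ⟨g', n, i, hg', hi, rfl⟩ := hH
  exact ⟨g * g', n, i, hg.mul hg', hi, (act_mul hα hg.det_ne_zero hg'.det_ne_zero _).symm⟩

variable [IsUltrametricDist L] [CompleteSpace L] [Fact (0 < valL p L α)]

lemma lift_eq_chartLift (u : BX p L α) :
    lift k α β u = chartLift₁ k α β u.1.fn + chartLift₂ k α β u.2.fn := by
  ext x y
  rw [lift_apply, Pi.add_apply, Pi.add_apply]
  simp only [chartLift₁, chartLift₂, LinearMap.coe_mk, AddHom.coe_mk]
  split_ifs <;> simp

theorem HypS.lift_mem_closure (h : HypS p L k α β) : ∃ C : ℝ, 0 < C ∧ ∀ (u : BX p L α) (H : ℕ),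
    LP (k - 1) H u.1.fn → LP (k - 1) H u.2.fn →
    lift k α β u ∈ AddSubgroup.closure (smallAtoms p k α β (C * ‖u‖)) := by
  have hp0 : (0 : ℝ) < p := by exact_mod_cast hp.out.pos
  have hp1 : (1 : ℝ) ≤ p := by exact_mod_cast hp.out.one_lt.le
  have hk := h.two_le
  have hf : 0 < ‖((k - 1).factorial : ℚ_[p])‖ := norm_pos_iff.2 (by
    exact_mod_cast Nat.factorial_ne_zero _)
  have hr := h.pos_left
  refine ⟨(p : ℝ) ^ valL p L α * (‖((k - 1).factorial : ℚ_[p])‖⁻¹ * (p : ℝ) ^ valL p L α),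
    by positivity, fun u H h1 h2 => ?_⟩
  rw [lift_eq_chartLift]
  have m1 := u.1.isCr.mem_closure_ballMonSet h.pos_left h.lt_natCast.le h1
  have m2 := u.2.isCr.mem_closure_ballMonSet h.pos_left h.lt_natCast.le h2
  rw [← CrSp.norm_def] at m1 m2
  have n1 : ‖u.1‖ ≤ ‖u‖ := le_max_left _ _
  have n2 : ‖u.2‖ ≤ ‖u‖ := le_max_right _ _
  refine add_mem ?_ ?_
  · have : AddSubgroup.closure (ballMonSet p L (valL p L α) (k - 1)
        (‖((k - 1).factorial : ℚ_[p])‖⁻¹ * (p : ℝ) ^ valL p L α * ‖u.1‖)) ≤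
        (AddSubgroup.closure (smallAtoms p k α β ((p : ℝ) ^ valL p L α *
          (‖((k - 1).factorial : ℚ_[p])‖⁻¹ * (p : ℝ) ^ valL p L α) * ‖u‖))).comap
          (chartLift₁ k α β).toAddMonoidHom := by
      rw [AddSubgroup.closure_le]
      rintro _ ⟨n, x, j, c, -, hj, hc, rfl⟩
      apply AddSubgroup.subset_closure
      have hj' : j ≤ k - 2 := by omega
      refine ⟨c * (α ^ (n + 1) * (psi k α β ((p : ℚ_[p]) ^ (n + 1)))⁻¹),
        _, atom_unip (norm_p_mul_lt ((x : ℕ) : ℤ_[p])).le (n + 1) hj', ?_, ?_⟩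
      · rw [norm_mul, h.norm_coeff, pow_succ, Real.mul_rpow (by positivity) (by positivity),
          ← mul_assoc, mul_comm (_ * _) ((p : ℝ) ^ valL p L α), mul_assoc]
        refine mul_le_mul_of_nonneg_left (hc.trans ?_) (by positivity)
        gcongr
      · change chartLift₁ k α β (c • _) = _
        rw [map_smul, h.chartLift₁_ballMon hj', smul_smul]
    exact this m1
  · have : AddSubgroup.closure (ballMonSet p L (valL p L α) (k - 1)
        (‖((k - 1).factorial : ℚ_[p])‖⁻¹ * (p : ℝ) ^ valL p L α * ‖u.2‖)) ≤
        (AddSubgroup.closure (smallAtoms p k α β ((p : ℝ) ^ valL p L α *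
          (‖((k - 1).factorial : ℚ_[p])‖⁻¹ * (p : ℝ) ^ valL p L α) * ‖u‖))).comap
          (chartLift₂ k α β).toAddMonoidHom := by
      rw [AddSubgroup.closure_le]
      rintro _ ⟨n, x, j, c, -, hj, hc, rfl⟩
      apply AddSubgroup.subset_closure
      have hj' : j ≤ k - 2 := by omega
      refine ⟨c * (α ^ n * (psi k α β ((p : ℚ_[p]) ^ n))⁻¹),
        _, act_mem_atoms h.left_ne_zero isK_sw
          (atom_unip (b := (((x : ℕ) : ℤ_[p]) : ℚ_[p])) (PadicInt.norm_le_one _) n hj'), ?_, ?_⟩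
      · rw [norm_mul, h.norm_coeff]
        refine hc.trans ?_
        rw [mul_assoc ((p : ℝ) ^ valL p L α)]
        refine le_trans ?_ (le_mul_of_one_le_left (by positivity)
          (Real.one_le_rpow hp1 hr.le))
        gcongr
      · change chartLift₂ k α β (c • _) = _
        rw [map_smul, h.chartLift₂_ballMon hj', smul_smul]
    exact this m2

variable (p) in
/-- The pairs of charts whose lift is a combination of elementary functions. -/
def DD (k : ℕ) (α β : L) [Fact (0 < valL p L α)] : Submodule L (BX p L α) :=
  (SS p k α β).comap (lift k α β)

lemma mem_DD {u : BX p L α} : u ∈ DD p k α β ↔ lift k α β u ∈ SS p k α β := Iff.rfl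

lemma HypS.mem_DD_of_LP (h : HypS p L k α β) {u : BX p L α} {H : ℕ} (h1 : LP (k - 1) H u.1.fn)
    (h2 : LP (k - 1) H u.2.fn) : u ∈ DD p k α β := by
  obtain ⟨C, -, hC⟩ := h.lift_mem_closure
  exact closure_smallAtoms_le _ (hC u H h1 h2)

lemma HypS.exists_lift_of_atom (h : HypS p L k α β) : ∃ C : ℝ, 0 < C ∧
    ∀ a ∈ atoms p k α β, ∃ u : BX p L α, lift k α β u = a ∧ ‖u‖ ≤ C ∧
      ∃ H, LP (k - 1) H u.1.fn ∧ LP (k - 1) H u.2.fn := by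
  obtain ⟨C, hC, hb⟩ := h.exists_lift_atom 0
  refine ⟨C, hC, ?_⟩
  rintro _ ⟨g, n, i, hg, hi, rfl⟩
  exact hb g (by simpa using hg.1) (by simp [hg.2]) n i hi

lemma HypS.exists_LP_of_mem_SS (h : HypS p L k α β) {F : ℚ_[p] → ℚ_[p] → L}
    (hF : F ∈ SS p k α β) : ∃ u : BX p L α, lift k α β u = F ∧
      ∃ H, LP (k - 1) H u.1.fn ∧ LP (k - 1) H u.2.fn := by
  have hk := h.two_le
  obtain ⟨C, -, hC⟩ := h.exists_lift_of_atom
  induction hF using Submodule.span_induction with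
  | mem a ha =>
    obtain ⟨u, h1, -, h2⟩ := hC a ha
    exact ⟨u, h1, h2⟩
  | zero =>
    refine ⟨0, map_zero _, 0, fun z => ⟨0, by simp; omega, fun s => ?_⟩,
      fun z => ⟨0, by simp; omega, fun s => ?_⟩⟩ <;> simp [CrSp.fn_zero]
  | add F G _ _ hF hG =>
    obtain ⟨u, hu, H, u1, u2⟩ := hF
    obtain ⟨v, hv, H', v1, v2⟩ := hG
    refine ⟨u + v, by rw [map_add, hu, hv], max H H', ?_, ?_⟩
    · exact (u1.mono_level (le_max_left _ _)).add (v1.mono_level (le_max_right _ _))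
    · exact (u2.mono_level (le_max_left _ _)).add (v2.mono_level (le_max_right _ _))
  | smul c F _ hF =>
    obtain ⟨u, hu, H, u1, u2⟩ := hF
    exact ⟨c • u, by rw [map_smul, hu], H, u1.smul c, u2.smul c⟩

lemma HypS.LP_of_mem_DD (h : HypS p L k α β) {u : BX p L α} (hu : u ∈ DD p k α β) :
    ∃ H, LP (k - 1) H u.1.fn ∧ LP (k - 1) H u.2.fn := by
  obtain ⟨v, hv, hH⟩ := h.exists_LP_of_mem_SS hu
  rwa [lift_injective _ _ _ hv] at hH

lemma HypS.dense_DD (h : HypS p L k α β) : Dense (DD p k α β : Set (BX p L α)) := by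
  rw [Metric.dense_iff]
  intro u ε hε
  obtain ⟨f, H, f1, f2, f3⟩ := exists_LP_near h.pos_left h.lt_natCast u.1.isCr hε
  obtain ⟨g, H', g1, g2, g3⟩ := exists_LP_near h.pos_left h.lt_natCast u.2.isCr hε
  refine ⟨(CrSp.mk f f2, CrSp.mk g g2), ?_, ?_⟩
  · rw [Metric.mem_ball, dist_comm, dist_eq_norm]
    exact max_lt f3 g3
  · exact h.mem_DD_of_LP (H := max H H') (f1.mono_level (le_max_left _ _))
      (g1.mono_level (le_max_right _ _))

/-- Operators on the elementary functions that are bounded on the atoms extend continuously. -/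
theorem HypS.exists_extension (h : HypS p L k α β) : ∃ C : ℝ, 0 < C ∧
    ∀ (E : Type) [NormedAddCommGroup E] [NormedSpace L E] [IsUltrametricDist E] [CompleteSpace E]
      (T : DD p k α β →ₗ[L] E) (M : ℝ), (∀ u : DD p k α β, lift k α β u.1 ∈ atoms p k α β → ‖T u‖ ≤ M) →
      ∃ T' : BX p L α →L[L] E, (∀ u : DD p k α β, T' u = T u) ∧ ∀ u, ‖T' u‖ ≤ C * M * ‖u‖ := by
  obtain ⟨C, hC, hmem⟩ := h.lift_mem_closure
  refine ⟨C, hC, fun E _ _ _ _ T M hT => ?_⟩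
  have hM : 0 ≤ M := by
    obtain ⟨C', -, hC'⟩ := h.exists_lift_of_atom
    have ha : act α 1 (act α (Dm 0) (eh k α β 0)) ∈ atoms p k α β :=
      ⟨1, 0, 0, isK_one, Nat.zero_le _, rfl⟩
    obtain ⟨u, hu, -⟩ := hC' _ ha
    have hu' : lift k α β u ∈ atoms p k α β := hu ▸ ha
    exact (norm_nonneg _).trans (hT ⟨u, Submodule.subset_span hu'⟩ hu')
  have key : ∀ u : DD p k α β, ‖T u‖ ≤ C * M * ‖(DD p k α β).subtype u‖ := by
    intro u
    obtain ⟨H, h1, h2⟩ := h.LP_of_mem_DD u.2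
    have hm := hmem u.1 H h1 h2
    have claim : ∀ F ∈ AddSubgroup.closure (smallAtoms p k α β (C * ‖u.1‖)),
        ∃ v : DD p k α β, lift k α β v.1 = F ∧ ‖T v‖ ≤ C * M * ‖u.1‖ := by
      intro F hF
      induction hF using AddSubgroup.closure_induction with
      | mem F hF =>
        obtain ⟨c, a, ha, hc, rfl⟩ := hF
        obtain ⟨v, hv, -⟩ := h.exists_LP_of_mem_SS (Submodule.subset_span ha)
        have hv' : lift k α β v ∈ atoms p k α β := hv ▸ ha
        refine ⟨c • ⟨v, Submodule.subset_span hv'⟩, ?_, ?_⟩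
        · rw [Submodule.coe_smul, map_smul, hv]
        · rw [map_smul, norm_smul]
          calc ‖c‖ * _ ≤ (C * ‖u.1‖) * M := by
                gcongr
                exact hT _ hv'
            _ = _ := by ring
      | zero => exact ⟨0, by simp, by rw [map_zero, norm_zero]; positivity⟩
      | add F G _ _ hF hG =>
        obtain ⟨v, hv, nv⟩ := hF
        obtain ⟨w, hw, nw⟩ := hG
        refine ⟨v + w, by rw [Submodule.coe_add, map_add, hv, hw], ?_⟩
        rw [map_add]
        exact (IsUltrametricDist.norm_add_le_max _ _).trans (max_le nv nw)
      | neg F _ hF =>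
        obtain ⟨v, hv, nv⟩ := hF
        exact ⟨-v, by rw [Submodule.coe_neg, map_neg, hv], by rwa [map_neg, norm_neg]⟩
    obtain ⟨v, hv, nv⟩ := claim _ hm
    rwa [Subtype.ext (lift_injective _ _ _ hv)] at nv
  have hd : DenseRange (DD p k α β).subtype := by
    rw [DenseRange, Submodule.coe_subtype, Subtype.range_coe]; exact h.dense_DD
  exact ⟨T.extendOfNorm (DD p k α β).subtype,
    fun u => LinearMap.extendOfNorm_eq hd ⟨_, key⟩ u,
    fun u => LinearMap.norm_extendOfNorm_apply_le hd _ key u⟩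

/-- Continuous linear maps agreeing on the atoms are equal. -/
lemma HypS.clm_ext (h : HypS p L k α β) {E : Type} [NormedAddCommGroup E] [NormedSpace L E]
    {S T : BX p L α →L[L] E} (hST : ∀ u, lift k α β u ∈ atoms p k α β → S u = T u) : S = T := by
  have h1 : ∀ F ∈ SS p k α β, ∃ u : BX p L α, lift k α β u = F ∧ S u = T u := by
    intro F hF
    induction hF using Submodule.span_induction with
    | mem a ha =>
      obtain ⟨v, hv, -⟩ := h.exists_LP_of_mem_SS (Submodule.subset_span ha)
      exact ⟨v, hv, hST v (hv ▸ ha)⟩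
    | zero => exact ⟨0, by simp⟩
    | add F G _ _ hF hG =>
      obtain ⟨u, hu, u1⟩ := hF
      obtain ⟨v, hv, v1⟩ := hG
      exact ⟨u + v, by rw [map_add, hu, hv], by rw [map_add, map_add, u1, v1]⟩
    | smul c F _ hF =>
      obtain ⟨u, hu, u1⟩ := hF
      exact ⟨c • u, by rw [map_smul, hu], by rw [map_smul, map_smul, u1]⟩
  refine ContinuousLinearMap.coeFn_injective 
    (Continuous.ext_on h.dense_DD S.continuous T.continuous ?_)
  intro u hu
  obtain ⟨v, hv, e⟩ := h1 _ hu
  rwa [lift_injective _ _ _ hv] at e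

end Extension

section Rho

set_option linter.unusedSectionVars false

variable {p : ℕ} [hp : Fact p.Prime]
variable {L : Type} [NontriviallyNormedField L] [NormedAlgebra ℚ_[p] L]
variable {k : ℕ} {α β : L}
variable [IsUltrametricDist L] [CompleteSpace L] [Fact (0 < valL p L α)]

instance : IsUltrametricDist (BX p L α) :=
  IsUltrametricDist.isUltrametricDist_of_forall_norm_add_le_max_norm fun u v => by
    simp only [Prod.norm_def, Prod.fst_add, Prod.snd_add]
    have h1 := IsUltrametricDist.norm_add_le_max u.1 v.1
    have h2 := IsUltrametricDist.norm_add_le_max u.2 v.2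
    exact max_le (h1.trans (max_le_max (le_max_left _ _) (le_max_left _ _)))
      (h2.trans (max_le_max (le_max_right _ _) (le_max_right _ _)))

/-- A linear operator with values in the range of `lift` factors through `lift`. -/
lemma exists_factor_lift {V : Type} [AddCommGroup V] [Module L V] (k : ℕ) (β : L)
    (A : V →ₗ[L] (ℚ_[p] → ℚ_[p] → L)) (hA : ∀ v, ∃ u : BX p L α, lift k α β u = A v) :
    ∃ T : V →ₗ[L] BX p L α, ∀ v, lift k α β (T v) = A v := by
  let e := LinearEquiv.ofInjective (lift k α β : BX p L α →ₗ[L] _) (lift_injective k α β)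
  have hA' : ∀ v, A v ∈ LinearMap.range (lift k α β : BX p L α →ₗ[L] _) := hA
  refine ⟨e.symm.toLinearMap ∘ₗ A.codRestrict _ hA', fun v => ?_⟩
  have : e (e.symm (A.codRestrict _ hA' v)) = A.codRestrict _ hA' v := e.apply_symm_apply _
  exact congrArg Subtype.val this

lemma HypS.exists_rho (h : HypS p L k α β) (A : ℕ) : ∃ C : ℝ, 0 < C ∧
    ∀ g : Matrix (Fin 2) (Fin 2) ℚ_[p], (∀ i j, ‖g i j‖ ≤ (p : ℝ) ^ A) →
    ((p : ℝ) ^ A)⁻¹ ≤ ‖det2 p g‖ →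
    ∃ T : BX p L α →L[L] BX p L α, (∀ u, lift k α β (T u) = act α g (lift k α β u)) ∧
      ∀ u, ‖T u‖ ≤ C * ‖u‖ := by
  have hp0 : (0 : ℝ) < p := by exact_mod_cast hp.out.pos
  obtain ⟨C, hC, hb⟩ := h.exists_lift_atom A
  obtain ⟨C', hC', hext⟩ := h.exists_extension
  refine ⟨C' * C, by positivity, fun g hg hd => ?_⟩
  have hdet : det2 p g ≠ 0 := norm_pos_iff.1 (lt_of_lt_of_le (by positivity) hd)
  have hatom : ∀ a ∈ atoms p k α β, ∃ v : BX p L α, lift k α β v = act α g a ∧ ‖v‖ ≤ C := by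
    rintro _ ⟨g', n, i, hg', hi, rfl⟩
    have e1 : ∀ i j, ‖(g * g') i j‖ ≤ (p : ℝ) ^ A := fun i j => by
      rw [Matrix.mul_apply, Fin.sum_univ_two]
      refine (Padic.nonarchimedean _ _).trans (max_le ?_ ?_) <;> rw [norm_mul] <;>
        exact (mul_le_of_le_one_right (norm_nonneg _) (hg'.1 _ _)).trans (hg _ _)
    have e2 : ((p : ℝ) ^ A)⁻¹ ≤ ‖det2 p (g * g')‖ := by
      rwa [det2_mul, norm_mul, hg'.2, mul_one]
    obtain ⟨v, h1, h2, -⟩ := hb (g * g') e1 e2 n i hi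
    exact ⟨v, by rw [h1, act_mul h.left_ne_zero hdet hg'.det_ne_zero], h2⟩
  have hSS : ∀ F ∈ SS p k α β, ∃ v : BX p L α, lift k α β v = act α g F := by
    intro F hF
    have : SS p k α β ≤ (LinearMap.range (lift k α β : BX p L α →ₗ[L] _)).comap (act α g) :=
      Submodule.span_le.2 fun a ha => by
        obtain ⟨v, hv, -⟩ := hatom a ha
        exact ⟨v, hv⟩
    exact this hF
  obtain ⟨T, hT⟩ := exists_factor_lift (α := α) k β
    (act α g ∘ₗ lift k α β ∘ₗ (DD p k α β).subtype) (fun u => hSS _ u.2)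
  obtain ⟨T', h1, h2⟩ := hext (BX p L α) T C (fun u hu => by
    obtain ⟨v, hv, hn⟩ := hatom _ hu
    have : T u = v := lift_injective k α β ((hT u).trans hv.symm)
    rwa [this])
  refine ⟨T', fun u => ?_, h2⟩
  ext x y
  rw [act_apply, ← liftEval_apply, ← liftEval_apply]
  have := h.clm_ext (S := (liftEval k α β x y).comp T')
    (T := (α ^ (-(det2 p g).valuation)) •
      liftEval k α β (g 1 1 * x - g 0 1 * y) (-(g 1 0) * x + g 0 0 * y)) (fun u hu => by
      have e1 := h1 ⟨u, Submodule.subset_span hu⟩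
      simp only [ContinuousLinearMap.comp_apply, smul_apply, smul_eq_mul]
      rw [e1, liftEval_apply, liftEval_apply, hT]
      rfl)
  exact DFunLike.congr_fun this u

/-- The action of a matrix on pairs of charts. -/
def rho (k : ℕ) (α β : L) [Fact (0 < valL p L α)] (g : Matrix (Fin 2) (Fin 2) ℚ_[p]) :
    BX p L α →L[L] BX p L α :=
  if h : ∃ T : BX p L α →L[L] BX p L α, ∀ u, lift k α β (T u) = act α g (lift k α β u)
  then h.choose else 0

lemma exists_pow_bound (g : Matrix (Fin 2) (Fin 2) ℚ_[p]) (hg : det2 p g ≠ 0) :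
    ∃ A : ℕ, (∀ i j, ‖g i j‖ ≤ (p : ℝ) ^ A) ∧ ((p : ℝ) ^ A)⁻¹ ≤ ‖det2 p g‖ := by
  have hp1 : (1 : ℝ) < p := by exact_mod_cast hp.out.one_lt
  have hd := norm_pos_iff.2 hg
  obtain ⟨A, hA⟩ := pow_unbounded_of_one_lt
    (‖g 0 0‖ + ‖g 0 1‖ + ‖g 1 0‖ + ‖g 1 1‖ + ‖det2 p g‖⁻¹) hp1
  have h1 := norm_nonneg (g 0 0)
  have h2 := norm_nonneg (g 0 1)
  have h3 := norm_nonneg (g 1 0)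
  have h4 := norm_nonneg (g 1 1)
  have h5 := inv_pos.2 hd
  refine ⟨A, fun i j => ?_, inv_le_of_inv_le₀ hd (by linarith)⟩
  fin_cases i <;> fin_cases j <;> simp only [Fin.zero_eta, Fin.mk_one] <;> linarith

lemma HypS.lift_rho (h : HypS p L k α β) {g : Matrix (Fin 2) (Fin 2) ℚ_[p]} (hg : det2 p g ≠ 0)
    (u : BX p L α) : lift k α β (rho k α β g u) = act α g (lift k α β u) := by
  obtain ⟨A, h1, h2⟩ := exists_pow_bound g hg
  obtain ⟨C, -, hC⟩ := h.exists_rho A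
  obtain ⟨T, hT, -⟩ := hC g h1 h2
  have hex : ∃ T : BX p L α →L[L] BX p L α, ∀ u, lift k α β (T u) = act α g (lift k α β u) :=
    ⟨T, hT⟩
  rw [rho, dif_pos hex]
  exact hex.choose_spec u

lemma HypS.norm_rho_le (h : HypS p L k α β) : ∃ C : ℝ, 0 < C ∧
    ∀ g : Matrix (Fin 2) (Fin 2) ℚ_[p], IsK g → ∀ u : BX p L α,
      ‖rho k α β g u‖ ≤ C * ‖u‖ := by
  obtain ⟨C, h0, hC⟩ := h.exists_rho 0
  refine ⟨C, h0, fun g hg u => ?_⟩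
  obtain ⟨T, hT, hn⟩ := hC g (by simpa using hg.1) (by simp [hg.2])
  have : rho k α β g u = T u :=
    lift_injective k α β ((h.lift_rho hg.det_ne_zero u).trans (hT u).symm)
  rw [this]; exact hn u

lemma HypS.rho_mul (h : HypS p L k α β) {g g' : Matrix (Fin 2) (Fin 2) ℚ_[p]}
    (hg : det2 p g ≠ 0) (hg' : det2 p g' ≠ 0) (u : BX p L α) :
    rho k α β (g * g') u = rho k α β g (rho k α β g' u) := by
  apply lift_injective k α β
  rw [h.lift_rho hg, h.lift_rho hg', h.lift_rho (by rw [det2_mul]; exact mul_ne_zero hg hg'),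
    act_mul h.left_ne_zero hg hg']

lemma HypS.rho_one (h : HypS p L k α β) (u : BX p L α) : rho k α β 1 u = u := by
  apply lift_injective k α β
  rw [h.lift_rho isK_one.det_ne_zero, act_one]

end Rho

section Mon

set_option linter.unusedSectionVars false

variable {p : ℕ} [hp : Fact p.Prime]
variable {L : Type} [NontriviallyNormedField L] [NormedAlgebra ℚ_[p] L]
variable {k : ℕ} {α β : L}

/-- The homogeneous function extending `z ↦ z^j`. -/
def mon (k : ℕ) (α β : L) (j : ℕ) : ℚ_[p] → ℚ_[p] → L := fun x y =>
  if y = 0 then 0 else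
    (α * (p : L) / β) ^ y.valuation * iotaL p L y ^ (k - 2 - j) * iotaL p L x ^ j

/-- The transpose of `mon`, cut off to `‖x‖ < ‖y‖`. -/
def cutMon (k : ℕ) (α β : L) (j : ℕ) : ℚ_[p] → ℚ_[p] → L := fun x y =>
  if ‖x‖ < ‖y‖ then mon k α β j y x else 0

/-- The monomial of degree `l` in `x` supported on `‖x‖ = ‖y‖`. -/
def sig (k : ℕ) (α β : L) (l : ℕ) : ℚ_[p] → ℚ_[p] → L := fun x y =>
  if ‖x‖ = ‖y‖ then mon k α β l x y else 0

variable (p) in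
/-- The coefficient relating `sig` and `eh`. -/
def sigCoeff (k : ℕ) (β : L) (l : ℕ) : L := β * ((p : L) ^ (k - 1 - l))⁻¹

lemma eh_eq_mon (i : ℕ) (x y : ℚ_[p]) :
    eh k α β i x y = if ‖x‖ ≤ ‖y‖ then mon k α β i x y else 0 := by
  unfold eh mon
  by_cases h1 : ‖x‖ ≤ ‖y‖ <;> by_cases h2 : y = 0 <;> simp [h1, h2]

lemma mon_p_pow_mul {l : ℕ} (h : HypS p L k α β) (t : ℕ) (x y : ℚ_[p]) :
    mon k α β l x ((p : ℚ_[p]) ^ t * y) =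
      (α * (p : L) / β) ^ t * ((p : L) ^ (k - 2 - l)) ^ t * mon k α β l x y := by
  have hp0 : (p : ℚ_[p]) ≠ 0 := prime_cast_ne_zero
  unfold mon
  by_cases hy : y = 0
  · simp [hy]
  · rw [if_neg hy, if_neg (mul_ne_zero (pow_ne_zero _ hp0) hy),
      Padic.valuation_mul (pow_ne_zero _ hp0) hy, valuation_p_pow', zpow_add₀ h.chi_ne_zero,
      zpow_natCast, iotaL_mul, iotaL_pow, iotaL_p, mul_pow, ← pow_mul, ← pow_mul, mul_comm t]
    ring

lemma norm_lt_iff_le_p_mul (x y : ℚ_[p]) : ‖x‖ ≤ ‖(p : ℚ_[p]) * y‖ ↔ ‖x‖ < ‖y‖ ∨ y = 0 ∧ x = 0 := by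
  by_cases hy : y = 0
  · simp [hy]
  · have := norm_p_mul_lt (p := p)
    simp only [hy, false_and, or_false]
    have hy' := norm_pos_iff.2 hy
    rw [norm_mul, Padic.norm_p]
    have h1 := Padic.norm_le_pow_iff_norm_lt_pow_add_one (x / y) (-1)
    rw [neg_add_cancel, zpow_zero, zpow_neg_one, norm_div, div_le_iff₀ hy', div_lt_one hy'] at h1
    exact h1

lemma act_D1_eh {l : ℕ} (h : HypS p L k α β) (x y : ℚ_[p]) :
    act α (Dm 1) (eh k α β l) x y = if ‖x‖ < ‖y‖ then
      α⁻¹ * (α * (p : L) / β) * (p : L) ^ (k - 2 - l) * mon k α β l x y else 0 := by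
  have := mon_p_pow_mul (l := l) h 1 x y
  rw [act_Dm, eh_eq_mon]
  simp only [pow_one, Nat.cast_one, zpow_neg_one] at this ⊢
  rw [this]
  have := norm_lt_iff_le_p_mul x y
  by_cases h1 : ‖x‖ < ‖y‖
  · rw [if_pos h1, if_pos (this.2 (Or.inl h1))]; ring
  · rw [if_neg h1]
    by_cases hy : y = 0
    · simp [mon, hy]
    · rw [if_neg (by rw [this]; simp [h1, hy]), mul_zero]

lemma HypS.sigCoeff_mul {l : ℕ} (h : HypS p L k α β) (hl : l ≤ k - 2) :
    sigCoeff p k β l * (α⁻¹ * (α * (p : L) / β) * (p : L) ^ (k - 2 - l)) = 1 := by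
  have h1 := h.left_ne_zero
  have h2 := h.right_ne_zero
  have h3 : (p : L) ≠ 0 := prime_cast_ne_zero' p
  have h4 := h.two_le
  rw [sigCoeff, show k - 1 - l = k - 2 - l + 1 by omega, pow_succ]
  field_simp

lemma HypS.sig_eq {l : ℕ} (h : HypS p L k α β) (hl : l ≤ k - 2) :
    (sig k α β l : ℚ_[p] → ℚ_[p] → L) =
      eh k α β l - sigCoeff p k β l • act α (Dm 1) (eh k α β l) := by
  ext x y
  simp only [Pi.sub_apply, Pi.smul_apply, smul_eq_mul]
  rw [act_D1_eh h, eh_eq_mon, sig]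
  have h1 := h.sigCoeff_mul hl
  rcases lt_trichotomy ‖x‖ ‖y‖ with hx | hx | hx
  · rw [if_neg hx.ne, if_pos hx.le, if_pos hx, ← mul_assoc, h1, one_mul, sub_self]
  · rw [if_pos hx, if_pos hx.le, if_neg hx.not_lt, mul_zero, sub_zero]
  · rw [if_neg hx.ne', if_neg hx.not_ge, if_neg hx.not_gt, mul_zero, sub_zero]

lemma HypS.norm_sigCoeff {l : ℕ} (h : HypS p L k α β) (hl : l ≤ k - 2) :
    ‖sigCoeff p k β l‖ = (p : ℝ) ^ (valL p L α - l) := by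
  have hp0 : (0 : ℝ) < p := by exact_mod_cast hp.out.pos
  have h4 := h.two_le
  have h5 := h.sum
  rw [sigCoeff, norm_mul, norm_inv, norm_pow, norm_p_L (p := p), norm_eq_rpow_valL (p := p) h.right_ne_zero,
    inv_pow, inv_inv, ← Real.rpow_natCast, ← Real.rpow_add hp0, Nat.cast_sub (by omega),
    Nat.cast_sub (by omega)]
  congr 1
  push_cast
  linarith

lemma act_sw_sig {l : ℕ} (hl : l ≤ k - 2) :
    act α sw (sig k α β l : ℚ_[p] → ℚ_[p] → L) = sig k α β (k - 2 - l) := by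
  ext x y
  rw [act_sw, sig, sig]
  by_cases hxy : ‖x‖ = ‖y‖
  · rw [if_pos hxy, if_pos hxy.symm]
    unfold mon
    by_cases hy : y = 0
    · have hx : x = 0 := by rw [← norm_eq_zero, hxy, hy, norm_zero]
      simp [hx, hy]
    · have hx : x ≠ 0 := by rw [← norm_ne_zero_iff, hxy]; exact norm_ne_zero_iff.2 hy
      rw [if_neg hx, if_neg hy, valuation_eq_of_norm_eq hy hxy.symm, Nat.sub_sub_self hl]
      ring
  · rw [if_neg hxy, if_neg (Ne.symm hxy)]

lemma mon_eq_eh_add (j : ℕ) :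
    (mon k α β j : ℚ_[p] → ℚ_[p] → L) = eh k α β j + act α sw (cutMon k α β j) := by
  ext x y
  rw [Pi.add_apply, Pi.add_apply, act_sw, eh_eq_mon, cutMon]
  by_cases h : ‖x‖ ≤ ‖y‖
  · rw [if_pos h, if_neg h.not_gt, add_zero]
  · rw [if_neg h, if_pos (not_le.1 h), zero_add]

lemma HypS.hasSum_cutMon {j : ℕ} (h : HypS p L k α β) (hj : j ≤ k - 2) (x y : ℚ_[p]) :
    HasSum (fun t : ℕ => (α * ((p : L) ^ j)⁻¹) ^ (t + 1) *
      act α (Dm (t + 1)) (sig k α β (k - 2 - j)) x y) (cutMon k α β j x y) := by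
  have hα := h.left_ne_zero
  have hp0 : (0 : ℝ) < p := by exact_mod_cast hp.out.pos
  have h3 : (p : L) ≠ 0 := prime_cast_ne_zero' p
  have hterm : ∀ t : ℕ, (α * ((p : L) ^ j)⁻¹) ^ (t + 1) *
      act α (Dm (t + 1)) (sig k α β (k - 2 - j)) x y =
      if ‖x‖ = ‖(p : ℚ_[p]) ^ (t + 1) * y‖ then mon k α β j y x else 0 := by
    intro t
    have hpp : (p : ℚ_[p]) ^ (t + 1) ≠ 0 := pow_ne_zero _ prime_cast_ne_zero
    rw [act_Dm, ← act_sw_sig hj, act_sw, sig, ite_congr (eq_iff_iff.2 eq_comm)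
      (fun _ => rfl) (fun _ => rfl)]
    split_ifs
    · unfold mon
      by_cases hx : x = 0
      · simp [hx]
      · rw [if_neg hx, if_neg hx, iotaL_mul, iotaL_pow, iotaL_p, zpow_neg, zpow_natCast,
          mul_pow (_ ^ _) (iotaL p L y), ← pow_mul, mul_comm (t + 1), pow_mul (p : L) j, mul_pow α, inv_pow]
        field_simp
    · ring
  simp only [hterm]
  by_cases hxy : ‖x‖ < ‖y‖
  · by_cases hx : x = 0
    · have : mon k α β j y x = 0 := by simp [mon, hx]
      simp [cutMon, this, hasSum_zero]
    have hy : y ≠ 0 := by rintro rfl; rw [norm_zero] at hxy; exact absurd hxy (norm_nonneg _).not_gt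
    have hval : y.valuation < x.valuation := by
      rw [Padic.norm_eq_zpow_neg_valuation hx, Padic.norm_eq_zpow_neg_valuation hy,
        zpow_lt_zpow_iff_right₀ (by exact_mod_cast hp.out.one_lt)] at hxy
      linarith
    obtain ⟨t, ht⟩ : ∃ t : ℕ, x.valuation = y.valuation + (t + 1 : ℕ) :=
      ⟨(x.valuation - y.valuation - 1).toNat, by push_cast; omega⟩
    have key : ∀ t' : ℕ, ‖x‖ = ‖(p : ℚ_[p]) ^ (t' + 1) * y‖ ↔ t' = t := by
      intro t'
      rw [norm_mul, norm_p_pow, Padic.norm_eq_zpow_neg_valuation hx,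
        Padic.norm_eq_zpow_neg_valuation hy, ← zpow_natCast, ← zpow_neg, ← zpow_add₀ hp0.ne',
        zpow_right_inj₀ hp0 (by exact_mod_cast hp.out.one_lt.ne'), ht]
      push_cast
      omega
    simp only [key, cutMon, if_pos hxy]
    exact hasSum_ite_eq t _
  · rw [cutMon, if_neg hxy]
    convert hasSum_zero (α := L) (β := ℕ) using 2 with t
    split_ifs with h1
    · by_cases hx : x = 0
      · simp [mon, hx]
      · exfalso
        have := (norm_lt_iff_le_p_mul x y).1 (by
          rw [h1, pow_succ', mul_assoc, norm_mul, norm_mul (p : ℚ_[p])]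
          refine mul_le_mul_of_nonneg_left ?_ (norm_nonneg _)
          rw [norm_mul, norm_pow]
          exact mul_le_of_le_one_left (norm_nonneg _)
            (pow_le_one₀ (norm_nonneg _) (by rw [Padic.norm_p]; exact inv_le_one_of_one_le₀ (by exact_mod_cast hp.out.one_le))))
        tauto
    · rfl

variable [IsUltrametricDist L] [CompleteSpace L] [Fact (0 < valL p L α)]

lemma HypS.exists_lift_sig (h : HypS p L k α β) : ∃ C : ℝ, 0 < C ∧ ∀ l ≤ k - 2, ∀ s : ℕ,
    ∃ u : BX p L α, lift k α β u = act α (Dm s) (sig k α β l) ∧ ‖u‖ ≤ C := by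
  have hp1 : (1 : ℝ) ≤ p := by exact_mod_cast hp.out.one_le
  obtain ⟨C, hC, hb⟩ := h.exists_lift_of_atom
  have h0 : 0 < (p : ℝ) ^ valL p L α := by positivity
  refine ⟨C + (p : ℝ) ^ valL p L α * C, by positivity, fun l hl s => ?_⟩
  have hat : ∀ n, act α (Dm n) (eh k α β l) ∈ atoms p k α β := fun n =>
    ⟨1, n, l, isK_one, hl, by rw [act_one]⟩
  obtain ⟨u, hu, hun, -⟩ := hb _ (hat s)
  obtain ⟨v, hv, hvn, -⟩ := hb _ (hat (s + 1))
  refine ⟨u - sigCoeff p k β l • v, ?_, (norm_sub_le _ _).trans (add_le_add hun ?_)⟩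
  · rw [map_sub, map_smul, hu, hv, h.sig_eq hl, map_sub, map_smul,
      ← act_mul h.left_ne_zero (det2_Dm_ne_zero _) (det2_Dm_ne_zero _), Dm_mul]
  · rw [norm_smul, h.norm_sigCoeff hl]
    refine mul_le_mul ?_ hvn (norm_nonneg _) h0.le
    exact Real.rpow_le_rpow_of_exponent_le hp1 (by linarith [(Nat.cast_nonneg l : (0 : ℝ) ≤ l)])

lemma HypS.le_of_lt_val (h : HypS p L k α β) {j : ℕ} (hj : (j : ℝ) < valL p L α) : j ≤ k - 2 := by
  have h1 : (j : ℝ) < k - 1 := by linarith [h.sum, h.pos_right]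
  have h2 : (j : ℝ) + 1 < k := by linarith
  have : j + 1 < k := by exact_mod_cast h2
  omega

lemma HypS.exists_lift_cutMon (h : HypS p L k α β) : ∃ C : ℝ, 0 < C ∧
    ∀ j : ℕ, (j : ℝ) < valL p L α → ∀ s : ℕ,
    ∃ u : BX p L α, lift k α β u = act α (Dm s) (cutMon k α β j) ∧ ‖u‖ ≤ C := by
  have hp1 : (1 : ℝ) < p := by exact_mod_cast hp.out.one_lt
  have hp0 : (0 : ℝ) < p := by linarith
  obtain ⟨C, hC, hb⟩ := h.exists_lift_sig
  have hone : ∀ j : ℕ, (j : ℝ) < valL p L α → ∃ M : ℝ, 0 < M ∧ ∀ s : ℕ,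
      ∃ u : BX p L α, lift k α β u = act α (Dm s) (cutMon k α β j) ∧ ‖u‖ ≤ M := by
    intro j hj
    have hjk := h.le_of_lt_val hj
    set q := ‖α * ((p : L) ^ j)⁻¹‖ with hq
    have hq1 : q < 1 := by
      rw [hq, norm_mul, norm_inv, norm_pow, norm_p_L (p := p), norm_eq_rpow_valL (p := p) h.left_ne_zero,
        inv_pow, inv_inv, ← Real.rpow_natCast, ← Real.rpow_add hp0]
      exact Real.rpow_lt_one_of_one_lt_of_neg hp1 (by linarith)
    have hq0 : 0 ≤ q := norm_nonneg _
    refine ⟨q * C * (1 - q)⁻¹ + 1, by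
      have := inv_pos.2 (sub_pos.2 hq1); positivity, fun s => ?_⟩
    choose v hv hvn using hb (k - 2 - j) (Nat.sub_le _ _)
    have hg := (hasSum_geometric_of_lt_one hq0 hq1).mul_left (q * C)
    have hbd : ∀ t : ℕ, ‖(α * ((p : L) ^ j)⁻¹) ^ (t + 1) • v (s + (t + 1))‖ ≤ q * C * q ^ t := by
      intro t
      rw [norm_smul, norm_pow, ← hq]
      calc q ^ (t + 1) * ‖v (s + (t + 1))‖ ≤ q ^ (t + 1) * C := by gcongr; exact hvn _
        _ = q * C * q ^ t := by ring
    have hsum : Summable fun t : ℕ => (α * ((p : L) ^ j)⁻¹) ^ (t + 1) • v (s + (t + 1)) :=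
      Summable.of_norm_bounded hg.summable hbd
    refine ⟨∑' t : ℕ, (α * ((p : L) ^ j)⁻¹) ^ (t + 1) • v (s + (t + 1)), ?_,
      (tsum_of_norm_bounded hg hbd).trans (by linarith)⟩
    ext x y
    have h1 := (hsum.hasSum.mapL (liftEval k α β x y))
    rw [← liftEval_apply]
    refine h1.unique ?_
    rw [act_Dm]
    refine ((h.hasSum_cutMon hjk x ((p : ℚ_[p]) ^ s * y)).mul_left (α ^ (-(s : ℤ)))).congr_fun
      fun t => ?_
    rw [map_smul, liftEval_apply, hv, ← Dm_mul,
      act_mul h.left_ne_zero (det2_Dm_ne_zero _) (det2_Dm_ne_zero _), act_Dm]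
    simp only [smul_eq_mul]
    ring
  choose! M hM0 hM using hone
  refine ⟨C + ∑ j ∈ Finset.range k, |M j|, by positivity, fun j hj s => ?_⟩
  obtain ⟨u, hu, hn⟩ := hM j hj s
  have h2 := h.two_le
  refine ⟨u, hu, hn.trans ((le_abs_self _).trans ?_)⟩
  have := Finset.single_le_sum (f := fun j => |M j|) (fun i _ => abs_nonneg _)
    (Finset.mem_range.2 (show j < k by have := h.le_of_lt_val hj; omega))
  linarith

lemma HypS.exists_lift_mon (h : HypS p L k α β) {j : ℕ} (hj : (j : ℝ) < valL p L α) :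
    ∃ u : BX p L α, lift k α β u = mon k α β j := by
  obtain ⟨C, -, hb⟩ := h.exists_lift_of_atom
  obtain ⟨C', -, hc⟩ := h.exists_lift_cutMon
  obtain ⟨u, hu, -⟩ := hb (eh k α β j) ⟨1, 0, j, isK_one, h.le_of_lt_val hj, by
    rw [act_one]; ext x y; simp [act_Dm]⟩
  obtain ⟨v, hv, -⟩ := hc j hj 0
  refine ⟨u + rho k α β sw v, ?_⟩
  rw [map_add, hu, h.lift_rho isK_sw.det_ne_zero, hv, mon_eq_eh_add]
  congr 2
  ext x y; simp [act_Dm]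

end Mon

section Unitary

set_option linter.unusedSectionVars false

variable {p : ℕ} [hp : Fact p.Prime]
variable {L : Type} [NontriviallyNormedField L] [NormedAlgebra ℚ_[p] L]
variable {k : ℕ} {α β : L}
variable [IsUltrametricDist L] [CompleteSpace L] [Fact (0 < valL p L α)]

variable (p) in
/-- The translates of the special functions. -/
def specSet (k : ℕ) (α β : L) [Fact (0 < valL p L α)] : Set (BX p L α) :=
  {u | ∃ (j : ℕ) (g : Matrix (Fin 2) (Fin 2) ℚ_[p]), (j : ℝ) < valL p L α ∧ det2 p g ≠ 0 ∧
    lift k α β u = act α g (mon k α β j)}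

variable (p) in
/-- The closed subspace of pairs of charts corresponding to `L(α)`. -/
def Lsub (k : ℕ) (α β : L) [Fact (0 < valL p L α)] : Submodule L (BX p L α) :=
  (Submodule.span L (specSet p k α β)).topologicalClosure

instance : IsClosed (Lsub p k α β : Set (BX p L α)) :=
  Submodule.isClosed_topologicalClosure _

variable (p) in
/-- The quotient Banach space. -/
abbrev QX (k : ℕ) (α β : L) [Fact (0 < valL p L α)] : Type := BX p L α ⧸ Lsub p k α β

/-- The quotient map. -/
def qmk (k : ℕ) (α β : L) [Fact (0 < valL p L α)] : BX p L α →L[L] QX p k α β :=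
  (Lsub p k α β).mkQ.mkContinuous 1 fun u => by
    rw [one_mul]; exact Submodule.Quotient.norm_mk_le (Lsub p k α β) u

lemma norm_qmk_le (u : BX p L α) : ‖qmk k α β u‖ ≤ ‖u‖ :=
  Submodule.Quotient.norm_mk_le (Lsub p k α β) u

lemma qmk_eq_zero {u : BX p L α} : qmk k α β u = 0 ↔ u ∈ Lsub p k α β :=
  Submodule.Quotient.mk_eq_zero _

lemma qmk_surjective : Function.Surjective (qmk k α β : BX p L α → QX p k α β) :=
  Submodule.mkQ_surjective _

lemma exists_qmk_lt (x : QX p k α β) {ε : ℝ} (hε : 0 < ε) :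
    ∃ u : BX p L α, qmk k α β u = x ∧ ‖u‖ < ‖x‖ + ε := Submodule.Quotient.norm_mk_lt x hε

instance : IsUltrametricDist (QX p k α β) :=
  IsUltrametricDist.isUltrametricDist_of_forall_norm_add_le_max_norm fun x y => by
    refine le_of_forall_pos_le_add fun ε hε => ?_
    obtain ⟨u, rfl, hu⟩ := exists_qmk_lt x hε
    obtain ⟨v, rfl, hv⟩ := exists_qmk_lt y hε
    rw [← map_add, ← max_add_add_right]
    exact (norm_qmk_le _).trans ((IsUltrametricDist.norm_add_le_max _ _).trans
      (max_le_max hu.le hv.le))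

lemma HypS.rho_mem_Lsub (h : HypS p L k α β) {g : Matrix (Fin 2) (Fin 2) ℚ_[p]}
    (hg : det2 p g ≠ 0) {u : BX p L α} (hu : u ∈ Lsub p k α β) :
    rho k α β g u ∈ Lsub p k α β := by
  have hle : Lsub p k α β ≤ (Lsub p k α β).comap (rho k α β g).toLinearMap := by
    refine Submodule.topologicalClosure_minimal _ (Submodule.span_le.2 ?_) ?_
    · rintro v ⟨j, g', hj, hg', hv⟩
      refine Submodule.le_topologicalClosure _ (Submodule.subset_span ⟨j, g * g', hj, ?_, ?_⟩)
      · rw [det2_mul]; exact mul_ne_zero hg hg'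
      · rw [act_mul h.left_ne_zero hg hg', ← hv]
        exact h.lift_rho hg v
    · exact (Submodule.isClosed_topologicalClosure _).preimage (rho k α β g).continuous
  exact hle hu

lemma HypS.qmk_rho_eq (h : HypS p L k α β) {g : Matrix (Fin 2) (Fin 2) ℚ_[p]}
    (hg : det2 p g ≠ 0) {u v : BX p L α} (huv : qmk k α β u = qmk k α β v) :
    qmk k α β (rho k α β g u) = qmk k α β (rho k α β g v) := by
  rw [← sub_eq_zero, ← map_sub, qmk_eq_zero] at huv
  rw [← sub_eq_zero, ← map_sub, ← map_sub, qmk_eq_zero]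
  exact h.rho_mem_Lsub hg huv

lemma HypS.norm_qmk_rho_le (h : HypS p L k α β) {g : Matrix (Fin 2) (Fin 2) ℚ_[p]}
    (hg : det2 p g ≠ 0) {C : ℝ} (hC : 0 ≤ C) (hb : ∀ u, ‖qmk k α β (rho k α β g u)‖ ≤ C * ‖u‖)
    (u : BX p L α) : ‖qmk k α β (rho k α β g u)‖ ≤ C * ‖qmk k α β u‖ := by
  refine le_of_forall_pos_le_add fun ε hε => ?_
  obtain ⟨v, hv, hn⟩ := exists_qmk_lt (qmk k α β u) (show 0 < ε / (C + 1) by positivity)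
  rw [← h.qmk_rho_eq hg hv]
  refine (hb v).trans ?_
  have : C * (ε / (C + 1)) ≤ ε := by
    rw [mul_div_assoc', div_le_iff₀ (by positivity)]; nlinarith
  nlinarith [mul_le_mul_of_nonneg_left hn.le hC]

variable (p) in
/-- The function `H` is the lift of a pair of charts whose class has norm at most `C`. -/
def QB (k : ℕ) (α β : L) [Fact (0 < valL p L α)] (H : ℚ_[p] → ℚ_[p] → L) (C : ℝ) : Prop :=
  ∃ u : BX p L α, lift k α β u = H ∧ ‖qmk k α β u‖ ≤ C

lemma QB.mono {H : ℚ_[p] → ℚ_[p] → L} {C D : ℝ} (hH : QB p k α β H C) (hCD : C ≤ D) :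
    QB p k α β H D := by
  obtain ⟨u, hu, hn⟩ := hH
  exact ⟨u, hu, hn.trans hCD⟩

lemma QB.smul {H : ℚ_[p] → ℚ_[p] → L} {C : ℝ} (hH : QB p k α β H C) {c : L} (hc : ‖c‖ ≤ 1) :
    QB p k α β (c • H) C := by
  obtain ⟨u, hu, hn⟩ := hH
  refine ⟨c • u, by rw [map_smul, hu], ?_⟩
  rw [map_smul, norm_smul]
  exact (mul_le_of_le_one_left (norm_nonneg _) hc).trans hn

lemma QB.add {H G : ℚ_[p] → ℚ_[p] → L} {C : ℝ} (hH : QB p k α β H C) (hG : QB p k α β G C) :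
    QB p k α β (H + G) C := by
  obtain ⟨u, hu, hn⟩ := hH
  obtain ⟨v, hv, hm⟩ := hG
  refine ⟨u + v, by rw [map_add, hu, hv], ?_⟩
  rw [map_add]
  exact (IsUltrametricDist.norm_add_le_max _ _).trans (max_le hn hm)

lemma QB.sub {H G : ℚ_[p] → ℚ_[p] → L} {C : ℝ} (hH : QB p k α β H C) (hG : QB p k α β G C) :
    QB p k α β (H - G) C := by
  have := hH.add (hG.smul (c := -1) (by simp))
  rwa [neg_one_smul, ← sub_eq_add_neg] at this

lemma QB.sum {ι : Type} {s : Finset ι} {F : ι → ℚ_[p] → ℚ_[p] → L} {C : ℝ} (hC : 0 ≤ C)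
    (hF : ∀ i ∈ s, QB p k α β (F i) C) : QB p k α β (∑ i ∈ s, F i) C := by
  induction s using Finset.induction_on with
  | empty => exact ⟨0, by simp, by simpa using hC⟩
  | insert a s ha ih =>
    rw [Finset.sum_insert ha]
    exact (hF a (Finset.mem_insert_self _ _)).add
      (ih fun i hi => hF i (Finset.mem_insert_of_mem hi))

lemma HypS.exists_QB_act (h : HypS p L k α β) : ∃ C : ℝ, 0 < C ∧
    ∀ g : Matrix (Fin 2) (Fin 2) ℚ_[p], IsK g → ∀ H M, QB p k α β H M →
      QB p k α β (act α g H) (C * M) := by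
  obtain ⟨C, hC, hb⟩ := h.norm_rho_le
  refine ⟨C, hC, fun g hg H M ⟨u, hu, hn⟩ => ⟨rho k α β g u, ?_, ?_⟩⟩
  · rw [h.lift_rho hg.det_ne_zero, hu]
  · exact (h.norm_qmk_rho_le hg.det_ne_zero hC.le
      (fun v => (norm_qmk_le _).trans (hb g hg v)) u).trans (by gcongr)

lemma HypS.QB_act_mon (h : HypS p L k α β) {j : ℕ} (hj : (j : ℝ) < valL p L α)
    {g : Matrix (Fin 2) (Fin 2) ℚ_[p]} (hg : det2 p g ≠ 0) :
    QB p k α β (act α g (mon k α β j)) 0 := by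
  obtain ⟨u, hu⟩ := h.exists_lift_mon hj
  have e : lift k α β (rho k α β g u) = act α g (mon k α β j) := by rw [h.lift_rho hg, hu]
  refine ⟨rho k α β g u, e, ?_⟩
  rw [qmk_eq_zero.2 (Submodule.le_topologicalClosure _ (Submodule.subset_span ⟨j, g, hj, hg, e⟩)),
    norm_zero]

lemma det2_scalar_ne_zero {c : ℚ_[p]} (hc : c ≠ 0) : det2 p !![c, 0; 0, c] ≠ 0 := by
  simp [det2, hc]

lemma Dm_mul_sw_mul_Dm (s : ℕ) : (Dm (s + 1) * (sw * Dm 1) : Matrix (Fin 2) (Fin 2) ℚ_[p]) =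
    !![(p : ℚ_[p]), 0; 0, p] * (Dm s * sw) := by
  ext i j; fin_cases i <;> fin_cases j <;> simp [Dm, sw, pow_succ']

lemma det2_mul_ne_zero {g g' : Matrix (Fin 2) (Fin 2) ℚ_[p]} (hg : det2 p g ≠ 0)
    (hg' : det2 p g' ≠ 0) : det2 p (g * g') ≠ 0 := by
  rw [det2_mul]; exact mul_ne_zero hg hg'

lemma det2_sw_ne_zero : det2 p (sw : Matrix (Fin 2) (Fin 2) ℚ_[p]) ≠ 0 := isK_sw.det_ne_zero

/-- Scalar matrices act on homogeneous functions through units. -/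
lemma HypS.QB_act_scalar (h : HypS p L k α β) {H : ℚ_[p] → ℚ_[p] → L} (hH : Homog k α β H)
    {M : ℝ} (hM : QB p k α β H M) {c : ℚ_[p]} (hc : c ≠ 0) :
    QB p k α β (act α !![c, 0; 0, c] H) M := by
  rw [hH.act_scalar hc]
  exact hM.smul (h.norm_scalar hc).le

lemma HypS.exists_QB_Dm (h : HypS p L k α β) : ∃ C : ℝ, 0 < C ∧ ∀ i ≤ k - 2, ∀ s : ℕ,
    QB p k α β (act α (Dm s) (eh k α β i)) C ∧
      QB p k α β (act α (Dm s) (act α sw (eh k α β i))) C := by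
  obtain ⟨C, hC, hb⟩ := h.exists_lift_of_atom
  obtain ⟨C₁, hC₁, hb₁⟩ := h.exists_lift_sig
  obtain ⟨C₂, hC₂, hb₂⟩ := h.exists_lift_cutMon
  have hα := h.left_ne_zero
  have hp1 : (1 : ℝ) ≤ p := by exact_mod_cast hp.out.one_le
  set M := C + C₁ + C₂ with hM
  have hM0 : 0 < M := by positivity
  refine ⟨M, hM0, fun i hi s => ⟨?_, ?_⟩⟩
  · obtain ⟨u, hu, hn, -⟩ := hb (act α (Dm s) (eh k α β i)) ⟨1, s, i, isK_one, hi, by rw [act_one]⟩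
    exact ⟨u, hu, (norm_qmk_le _).trans (by linarith)⟩
  by_cases hir : (i : ℝ) < valL p L α
  · obtain ⟨u, hu, hn⟩ := hb₂ i hir s
    have h1 : QB p k α β (act α (Dm s) (cutMon k α β i)) M :=
      ⟨u, hu, (norm_qmk_le _).trans (by linarith)⟩
    have h2 := (h.QB_act_mon hir (det2_mul_ne_zero (det2_Dm_ne_zero s) det2_sw_ne_zero)).mono hM0.le
    have h3 : act α (Dm s : Matrix (Fin 2) (Fin 2) ℚ_[p]) (act α sw (eh k α β i)) =
        act α (Dm s * sw) (mon k α β i) - act α (Dm s) (cutMon k α β i) := by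
      rw [act_mul hα (det2_Dm_ne_zero s) det2_sw_ne_zero, mon_eq_eh_add, map_add, map_add,
        eq_sub_iff_add_eq]
      congr 2
      ext x y; rw [act_sw, act_sw]
    rw [h3]
    exact h2.sub h1
  · induction s with
    | zero =>
      obtain ⟨u, hu, hn, -⟩ := hb (act α sw (act α (Dm 0) (eh k α β i))) ⟨sw, 0, i, isK_sw, hi, rfl⟩
      refine ⟨u, ?_, (norm_qmk_le _).trans (by linarith)⟩
      rw [hu]
      ext x y; simp [act_Dm, act_sw]
    | succ s ih =>
      obtain ⟨u, hu, hn⟩ := hb₁ (k - 2 - i) (Nat.sub_le _ _) (s + 1)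
      have h1 : QB p k α β (act α (Dm (s + 1)) (sig k α β (k - 2 - i))) M :=
        ⟨u, hu, (norm_qmk_le _).trans (by linarith)⟩
      have h2 := h.QB_act_scalar (((h.eh_homog hi).act sw).act (Dm s)) ih
        (prime_cast_ne_zero (p := p))
      have h3 : ‖sigCoeff p k β i‖ ≤ 1 := by
        rw [h.norm_sigCoeff hi]
        exact Real.rpow_le_one_of_one_le_of_nonpos hp1 (by linarith)
      have h4 : act α (Dm (s + 1) : Matrix (Fin 2) (Fin 2) ℚ_[p]) (act α sw (eh k α β i)) =
          act α (Dm (s + 1)) (sig k α β (k - 2 - i)) + sigCoeff p k β i •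
            act α !![(p : ℚ_[p]), 0; 0, p] (act α (Dm s) (act α sw (eh k α β i))) := by
        rw [← act_sw_sig hi, h.sig_eq hi, map_sub, map_sub, map_smul, map_smul,
          ← act_mul hα (det2_Dm_ne_zero s) det2_sw_ne_zero, ← act_mul hα
            (det2_scalar_ne_zero prime_cast_ne_zero)
            (det2_mul_ne_zero (det2_Dm_ne_zero s) det2_sw_ne_zero), ← Dm_mul_sw_mul_Dm,
          act_mul hα (det2_Dm_ne_zero _) (det2_mul_ne_zero det2_sw_ne_zero (det2_Dm_ne_zero _)),
          act_mul hα det2_sw_ne_zero (det2_Dm_ne_zero _), sub_add_cancel]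
      rw [h4]
      exact h1.add (h2.smul h3)

end Unitary

section Iwahori

set_option linter.unusedSectionVars false

open Polynomial

variable {p : ℕ} [hp : Fact p.Prime]
variable {L : Type} [NontriviallyNormedField L] [NormedAlgebra ℚ_[p] L]
variable {k : ℕ} {α β : L}

/-- Membership in the Iwahori subgroup of matrices that are upper triangular modulo `p`. -/
def IsIw (g : Matrix (Fin 2) (Fin 2) ℚ_[p]) : Prop :=
  ‖g 0 0‖ = 1 ∧ ‖g 1 1‖ = 1 ∧ ‖g 0 1‖ ≤ 1 ∧ ‖g 1 0‖ < 1

lemma IsIw.norm_det {g : Matrix (Fin 2) (Fin 2) ℚ_[p]} (hg : IsIw g) : ‖det2 p g‖ = 1 := by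
  obtain ⟨h1, h2, h3, h4⟩ := hg
  have h5 : ‖g 0 1 * g 1 0‖ < 1 := by
    rw [norm_mul]; exact mul_lt_one_of_nonneg_of_lt_one_right h3 (norm_nonneg _) h4
  have h6 : ‖g 0 0 * g 1 1‖ = 1 := by rw [norm_mul, h1, h2, one_mul]
  have := norm_add_eq_of_lt (x := g 0 0 * g 1 1) (y := -(g 0 1 * g 1 0)) (by rw [norm_neg, h6]; exact h5)
  rw [det2, sub_eq_add_neg, this, h6]

lemma IsIw.det_ne_zero {g : Matrix (Fin 2) (Fin 2) ℚ_[p]} (hg : IsIw g) : det2 p g ≠ 0 :=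
  norm_pos_iff.1 (by rw [hg.norm_det]; exact one_pos)

/-- Iwahori matrices stabilise the integral span of the functions `eh`. -/
lemma IsIw.act_eh {g : Matrix (Fin 2) (Fin 2) ℚ_[p]} (hg : IsIw g) {i : ℕ} (hi : i ≤ k - 2) :
    ∃ c : ℕ → L, (∀ m, ‖c m‖ ≤ 1) ∧
      act α g (eh k α β i) = ∑ m ∈ Finset.range (k - 2 + 1), c m • eh k α β m := by
  have hdet := hg.norm_det
  have hv : (det2 p g).valuation = 0 := by
    rw [valuation_eq_of_norm_eq (y := 1) hg.det_ne_zero (by rw [hdet, norm_one]), Padic.valuation_one]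
  obtain ⟨h1, h2, h3, h4⟩ := hg
  let P : ℤ_[p][X] := (C (toZ (g 0 0)) - C (toZ (g 1 0)) * X) ^ (k - 2 - i) *
    (C (toZ (g 1 1)) * X - C (toZ (g 0 1))) ^ i
  have hdeg : P.natDegree < k - 2 + 1 := by
    have : P.natDegree ≤ (k - 2 - i) * 1 + i * 1 := by
      refine natDegree_mul_le_of_le (natDegree_pow_le_of_le _ ?_) (natDegree_pow_le_of_le _ ?_) <;>
        compute_degree
    omega
  refine ⟨fun m => iotaL p L ((P.coeff m : ℤ_[p]) : ℚ_[p]), fun m => ?_, ?_⟩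
  · rw [norm_iotaL]; exact PadicInt.norm_le_one _
  ext x y
  rw [act_apply, hv, neg_zero, zpow_zero, one_mul, Finset.sum_apply, Finset.sum_apply]
  simp only [Pi.smul_apply, smul_eq_mul]
  by_cases hxy : ‖x‖ ≤ ‖y‖
  · by_cases hy : y = 0
    · have hx : x = 0 := by rw [hy, norm_zero] at hxy; exact norm_le_zero_iff.1 hxy
      simp [eh, hx, hy]
    have hy' := norm_pos_iff.2 hy
    have e1 : ‖-(g 1 0) * x + g 0 0 * y‖ = ‖y‖ := by
      have : ‖-(g 1 0) * x‖ < ‖g 0 0 * y‖ := by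
        rw [norm_mul, norm_mul, h1, one_mul, norm_neg]
        exact (mul_le_mul_of_nonneg_left hxy (norm_nonneg _)).trans_lt
          (mul_lt_of_lt_one_left hy' h4)
      rw [add_comm, norm_add_eq_of_lt this, norm_mul, h1, one_mul]
    have e2 : ‖g 1 1 * x - g 0 1 * y‖ ≤ ‖y‖ := by
      rw [sub_eq_add_neg]
      refine (Padic.nonarchimedean _ _).trans (max_le ?_ ?_)
      · rw [norm_mul, h2, one_mul]; exact hxy
      · rw [norm_neg, norm_mul]; exact mul_le_of_le_one_left (norm_nonneg _) h3
    have hne : -(g 1 0) * x + g 0 0 * y ≠ 0 := norm_pos_iff.1 (by rw [e1]; exact hy')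
    have hL : ∀ m ∈ Finset.range (k - 2 + 1), iotaL p L ((P.coeff m : ℤ_[p]) : ℚ_[p]) * eh k α β m x y =
        psi k α β y * iotaL p L (((P.coeff m : ℤ_[p]) : ℚ_[p]) * (x / y) ^ m) := by
      intro m hm
      rw [eh, if_pos ⟨hxy, hy⟩, eh_term_eq (by have := Finset.mem_range.1 hm; omega) _ hy,
        iotaL_mul, iotaL_pow]
      ring
    rw [Finset.sum_congr rfl hL, ← Finset.mul_sum, eh, if_pos ⟨by rw [e1]; exact e2, hne⟩,
      valuation_eq_of_norm_eq hne e1]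
    have hz : ‖x / y‖ ≤ 1 := by rw [norm_div]; exact div_le_one_of_le₀ hxy (norm_nonneg _)
    have hev : (∑ m ∈ Finset.range (k - 2 + 1), iotaL p L (((P.coeff m : ℤ_[p]) : ℚ_[p]) * (x / y) ^ m)) =
        iotaL p L ((P.eval (toZ (x / y)) : ℤ_[p]) : ℚ_[p]) := by
      rw [eval_eq_sum_range' hdeg]
      unfold iotaL
      rw [PadicInt.coe_sum, map_sum]
      refine Finset.sum_congr rfl fun m _ => ?_
      rw [PadicInt.coe_mul, PadicInt.coe_pow, coe_toZ hz]
    rw [hev]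
    simp only [P, eval_mul, eval_pow, eval_sub, eval_C, eval_X, PadicInt.coe_mul, PadicInt.coe_pow,
      PadicInt.coe_sub, coe_toZ h1.le, coe_toZ h2.le, coe_toZ h3, coe_toZ h4.le, coe_toZ hz]
    rw [psi, show k - 2 = k - 2 - i + i by omega, pow_add]
    simp only [Nat.add_sub_cancel]
    rw [show (α * (p : L) / β) ^ y.valuation * (iotaL p L y ^ (k - 2 - i) * iotaL p L y ^ i) *
      iotaL p L ((g 0 0 - g 1 0 * (x / y)) ^ (k - 2 - i) * (g 1 1 * (x / y) - g 0 1) ^ i) =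
      (α * (p : L) / β) ^ y.valuation * iotaL p L
        ((y * (g 0 0 - g 1 0 * (x / y))) ^ (k - 2 - i) * (y * (g 1 1 * (x / y) - g 0 1)) ^ i) by
      rw [iotaL_mul, iotaL_mul, mul_pow, mul_pow, iotaL_mul, iotaL_mul]
      simp only [iotaL_pow]; ring]
    rw [mul_assoc, ← iotaL_pow, ← iotaL_pow, ← iotaL_mul]
    congr 4 <;> field_simp <;> ring
  · have hR : ∀ m ∈ Finset.range (k - 2 + 1), iotaL p L ((P.coeff m : ℤ_[p]) : ℚ_[p]) * eh k α β m x y = 0 :=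
      fun m _ => by rw [eh, if_neg (fun h => hxy h.1), mul_zero]
    rw [Finset.sum_eq_zero hR, eh, if_neg]
    rintro ⟨h5, -⟩
    rw [not_le] at hxy
    have hx := (norm_nonneg y).trans_lt hxy
    by_cases h6 : ‖-(g 1 0) * x + g 0 0 * y‖ < ‖x‖
    · have h7 : x * det2 p g = g 0 0 * (g 1 1 * x - g 0 1 * y) + g 0 1 * (-(g 1 0) * x + g 0 0 * y) := by
        rw [det2]; ring
      have h8 : ‖x * det2 p g‖ < ‖x‖ := by
        rw [h7]
        refine (Padic.nonarchimedean _ _).trans_lt (max_lt ?_ ?_)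
        · rw [norm_mul, h1, one_mul]; exact h5.trans_lt h6
        · rw [norm_mul]; exact (mul_le_of_le_one_left (norm_nonneg _) h3).trans_lt h6
      rw [norm_mul, hdet, mul_one] at h8
      exact lt_irrefl _ h8
    · apply h6
      refine (Padic.nonarchimedean _ _).trans_lt (max_lt ?_ ?_)
      · rw [norm_mul, norm_neg]; exact mul_lt_of_lt_one_left hx h4
      · rw [norm_mul, h1, one_mul]; exact hxy

/-- `exists s` with `x = y * p^s * e`, `e` a unit. -/
lemma exists_eq_mul_pow {x y : ℚ_[p]} (hx : x ≠ 0) (hxy : ‖x‖ ≤ ‖y‖) :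
    ∃ (s : ℕ) (e : ℚ_[p]), ‖e‖ = 1 ∧ x = y * (p : ℚ_[p]) ^ s * e := by
  have hp0 : (0 : ℝ) < p := by exact_mod_cast hp.out.pos
  have hy : y ≠ 0 := norm_pos_iff.1 ((norm_pos_iff.2 hx).trans_le hxy)
  have h1 : y.valuation ≤ x.valuation := by
    rw [Padic.norm_eq_zpow_neg_valuation hx, Padic.norm_eq_zpow_neg_valuation hy,
      zpow_le_zpow_iff_right₀ (by exact_mod_cast hp.out.one_lt)] at hxy
    linarith
  have hpp : (p : ℚ_[p]) ^ (x.valuation - y.valuation).toNat ≠ 0 := pow_ne_zero _ prime_cast_ne_zero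
  refine ⟨(x.valuation - y.valuation).toNat, x / (y * (p : ℚ_[p]) ^ (x.valuation - y.valuation).toNat),
    ?_, ?_⟩
  · rw [norm_div, norm_mul, norm_p_pow, ← zpow_natCast, Int.toNat_of_nonneg (by linarith),
      Padic.norm_eq_zpow_neg_valuation hx, Padic.norm_eq_zpow_neg_valuation hy, ← zpow_neg,
      ← zpow_add₀ hp0.ne', div_eq_one_iff_eq (zpow_ne_zero _ hp0.ne')]
    congr 1; ring
  · field_simp

/-- A decomposition `K ⋅ scalar ⋅ D_s ⋅ W ⋅ Iwahori`. -/
def IsDec (g : Matrix (Fin 2) (Fin 2) ℚ_[p]) : Prop :=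
  ∃ (κ τ : Matrix (Fin 2) (Fin 2) ℚ_[p]) (c : ℚ_[p]) (s : ℕ), IsK κ ∧ IsIw τ ∧ c ≠ 0 ∧
    (g = κ * (!![c, 0; 0, c] * (Dm s * τ)) ∨ g = κ * (!![c, 0; 0, c] * (Dm s * (sw * τ))))

lemma IsDec.mul_left {g κ : Matrix (Fin 2) (Fin 2) ℚ_[p]} (hg : IsDec g) (hκ : IsK κ) :
    IsDec (κ * g) := by
  obtain ⟨κ', τ, c, s, h1, h2, h3, h4⟩ := hg
  refine ⟨κ * κ', τ, c, s, hκ.mul h1, h2, h3, ?_⟩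
  rcases h4 with rfl | rfl
  · left; rw [Matrix.mul_assoc]
  · right; rw [Matrix.mul_assoc]

lemma isDec_diag_mul {x y : ℚ_[p]} (hx : x ≠ 0) (hy : y ≠ 0)
    {τ : Matrix (Fin 2) (Fin 2) ℚ_[p]} (hτ : IsIw τ) : IsDec (!![x, 0; 0, y] * τ) := by
  obtain ⟨h1, h2, h3, h4⟩ := hτ
  rcases le_total ‖x‖ ‖y‖ with hxy | hxy
  · obtain ⟨s, e, he, rfl⟩ := exists_eq_mul_pow hx hxy
    refine ⟨1, !![e, 0; 0, 1] * τ, y, s, isK_one, ?_, hy, Or.inl ?_⟩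
    · simp [IsIw, Matrix.mul_apply, Fin.sum_univ_two, he, h1, h2, h3, h4]
    · rw [Matrix.one_mul, ← Matrix.mul_assoc, ← Matrix.mul_assoc]
      congr 1
      ext i j; fin_cases i <;> fin_cases j <;> simp [Dm, Matrix.mul_apply, Fin.sum_univ_two]
  · obtain ⟨s, e, he, rfl⟩ := exists_eq_mul_pow hy hxy
    refine ⟨sw, !![1, 0; 0, e] * τ, x, s, isK_sw, ?_, hx, Or.inr ?_⟩
    · simp [IsIw, Matrix.mul_apply, Fin.sum_univ_two, he, h1, h2, h3, h4]
    · rw [← Matrix.mul_assoc, ← Matrix.mul_assoc, ← Matrix.mul_assoc, ← Matrix.mul_assoc]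
      congr 1
      ext i j; fin_cases i <;> fin_cases j <;> simp [Dm, sw, Matrix.mul_apply, Fin.sum_univ_two]

lemma sw_mul_sw : (sw * sw : Matrix (Fin 2) (Fin 2) ℚ_[p]) = 1 := by
  ext i j; fin_cases i <;> fin_cases j <;> simp [sw]

lemma isDec_of_left {g : Matrix (Fin 2) (Fin 2) ℚ_[p]} (hg : det2 p g ≠ 0)
    (h1 : ‖g 1 0‖ ≤ ‖g 0 0‖) (h2 : ‖g 0 1‖ ≤ ‖g 0 0‖) : IsDec g := by
  have ha : g 0 0 ≠ 0 := by
    intro ha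
    rw [ha, norm_zero, norm_le_zero_iff] at h1
    apply hg; rw [det2, ha, h1]; ring
  have e : g = !![1, 0; g 1 0 / g 0 0, 1] * (!![g 0 0, 0; 0, det2 p g / g 0 0] *
      !![1, g 0 1 / g 0 0; 0, 1]) := by
    ext i j; fin_cases i <;> fin_cases j <;>
      simp [Matrix.mul_apply, Fin.sum_univ_two, det2] <;> field_simp
    ring
  have hdiv : ∀ {x : ℚ_[p]}, ‖x‖ ≤ ‖g 0 0‖ → ‖x / g 0 0‖ ≤ 1 := fun h => by
    rw [norm_div]; exact div_le_one_of_le₀ h (norm_nonneg _)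
  rw [e]
  refine (isDec_diag_mul ha (div_ne_zero hg ha) ?_).mul_left ⟨fun i j => ?_, by simp [det2]⟩
  · exact ⟨by simp, by simp, by simpa using hdiv h2, by simp⟩
  · fin_cases i <;> fin_cases j <;> simp
    simpa using hdiv h1

lemma isDec_of_right {g : Matrix (Fin 2) (Fin 2) ℚ_[p]} (hg : det2 p g ≠ 0)
    (h1 : ‖g 0 1‖ ≤ ‖g 1 1‖) (h2 : ‖g 1 0‖ < ‖g 1 1‖) : IsDec g := by
  have hd' : 0 < ‖g 1 1‖ := (norm_nonneg _).trans_lt h2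
  have hd : g 1 1 ≠ 0 := norm_pos_iff.1 hd'
  have e : g = !![1, g 0 1 / g 1 1; 0, 1] * (!![det2 p g / g 1 1, 0; 0, g 1 1] *
      !![1, 0; g 1 0 / g 1 1, 1]) := by
    ext i j; fin_cases i <;> fin_cases j <;>
      simp [Matrix.mul_apply, Fin.sum_univ_two, det2] <;> field_simp
    ring
  rw [e]
  refine (isDec_diag_mul (div_ne_zero hg hd) hd ?_).mul_left ⟨fun i j => ?_, by simp [det2]⟩
  · refine ⟨by simp, by simp, by simp, ?_⟩
    simpa using (div_lt_one hd').2 h2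
  · fin_cases i <;> fin_cases j <;> simp
    exact div_le_one_of_le₀ h1 (norm_nonneg _)

lemma isDec_of_det {g : Matrix (Fin 2) (Fin 2) ℚ_[p]} (hg : det2 p g ≠ 0) : IsDec g := by
  have hsw : sw * (sw * g) = g := by rw [← Matrix.mul_assoc, sw_mul_sw, Matrix.one_mul]
  have hg' := det2_mul_ne_zero det2_sw_ne_zero hg
  have hswg : sw * g = !![-g 1 0, -g 1 1; -g 0 0, -g 0 1] := by
    ext i j; fin_cases i <;> fin_cases j <;> simp [sw, Matrix.mul_apply, Fin.sum_univ_two]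
  rw [hswg] at hsw hg'
  by_cases h : max ‖g 0 1‖ ‖g 1 1‖ ≤ max ‖g 0 0‖ ‖g 1 0‖
  · rcases le_total ‖g 1 0‖ ‖g 0 0‖ with h1 | h1
    · rw [max_eq_left h1] at h
      exact isDec_of_left hg h1 ((le_max_left _ _).trans h)
    · rw [max_eq_right h1] at h
      rw [← hsw]
      refine (isDec_of_left hg' ?_ ?_).mul_left isK_sw
      · simpa using h1
      · simpa using (le_max_right _ _).trans h
  · rw [not_le] at h
    rcases le_total ‖g 0 1‖ ‖g 1 1‖ with h1 | h1
    · rw [max_eq_right h1] at h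
      exact isDec_of_right hg h1 ((le_max_right _ _).trans_lt h)
    · rw [max_eq_left h1] at h
      rw [← hsw]
      refine (isDec_of_right hg' ?_ ?_).mul_left isK_sw
      · simpa using h1
      · simpa using (le_max_left _ _).trans_lt h

variable [IsUltrametricDist L] [CompleteSpace L] [Fact (0 < valL p L α)]

lemma HypS.exists_QB_eh (h : HypS p L k α β) : ∃ C : ℝ, 0 < C ∧
    ∀ g : Matrix (Fin 2) (Fin 2) ℚ_[p], det2 p g ≠ 0 → ∀ i ≤ k - 2,
      QB p k α β (act α g (eh k α β i)) C := by
  obtain ⟨C, hC, hb⟩ := h.exists_QB_Dm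
  obtain ⟨C', hC', hb'⟩ := h.exists_QB_act
  have hα := h.left_ne_zero
  refine ⟨C' * C, by positivity, fun g hg i hi => ?_⟩
  obtain ⟨κ, τ, c, s, hκ, hτ, hc, hdec⟩ := isDec_of_det hg
  obtain ⟨a, ha, hτe⟩ := hτ.act_eh (α := α) (β := β) hi
  have hτ0 := hτ.det_ne_zero
  have hsc := det2_scalar_ne_zero hc
  have hDτ := det2_mul_ne_zero (det2_Dm_ne_zero s) hτ0
  have hDwτ := det2_mul_ne_zero (det2_Dm_ne_zero s) (det2_mul_ne_zero det2_sw_ne_zero hτ0)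
  rcases hdec with rfl | rfl
  · rw [act_mul hα hκ.det_ne_zero (det2_mul_ne_zero hsc hDτ), act_mul hα hsc hDτ,
      act_mul hα (det2_Dm_ne_zero s) hτ0]
    refine hb' κ hκ _ _ (h.QB_act_scalar (((h.eh_homog hi).act _).act _) ?_ hc)
    rw [hτe, map_sum]
    refine QB.sum hC.le fun m hm => ?_
    rw [map_smul]
    exact (hb m (by have := Finset.mem_range.1 hm; omega) s).1.smul (ha m)
  · rw [act_mul hα hκ.det_ne_zero (det2_mul_ne_zero hsc hDwτ), act_mul hα hsc hDwτ,
      act_mul hα (det2_Dm_ne_zero s) (det2_mul_ne_zero det2_sw_ne_zero hτ0),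
      act_mul hα det2_sw_ne_zero hτ0]
    refine hb' κ hκ _ _ (h.QB_act_scalar ((((h.eh_homog hi).act _).act _).act _) ?_ hc)
    rw [hτe, map_sum, map_sum]
    refine QB.sum hC.le fun m hm => ?_
    rw [map_smul, map_smul]
    exact (hb m (by have := Finset.mem_range.1 hm; omega) s).2.smul (ha m)

/-- The action on the quotient is uniformly bounded. -/
theorem HypS.exists_unitary_bound (h : HypS p L k α β) : ∃ C : ℝ, 0 < C ∧
    ∀ g : Matrix (Fin 2) (Fin 2) ℚ_[p], det2 p g ≠ 0 → ∀ u : BX p L α,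
      ‖qmk k α β (rho k α β g u)‖ ≤ C * ‖qmk k α β u‖ := by
  obtain ⟨C, hC, hb⟩ := h.exists_QB_eh
  obtain ⟨C', hC', hext⟩ := h.exists_extension
  have hα := h.left_ne_zero
  refine ⟨C' * C, by positivity, fun g hg u => ?_⟩
  refine h.norm_qmk_rho_le hg (by positivity) (fun v => ?_) u
  obtain ⟨T', h1, h2⟩ := hext (QX p k α β)
    (((qmk k α β).comp (rho k α β g)).toLinearMap ∘ₗ (DD p k α β).subtype) C (fun w hw => by
      obtain ⟨g', n, i, hg', hi, he⟩ := hw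
      obtain ⟨v, hv, hn⟩ := hb (g * (g' * Dm n))
        (det2_mul_ne_zero hg (det2_mul_ne_zero hg'.det_ne_zero (det2_Dm_ne_zero n))) i hi
      have : rho k α β g w = v := by
        apply lift_injective k α β
        rw [hv, h.lift_rho hg, he, act_mul hα hg
          (det2_mul_ne_zero hg'.det_ne_zero (det2_Dm_ne_zero n)),
          act_mul hα hg'.det_ne_zero (det2_Dm_ne_zero n)]
      rw [← this] at hn
      exact hn)
  have : T' = (qmk k α β).comp (rho k α β g) :=
    h.clm_ext fun w hw => h1 ⟨w, Submodule.subset_span hw⟩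
  rw [this] at h2
  exact h2 v

end Iwahori

section Averages

set_option linter.unusedSectionVars false

variable {p : ℕ} [hp : Fact p.Prime]
variable {L : Type} [NontriviallyNormedField L] [NormedAlgebra ℚ_[p] L]

lemma card_modEq_range {e M : ℕ} (he : e ≤ M) (r : ℕ) :
    ((Finset.range (p ^ M)).filter (fun i => i ≡ r [MOD p ^ e])).card = p ^ (M - e) := by
  have hpe : 0 < p ^ e := pow_pos hp.out.pos e
  rw [← Nat.count_eq_card_filter_range, Nat.count_modEq_card _ hpe,
    Nat.mod_eq_zero_of_dvd (pow_dvd_pow p he), if_neg (Nat.not_lt_zero _), add_zero,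
    Nat.pow_div he hp.out.pos]

lemma exists_nat_norm_sub_le {τ : ℚ_[p]} (hτ : ‖τ‖ ≤ 1) (e : ℕ) :
    ∃ r : ℕ, ‖τ - r‖ ≤ (p : ℝ) ^ (-e : ℤ) := by
  refine ⟨(toZ τ).appr e, ?_⟩
  have h := PadicInt.appr_spec e (toZ τ)
  rw [← PadicInt.norm_le_pow_iff_mem_span_pow, PadicInt.norm_def] at h
  push_cast at h
  rwa [coe_toZ hτ] at h

lemma norm_sub_le_iff_of_le {x y z : ℚ_[p]} {t : ℝ} (h : ‖y - z‖ ≤ t) :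
    ‖x - y‖ ≤ t ↔ ‖x - z‖ ≤ t := by
  constructor <;> intro h1
  · rw [show x - z = (x - y) + (y - z) by ring]
    exact (Padic.nonarchimedean _ _).trans (max_le h1 h)
  · rw [show x - y = (x - z) + -(y - z) by ring]
    exact (Padic.nonarchimedean _ _).trans (max_le h1 (by rwa [norm_neg]))

/-- The normalized sum of `f` over representatives of `p^{-N}ℤ_p / p^Nℤ_p`. -/
def avg (N : ℕ) : (ℚ_[p] → L) →ₗ[L] L where
  toFun f := ((p : L) ^ N)⁻¹ * ∑ i ∈ Finset.range (p ^ (2 * N)), f ((i : ℚ_[p]) / (p : ℚ_[p]) ^ N)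
  map_add' f g := by simp [Finset.sum_add_distrib, mul_add]
  map_smul' c f := by simp [← Finset.mul_sum, mul_left_comm]

lemma avg_apply (N : ℕ) (f : ℚ_[p] → L) : avg N f =
    ((p : L) ^ N)⁻¹ * ∑ i ∈ Finset.range (p ^ (2 * N)), f ((i : ℚ_[p]) / (p : ℚ_[p]) ^ N) := rfl

lemma norm_sample_le (N i : ℕ) : ‖(i : ℚ_[p]) / (p : ℚ_[p]) ^ N‖ ≤ (p : ℝ) ^ N := by
  rw [norm_div, norm_p_pow, div_inv_eq_mul]
  have : ‖(i : ℚ_[p])‖ ≤ 1 := by exact_mod_cast Padic.norm_int_le_one (i : ℤ)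
  exact mul_le_of_le_one_left (by positivity) this

lemma avg_congr {N : ℕ} {f g : ℚ_[p] → L} (h : ∀ y, ‖y‖ ≤ (p : ℝ) ^ N → f y = g y) :
    avg N f = avg N g := by
  rw [avg_apply, avg_apply]
  congr 1
  exact Finset.sum_congr rfl fun i _ => h _ (norm_sample_le N i)

/-- The average of the indicator function of a ball. -/
lemma avg_ball {N : ℕ} {n : ℤ} (h1 : -(N : ℤ) ≤ n) (h2 : n ≤ N) {t : ℚ_[p]}
    (ht : ‖t‖ ≤ (p : ℝ) ^ N) :
    avg N (fun y => if ‖y - t‖ ≤ (p : ℝ) ^ n then (1 : L) else 0) = (p : L) ^ n := by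
  have hp0 : (p : ℚ_[p]) ^ N ≠ 0 := pow_ne_zero _ prime_cast_ne_zero
  have hpR : (0 : ℝ) < (p : ℝ) := by exact_mod_cast hp.out.pos
  have hpL : (p : L) ≠ 0 := prime_cast_ne_zero' p
  obtain ⟨e, he⟩ : ∃ e : ℕ, (e : ℤ) = N - n := ⟨(N - n).toNat, by omega⟩
  have hτ : ‖(p : ℚ_[p]) ^ N * t‖ ≤ 1 := by
    rw [norm_mul, norm_p_pow]
    rw [inv_mul_le_iff₀ (by positivity), mul_one]; exact ht
  obtain ⟨r, hr⟩ := exists_nat_norm_sub_le hτ e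
  have key : ∀ i : ℕ, ‖(i : ℚ_[p]) / (p : ℚ_[p]) ^ N - t‖ ≤ (p : ℝ) ^ n ↔ i ≡ r [MOD p ^ e] := by
    intro i
    have e1 : (i : ℚ_[p]) / (p : ℚ_[p]) ^ N - t = (i - (p : ℚ_[p]) ^ N * t) / (p : ℚ_[p]) ^ N := by
      field_simp
    have e2 : (p : ℝ) ^ n = (p : ℝ) ^ (-e : ℤ) * (p : ℝ) ^ N := by
      rw [← zpow_natCast, ← zpow_add₀ hpR.ne', he]; congr 1; ring
    rw [e1, norm_div, norm_p_pow, div_inv_eq_mul, e2, mul_le_mul_iff_left₀ (by positivity),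
      norm_sub_le_iff_of_le hr]
    have e3 : (i : ℚ_[p]) - r = (((i : ℤ) - (r : ℤ) : ℤ) : ℚ_[p]) := by push_cast; rfl
    rw [e3, Padic.norm_int_le_pow_iff_dvd, Nat.ModEq.comm, Nat.modEq_iff_dvd]
    push_cast; rfl
  rw [avg_apply]
  have e4 : ∑ i ∈ Finset.range (p ^ (2 * N)),
      (if ‖(i : ℚ_[p]) / (p : ℚ_[p]) ^ N - t‖ ≤ (p : ℝ) ^ n then (1 : L) else 0) =
      ∑ i ∈ Finset.range (p ^ (2 * N)), if i ≡ r [MOD p ^ e] then (1 : L) else 0 :=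
    Finset.sum_congr rfl fun i _ => by simp only [key]
  rw [e4, Finset.sum_boole]
  have := card_modEq_range (p := p) (e := e) (M := 2 * N) (by omega) r
  have e6 : (((Finset.range (p ^ (2 * N))).filter (fun i => i ≡ r [MOD p ^ e])).card : L) =
      (p : L) ^ (2 * N - e) := by
    rw [← Nat.cast_pow, ← this]
  rw [e6, ← zpow_natCast, ← zpow_natCast, ← zpow_neg, ← zpow_add₀ hpL]
  congr 1
  omega

/-- The regularized integral at level `N`. -/
def regInt (κ : L) (N : ℕ) : (ℚ_[p] → L) →ₗ[L] L where
  toFun f := avg N f + κ * (p : L) ^ (N + 1) * f (((p : ℚ_[p]) ^ (N + 1))⁻¹)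
  map_add' f g := by simp; ring
  map_smul' c f := by simp; ring

lemma regInt_apply (κ : L) (N : ℕ) (f : ℚ_[p] → L) : regInt κ N f =
    avg N f + κ * (p : L) ^ (N + 1) * f (((p : ℚ_[p]) ^ (N + 1))⁻¹) := rfl

lemma norm_inv_p_pow (n : ℕ) : ‖((p : ℚ_[p]) ^ n)⁻¹‖ = (p : ℝ) ^ n := by
  rw [norm_inv, norm_p_pow, inv_inv]

lemma norm_inv_p_pow_sub {N : ℕ} {t : ℚ_[p]} (ht : ‖t‖ ≤ (p : ℝ) ^ N) :
    ‖((p : ℚ_[p]) ^ (N + 1))⁻¹ - t‖ = (p : ℝ) ^ (N + 1) := by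
  have hp1 : (1 : ℝ) < (p : ℝ) := by exact_mod_cast hp.out.one_lt
  rw [sub_eq_add_neg, norm_add_eq_of_lt, norm_inv_p_pow]
  rw [norm_neg, norm_inv_p_pow]
  exact ht.trans_lt (pow_lt_pow_right₀ hp1 (Nat.lt_succ_self N))

lemma regInt_ball (κ : L) {N : ℕ} {n : ℤ} (h1 : -(N : ℤ) ≤ n) (h2 : n ≤ N) {t : ℚ_[p]}
    (ht : ‖t‖ ≤ (p : ℝ) ^ N) :
    regInt κ N (fun y => if ‖y - t‖ ≤ (p : ℝ) ^ n then (1 : L) else 0) = (p : L) ^ n := by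
  have hp1 : (1 : ℝ) < (p : ℝ) := by exact_mod_cast hp.out.one_lt
  rw [regInt_apply, avg_ball h1 h2 ht, if_neg, mul_zero, add_zero]
  rw [norm_inv_p_pow_sub ht, not_le, ← zpow_natCast]
  exact zpow_lt_zpow_right₀ hp1 (by push_cast; omega)

lemma norm_le_zpow_iff {w : ℚ_[p]} (hw : w ≠ 0) (n : ℤ) : ‖w‖ ≤ (p : ℝ) ^ n ↔ -n ≤ w.valuation := by
  have hp1 : (1 : ℝ) < (p : ℝ) := by exact_mod_cast hp.out.one_lt
  rw [Padic.norm_eq_zpow_neg_valuation hw, zpow_le_zpow_iff_right₀ hp1]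
  omega

/-- `χ^{val w}` cut off to `val w ≤ m`. -/
def charCut (χ : L) (m : ℤ) : ℚ_[p] → L := fun w =>
  if w ≠ 0 ∧ w.valuation ≤ m then χ ^ w.valuation else 0

lemma charCut_succ (χ : L) (m : ℤ) (w : ℚ_[p]) : charCut χ (m + 1) w = charCut χ m w +
    χ ^ (m + 1) * ((if ‖w‖ ≤ (p : ℝ) ^ (-m - 1) then 1 else 0) -
      if ‖w‖ ≤ (p : ℝ) ^ (-m - 2) then 1 else 0) := by
  have hpR : (0 : ℝ) < (p : ℝ) := by exact_mod_cast hp.out.pos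
  by_cases hw : w = 0
  · subst hw
    simp [charCut, (zpow_pos hpR _).le]
  simp only [charCut, norm_le_zpow_iff hw, hw, ne_eq, not_false_eq_true, true_and]
  rcases lt_trichotomy w.valuation (m + 1) with h | h | h
  · rw [if_pos h.le, if_pos (by omega), if_neg (by omega), if_neg (by omega)]; ring
  · rw [if_pos h.le, if_neg (by omega), if_pos (by omega), if_neg (by omega), h]; ring
  · rw [if_neg (by omega), if_neg (by omega), if_pos (by omega), if_pos (by omega)]; ring

lemma avg_charCut {χ Q κ : L} (hχ : χ ≠ 0) (hQ : Q = (p : L) / χ)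
    (hκ : κ * (1 - Q) = 1 - (p : L)⁻¹) {N : ℕ} {t : ℚ_[p]} (ht : ‖t‖ ≤ (p : ℝ) ^ N) (j : ℕ)
    (hj : j ≤ 2 * N) :
    avg N (fun y => charCut χ (j - N - 1) (y - t)) =
      κ * (Q ^ (-(j - N - 1 : ℤ)) - Q ^ (N + 1)) := by
  have hpR : (0 : ℝ) < (p : ℝ) := by exact_mod_cast hp.out.pos
  have hpL : (p : L) ≠ 0 := prime_cast_ne_zero' p
  have hQ0 : Q ≠ 0 := by rw [hQ]; exact div_ne_zero hpL hχ
  induction j with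
  | zero =>
    have e1 : avg N (fun y => charCut χ ((0 : ℕ) - N - 1) (y - t)) = avg N (0 : ℚ_[p] → L) := by
      apply avg_congr
      intro y hy
      simp only [charCut, Pi.zero_apply]
      rw [if_neg]
      rintro ⟨h0, h1⟩
      have h2 : ‖y - t‖ ≤ (p : ℝ) ^ (N : ℤ) := by
        rw [zpow_natCast]
        exact (Padic.nonarchimedean y (-t)).trans (max_le hy (by rwa [norm_neg])) |> fun h => by
          rwa [← sub_eq_add_neg] at h
      rw [norm_le_zpow_iff h0] at h2
      push_cast at h1
      omega
    rw [e1, map_zero]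
    have : (-((0 : ℕ) - N - 1 : ℤ)) = ((N + 1 : ℕ) : ℤ) := by push_cast; ring
    rw [this, zpow_natCast, sub_self, mul_zero]
  | succ j ih =>
    have e1 : (fun y => charCut χ ((j + 1 : ℕ) - N - 1) (y - t)) =
        (fun y => charCut χ (j - N - 1) (y - t)) + χ ^ ((j : ℤ) - N) •
          ((fun y => if ‖y - t‖ ≤ (p : ℝ) ^ (N - j : ℤ) then (1 : L) else 0) -
            fun y => if ‖y - t‖ ≤ (p : ℝ) ^ (N - j - 1 : ℤ) then (1 : L) else 0) := by
      funext y
      have := charCut_succ (p := p) χ (j - N - 1) (y - t)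
      have a1 : ((j + 1 : ℕ) - N - 1 : ℤ) = (j - N - 1) + 1 := by push_cast; ring
      rw [a1, this, show (-(j - N - 1 : ℤ) - 1) = N - j by ring,
        show (-(j - N - 1 : ℤ) - 2) = N - j - 1 by ring, show (j - N - 1 + 1 : ℤ) = j - N by ring]
      rfl
    rw [e1, map_add, map_smul, map_sub, ih (by omega), avg_ball (by omega) (by omega) ht,
      avg_ball (by omega) (by omega) ht]
    have a2 : (-((j + 1 : ℕ) - N - 1 : ℤ)) = N - j := by push_cast; ring
    have a3 : (-((j : ℤ) - N - 1 : ℤ)) = (N - j) + 1 := by ring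
    have a4 : χ ^ ((j : ℤ) - N) * (p : L) ^ (N - j : ℤ) = Q ^ (N - j : ℤ) := by
      rw [hQ, div_zpow, ← neg_sub, zpow_neg]; field_simp
    rw [a2, a3, zpow_add_one₀ hQ0, zpow_sub_one₀ hpL, smul_eq_mul]
    linear_combination (1 - (p : L)⁻¹) * a4 - Q ^ (N - j : ℤ) * hκ

lemma regInt_charCut {χ Q κ : L} (hχ : χ ≠ 0) (hQ : Q = (p : L) / χ)
    (hκ : κ * (1 - Q) = 1 - (p : L)⁻¹) {N : ℕ} {t : ℚ_[p]} (ht : ‖t‖ ≤ (p : ℝ) ^ N) {m : ℤ}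
    (h1 : -(N : ℤ) - 1 ≤ m) (h2 : m ≤ N - 1) :
    regInt κ N (fun y => charCut χ m (y - t)) = κ * Q ^ (-m) := by
  have hpR : (0 : ℝ) < (p : ℝ) := by exact_mod_cast hp.out.pos
  have hpL : (p : L) ≠ 0 := prime_cast_ne_zero' p
  obtain ⟨j, hj⟩ : ∃ j : ℕ, (j : ℤ) = m + N + 1 := ⟨(m + N + 1).toNat, by omega⟩
  have hm : m = j - N - 1 := by omega
  have h3 := norm_inv_p_pow_sub ht
  have h4 : ((p : ℚ_[p]) ^ (N + 1))⁻¹ - t ≠ 0 := by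
    rw [← norm_pos_iff, h3]; positivity
  have h5 : (((p : ℚ_[p]) ^ (N + 1))⁻¹ - t).valuation = -((N + 1 : ℕ) : ℤ) := by
    rw [valuation_eq_of_norm_eq h4 (h3.trans (norm_inv_p_pow (N + 1)).symm), Padic.valuation_inv,
      valuation_p_pow']
  rw [regInt_apply]
  have h6 : charCut χ m (((p : ℚ_[p]) ^ (N + 1))⁻¹ - t) = (χ ^ (N + 1))⁻¹ := by
    rw [charCut, if_pos ⟨h4, by rw [h5]; push_cast; omega⟩, h5, zpow_neg, zpow_natCast]
  have h7 := avg_charCut hχ hQ hκ ht j (by omega)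
  rw [← hm] at h7
  rw [h6, h7]
  have : Q ^ (N + 1) = (p : L) ^ (N + 1) * (χ ^ (N + 1))⁻¹ := by rw [hQ, div_pow, div_eq_mul_inv]
  rw [this]; ring

end Averages

section Theta

set_option linter.unusedSectionVars false

variable {p : ℕ} [hp : Fact p.Prime]
variable {L : Type} [NontriviallyNormedField L] [NormedAlgebra ℚ_[p] L]

/-- The leading coefficient function of the translate of `eh` by `g`. -/
def theta (χ : L) (g : Matrix (Fin 2) (Fin 2) ℚ_[p]) : ℚ_[p] → L := fun y =>
  if ‖g 1 1 - g 0 1 * y‖ ≤ ‖g 0 0 * y - g 1 0‖ ∧ g 0 0 * y - g 1 0 ≠ 0 then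
    χ ^ (g 0 0 * y - g 1 0).valuation else 0

lemma eventually_norm_le_pow (t : ℚ_[p]) : ∀ᶠ N : ℕ in atTop, ‖t‖ ≤ (p : ℝ) ^ N := by
  have hp1 : (1 : ℝ) < (p : ℝ) := by exact_mod_cast hp.out.one_lt
  exact (tendsto_pow_atTop_atTop_of_one_lt hp1).eventually_ge_atTop _

lemma eventually_abs_le (n : ℤ) : ∀ᶠ N : ℕ in atTop, |n| ≤ N := by
  filter_upwards [eventually_ge_atTop n.natAbs] with N hN
  rw [Int.abs_eq_natAbs]
  exact_mod_cast hN

lemma theta_eq_ball (χ : L) {g : Matrix (Fin 2) (Fin 2) ℚ_[p]} (hg : det2 p g ≠ 0)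
    (hab : ‖g 0 0‖ < ‖g 0 1‖) :
    theta χ g = χ ^ ((det2 p g).valuation - (g 0 1).valuation) • fun y =>
      if ‖y - g 1 1 / g 0 1‖ ≤ (p : ℝ) ^ (2 * (g 0 1).valuation - (det2 p g).valuation)
      then (1 : L) else 0 := by
  have hb : g 0 1 ≠ 0 := norm_pos_iff.1 ((norm_nonneg _).trans_lt hab)
  have hpR : (0 : ℝ) < (p : ℝ) := by exact_mod_cast hp.out.pos
  have hrad : (p : ℝ) ^ (2 * (g 0 1).valuation - (det2 p g).valuation) =
      ‖det2 p g / g 0 1‖ / ‖g 0 1‖ := by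
    rw [norm_div, Padic.norm_eq_zpow_neg_valuation hg, Padic.norm_eq_zpow_neg_valuation hb,
      ← zpow_sub₀ hpR.ne', ← zpow_sub₀ hpR.ne']
    congr 1; ring
  have hb' : 0 < ‖g 0 1‖ := norm_pos_iff.2 hb
  have hdb : 0 < ‖det2 p g / g 0 1‖ := norm_pos_iff.2 (div_ne_zero hg hb)
  funext y
  obtain ⟨w, rfl⟩ : ∃ w, y = g 1 1 / g 0 1 + w := ⟨y - g 1 1 / g 0 1, by ring⟩
  have e1 : g 1 1 - g 0 1 * (g 1 1 / g 0 1 + w) = -(g 0 1 * w) := by field_simp; ring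
  have e2 : g 0 0 * (g 1 1 / g 0 1 + w) - g 1 0 = det2 p g / g 0 1 + g 0 0 * w := by
    rw [det2]; field_simp; ring
  simp only [theta, Pi.smul_apply, smul_eq_mul, hrad, e1, e2, norm_neg, add_sub_cancel_left]
  have hiff : ‖w‖ ≤ ‖det2 p g / g 0 1‖ / ‖g 0 1‖ ↔ ‖g 0 1 * w‖ ≤ ‖det2 p g / g 0 1‖ := by
    rw [le_div_iff₀ hb', mul_comm ‖w‖, ← norm_mul]
  simp only [hiff]
  by_cases hw : ‖g 0 1 * w‖ ≤ ‖det2 p g / g 0 1‖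
  · have h1 : ‖g 0 0 * w‖ < ‖det2 p g / g 0 1‖ := by
      by_cases hw0 : w = 0
      · rw [hw0, mul_zero, norm_zero]; exact hdb
      · refine lt_of_lt_of_le ?_ hw
        rw [norm_mul, norm_mul]
        exact mul_lt_mul_of_pos_right hab (norm_pos_iff.2 hw0)
    have h2 := norm_add_eq_of_lt h1
    have h3 : det2 p g / g 0 1 + g 0 0 * w ≠ 0 := by
      rw [← norm_pos_iff, h2]; exact hdb
    rw [if_pos ⟨by rw [h2]; exact hw, h3⟩, if_pos hw, mul_one, valuation_eq_of_norm_eq h3 h2,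
      div_eq_mul_inv, Padic.valuation_mul hg (inv_ne_zero hb), Padic.valuation_inv]
    rfl
  · rw [if_neg, if_neg hw, mul_zero]
    rintro ⟨h1, -⟩
    rw [not_le] at hw
    have hw0 : w ≠ 0 := by
      rintro rfl; rw [mul_zero, norm_zero] at hw; exact absurd hw (not_lt.2 hdb.le)
    have h2 : ‖g 0 0 * w‖ < ‖g 0 1 * w‖ := by
      rw [norm_mul, norm_mul]; exact mul_lt_mul_of_pos_right hab (norm_pos_iff.2 hw0)
    exact absurd (h1.trans (Padic.nonarchimedean _ _)) (not_le.2 (max_lt hw h2))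

lemma theta_eq_charCut {χ : L} (hχ : χ ≠ 0) {g : Matrix (Fin 2) (Fin 2) ℚ_[p]} (hg : det2 p g ≠ 0)
    (hab : ‖g 0 1‖ ≤ ‖g 0 0‖) (ha : g 0 0 ≠ 0) :
    theta χ g = χ ^ (g 0 0).valuation • fun y =>
      charCut χ ((det2 p g).valuation - 2 * (g 0 0).valuation) (y - g 1 0 / g 0 0) := by
  have hp1 : (1 : ℝ) < (p : ℝ) := by exact_mod_cast hp.out.one_lt
  funext y
  obtain ⟨w, rfl⟩ : ∃ w, y = g 1 0 / g 0 0 + w := ⟨y - g 1 0 / g 0 0, by ring⟩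
  have e1 : g 1 1 - g 0 1 * (g 1 0 / g 0 0 + w) = det2 p g / g 0 0 + -(g 0 1 * w) := by
    rw [det2]; field_simp; ring
  have e2 : g 0 0 * (g 1 0 / g 0 0 + w) - g 1 0 = g 0 0 * w := by field_simp; ring
  simp only [theta, Pi.smul_apply, smul_eq_mul, charCut, e1, e2, add_sub_cancel_left]
  by_cases hw : w = 0
  · subst hw; simp
  have h1 : ‖-(g 0 1 * w)‖ ≤ ‖g 0 0 * w‖ := by
    rw [norm_neg, norm_mul, norm_mul]; exact mul_le_mul_of_nonneg_right hab (norm_nonneg _)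
  have h2 : ‖det2 p g / g 0 0 + -(g 0 1 * w)‖ ≤ ‖g 0 0 * w‖ ↔ ‖det2 p g / g 0 0‖ ≤ ‖g 0 0 * w‖ := by
    constructor
    · intro h
      rw [show det2 p g / g 0 0 = (det2 p g / g 0 0 + -(g 0 1 * w)) + -(-(g 0 1 * w)) by ring]
      exact (Padic.nonarchimedean _ _).trans (max_le h (by rw [norm_neg]; exact h1))
    · intro h
      exact (Padic.nonarchimedean _ _).trans (max_le h h1)
  have h3 : ‖det2 p g / g 0 0‖ ≤ ‖g 0 0 * w‖ ↔
      w.valuation ≤ (det2 p g).valuation - 2 * (g 0 0).valuation := by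
    rw [Padic.norm_eq_zpow_neg_valuation (div_ne_zero hg ha),
      Padic.norm_eq_zpow_neg_valuation (mul_ne_zero ha hw), zpow_le_zpow_iff_right₀ hp1,
      div_eq_mul_inv, Padic.valuation_mul hg (inv_ne_zero ha), Padic.valuation_inv,
      Padic.valuation_mul ha hw]
    constructor <;> intro h <;> linarith
  simp only [h2, h3, mul_ne_zero ha hw, hw, ne_eq, not_false_eq_true, and_true, true_and]
  split_ifs
  · rw [Padic.valuation_mul ha hw, zpow_add₀ hχ]
  · rw [mul_zero]

lemma eventually_regInt_theta {α β κ : L} (hα : α ≠ 0) (hβ : β ≠ 0)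
    (hκ : κ * (1 - α / β) = 1 - (p : L)⁻¹) {g : Matrix (Fin 2) (Fin 2) ℚ_[p]} (hg : det2 p g ≠ 0) :
    ∀ᶠ N : ℕ in atTop, regInt κ N (theta (β * (p : L) / α) g) =
      (β / α) ^ (det2 p g).valuation *
        if ‖g 0 1‖ ≤ ‖g 0 0‖ then κ * (α * (p : L) / β) ^ (g 0 0).valuation
        else (α * (p : L) / β) ^ (g 0 1).valuation := by
  have hpL : (p : L) ≠ 0 := prime_cast_ne_zero' p
  have hχ : β * (p : L) / α ≠ 0 := div_ne_zero (mul_ne_zero hβ hpL) hα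
  by_cases hab : ‖g 0 1‖ ≤ ‖g 0 0‖
  · have ha : g 0 0 ≠ 0 := by
      intro h0
      have h1 : g 0 1 = 0 := by rw [h0, norm_zero] at hab; exact norm_le_zero_iff.1 hab
      exact hg (by rw [det2, h0, h1]; ring)
    rw [if_pos hab, theta_eq_charCut hχ hg hab ha]
    filter_upwards [eventually_norm_le_pow (g 1 0 / g 0 0),
      eventually_abs_le (|(det2 p g).valuation - 2 * (g 0 0).valuation| + 1)] with N h1 h2
    have h3 := abs_le.1 (show |(det2 p g).valuation - 2 * (g 0 0).valuation| ≤ (N : ℤ) - 1 by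
      have := (le_abs_self _).trans h2; omega)
    rw [map_smul, regInt_charCut (Q := α / β) hχ (by field_simp) hκ h1 (by omega) (by omega),
      smul_eq_mul, neg_sub, zpow_sub₀ (div_ne_zero hα hβ)]
    have e1 : (α / β) ^ (2 * (g 0 0).valuation) = ((α / β) * (α / β)) ^ (g 0 0).valuation := by
      rw [two_mul, zpow_add₀ (div_ne_zero hα hβ), mul_zpow]
    have e2 : (α * (p : L) / β) ^ (g 0 0).valuation =
        (β * (p : L) / α) ^ (g 0 0).valuation * ((α / β) * (α / β)) ^ (g 0 0).valuation := by
      rw [← mul_zpow]; congr 1; field_simp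
    have e3 : (β / α) ^ (det2 p g).valuation = ((α / β) ^ (det2 p g).valuation)⁻¹ := by
      rw [← inv_zpow, inv_div]
    rw [e1, e2, e3]; ring
  · rw [if_neg hab, theta_eq_ball _ hg (not_le.1 hab)]
    filter_upwards [eventually_norm_le_pow (g 1 1 / g 0 1),
      eventually_abs_le (2 * (g 0 1).valuation - (det2 p g).valuation)] with N h1 h2
    have h3 := abs_le.1 h2
    rw [map_smul, regInt_ball κ (by omega) (by omega) h1, smul_eq_mul, zpow_sub₀ hχ, zpow_sub₀ hpL]
    have e1 : (p : L) ^ (2 * (g 0 1).valuation) = ((p : L) * p) ^ (g 0 1).valuation := by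
      rw [two_mul, zpow_add₀ hpL, mul_zpow]
    have e2 : (α * (p : L) / β) ^ (g 0 1).valuation =
        ((p : L) * p) ^ (g 0 1).valuation / (β * (p : L) / α) ^ (g 0 1).valuation := by
      rw [← div_zpow]; congr 1; field_simp
    have e3 : (β / α) ^ (det2 p g).valuation =
        (β * (p : L) / α) ^ (det2 p g).valuation / (p : L) ^ (det2 p g).valuation := by
      rw [← div_zpow]; congr 1; field_simp
    rw [e1, e2, e3]; ring

end Theta

section Leading

set_option linter.unusedSectionVars false

open Polynomial

variable {p : ℕ} [hp : Fact p.Prime]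
variable {L : Type} [NontriviallyNormedField L] [NormedAlgebra ℚ_[p] L]
variable {k : ℕ} {α β : L}

lemma sum_choose_eval_eq_coeff {n : ℕ} {Q : L[X]} (hQ : Q.natDegree ≤ n) :
    ∑ t ∈ Finset.range (n + 1), ((-1 : L) ^ (n - t) * (n.choose t : L)) * Q.eval (t : L) =
      n.factorial * Q.coeff n := by
  have h1 : (fwdDiff (1 : L))^[n] Q.eval 0 = n.factorial * Q.coeff n := by
    rcases hQ.eq_or_lt with h | h
    · have := congrFun (Polynomial.fwdDiff_iter_degree_eq_factorial Q) 0
      rw [h] at this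
      rw [this, Polynomial.leadingCoeff, h]
      simp [mul_comm]
    · rw [Polynomial.fwdDiff_iter_eq_zero_of_degree_lt h, Polynomial.coeff_eq_zero_of_natDegree_lt h]
      simp
  rw [← h1, fwdDiff_iter_eq_sum_shift]
  refine Finset.sum_congr rfl fun t _ => ?_
  simp [zsmul_eq_mul]

/-- The leading coefficient of a function that is polynomial of degree at most `n` on the
balls of radius `p^{-N}`, computed by finite differences. -/
def topOp (n N : ℕ) : (ℚ_[p] → L) →ₗ[L] (ℚ_[p] → L) where
  toFun φ := fun y => ((n.factorial : L) * ((p : L) ^ N) ^ n)⁻¹ *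
    ∑ t ∈ Finset.range (n + 1), ((-1 : L) ^ (n - t) * (n.choose t : L)) * φ (y + t * (p : ℚ_[p]) ^ N)
  map_add' f g := by ext y; simp only [Pi.add_apply, mul_add, Finset.sum_add_distrib]
  map_smul' c f := by
    ext y
    simp only [Pi.smul_apply, smul_eq_mul, RingHom.id_apply, Finset.mul_sum]
    exact Finset.sum_congr rfl fun t _ => by ring

lemma topOp_apply (n N : ℕ) (φ : ℚ_[p] → L) (y : ℚ_[p]) : topOp n N φ y =
    ((n.factorial : L) * ((p : L) ^ N) ^ n)⁻¹ *
    ∑ t ∈ Finset.range (n + 1), ((-1 : L) ^ (n - t) * (n.choose t : L)) * φ (y + t * (p : ℚ_[p]) ^ N) :=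
  rfl

lemma topOp_eq {n N : ℕ} {φ : ℚ_[p] → L} {y : ℚ_[p]} {Q : L[X]} (hQ : Q.natDegree ≤ n)
    (h : ∀ t : ℕ, φ (y + t * (p : ℚ_[p]) ^ N) = Q.eval (t : L)) :
    topOp n N φ y = Q.coeff n / ((p : L) ^ N) ^ n := by
  have : CharZero L := charZero_of_injective_algebraMap (algebraMap ℚ_[p] L).injective
  have hf : (n.factorial : L) ≠ 0 := by exact_mod_cast n.factorial_ne_zero
  have hpL : (p : L) ≠ 0 := prime_cast_ne_zero' p
  rw [topOp_apply]
  simp only [h]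
  rw [sum_choose_eval_eq_coeff hQ]
  field_simp

/-- The leading coefficient of a product of powers of two affine functions. -/
lemma affine_prod_degree_coeff (s A B A' B' : L) {n j : ℕ} (hj : j ≤ n) :
    (C s * ((C A * X + C B) ^ (n - j) * (C A' * X + C B') ^ j) : L[X]).natDegree ≤ n ∧
    (C s * ((C A * X + C B) ^ (n - j) * (C A' * X + C B') ^ j) : L[X]).coeff n =
      s * (A ^ (n - j) * A' ^ j) := by
  have hdeg : ∀ A B : L, (C A * X + C B : L[X]).natDegree ≤ 1 := fun A B => natDegree_linear_le
  have h1 : ∀ (A B : L) (m : ℕ), ((C A * X + C B : L[X]) ^ m).natDegree ≤ m := fun A B m =>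
    natDegree_pow_le_of_le m (hdeg A B) |>.trans (by simp)
  have h2 : ∀ (A B : L) (m : ℕ), ((C A * X + C B : L[X]) ^ m).coeff m = A ^ m := fun A B m => by
    have := coeff_pow_of_natDegree_le (m := m) (hdeg A B)
    simpa using this
  have h3 : n - j + j = n := by omega
  refine ⟨(natDegree_C_mul_le _ _).trans ((natDegree_mul_le_of_le (h1 _ _ _) (h1 _ _ _)).trans
    h3.le), ?_⟩
  rw [coeff_C_mul]
  have := coeff_mul_add_eq_of_natDegree_le (h1 A B (n - j)) (h1 A' B' j)
  rw [h3, h2, h2] at this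
  rw [this]

lemma eventually_theta_support_stable {g : Matrix (Fin 2) (Fin 2) ℚ_[p]} (hg : det2 p g ≠ 0) :
    ∀ᶠ N : ℕ in atTop, ∀ y δ : ℚ_[p], ‖δ‖ ≤ ‖(p : ℚ_[p]) ^ N‖ →
      (‖g 1 1 - g 0 1 * y‖ ≤ ‖g 0 0 * y - g 1 0‖ ∧ g 0 0 * y - g 1 0 ≠ 0) →
      (‖g 1 1 - g 0 1 * (y + δ)‖ ≤ ‖g 0 0 * (y + δ) - g 1 0‖ ∧ g 0 0 * (y + δ) - g 1 0 ≠ 0) ∧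
        (g 0 0 * (y + δ) - g 1 0).valuation = (g 0 0 * y - g 1 0).valuation := by
  have hp1 : (1 : ℝ) < (p : ℝ) := by exact_mod_cast hp.out.one_lt
  set M : ℝ := max ‖g 0 0‖ ‖g 0 1‖ with hM
  have hM0 : 0 < M := by
    rw [hM, lt_max_iff, norm_pos_iff, norm_pos_iff]
    by_contra! h0
    exact hg (by rw [det2, h0.1, h0.2]; ring)
  have hd0 : 0 < ‖det2 p g‖ := norm_pos_iff.2 hg
  have ht : Tendsto (fun N : ℕ => ‖(p : ℚ_[p]) ^ N‖) atTop (𝓝 0) := by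
    simp only [norm_p_pow]
    exact (tendsto_pow_atTop_atTop_of_one_lt hp1).inv_tendsto_atTop
  filter_upwards [ht.eventually_lt_const (show 0 < ‖det2 p g‖ / M / M by positivity)]
    with N hN y δ hδ hy
  have hY : ‖det2 p g‖ / M ≤ ‖g 0 0 * y - g 1 0‖ := by
    rw [div_le_iff₀ hM0]
    have : det2 p g = g 0 0 * (g 1 1 - g 0 1 * y) + g 0 1 * (g 0 0 * y - g 1 0) := by
      rw [det2]; ring
    rw [this]
    refine (Padic.nonarchimedean _ _).trans (max_le ?_ ?_)
    · rw [norm_mul, mul_comm]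
      exact mul_le_mul hy.1 (le_max_left _ _) (norm_nonneg _) (norm_nonneg _)
    · rw [norm_mul, mul_comm]
      exact mul_le_mul_of_nonneg_left (le_max_right _ _) (norm_nonneg _)
  have hMδ : M * ‖δ‖ < ‖g 0 0 * y - g 1 0‖ := by
    refine lt_of_lt_of_le ?_ hY
    have := hδ.trans_lt hN
    rwa [lt_div_iff₀ hM0, mul_comm] at this
  have := support_stable (dx := -(g 0 1 * δ)) (dy := g 0 0 * δ) hy
    (by
      rw [norm_neg, norm_mul]
      exact (mul_le_mul_of_nonneg_right (le_max_right _ _) (norm_nonneg _)).trans hMδ.le)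
    (by
      rw [norm_mul]
      exact (mul_le_mul_of_nonneg_right (le_max_left _ _) (norm_nonneg _)).trans_lt hMδ)
  have e1 : g 1 1 - g 0 1 * (y + δ) = g 1 1 - g 0 1 * y + -(g 0 1 * δ) := by ring
  have e2 : g 0 0 * (y + δ) - g 1 0 = g 0 0 * y - g 1 0 + g 0 0 * δ := by ring
  rw [e1, e2]
  exact this

lemma eventually_topOp_eh {g : Matrix (Fin 2) (Fin 2) ℚ_[p]} (hg : det2 p g ≠ 0) {j : ℕ}
    (hj : j ≤ k - 2) :
    ∀ᶠ N : ℕ in atTop, topOp (k - 2) N (fun y => act β g (eh k β α j) 1 y) =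
      (β ^ (-(det2 p g).valuation) * (iotaL p L (g 0 0) ^ (k - 2 - j) * iotaL p L (-(g 0 1)) ^ j)) •
        theta (β * (p : L) / α) g := by
  have hpL : (p : L) ≠ 0 := prime_cast_ne_zero' p
  filter_upwards [eventually_theta_support_stable hg] with N hN
  funext y
  have hδ : ∀ t : ℕ, ‖(t : ℚ_[p]) * (p : ℚ_[p]) ^ N‖ ≤ ‖(p : ℚ_[p]) ^ N‖ := fun t => by
    rw [norm_mul]
    exact mul_le_of_le_one_left (norm_nonneg _)
      (by exact_mod_cast Padic.norm_int_le_one (t : ℤ))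
  have earg : ∀ z : ℚ_[p], act β g (eh k β α j) 1 z = β ^ (-(det2 p g).valuation) *
      (if ‖g 1 1 - g 0 1 * z‖ ≤ ‖g 0 0 * z - g 1 0‖ ∧ g 0 0 * z - g 1 0 ≠ 0 then
        (β * (p : L) / α) ^ (g 0 0 * z - g 1 0).valuation *
          iotaL p L (g 0 0 * z - g 1 0) ^ (k - 2 - j) * iotaL p L (g 1 1 - g 0 1 * z) ^ j else 0) := by
    intro z
    rw [act_apply, show g 1 1 * 1 - g 0 1 * z = g 1 1 - g 0 1 * z by ring,
      show -(g 1 0) * 1 + g 0 0 * z = g 0 0 * z - g 1 0 by ring]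
    rfl
  simp only [earg, Pi.smul_apply, smul_eq_mul, theta]
  by_cases hy : ‖g 1 1 - g 0 1 * y‖ ≤ ‖g 0 0 * y - g 1 0‖ ∧ g 0 0 * y - g 1 0 ≠ 0
  · rw [if_pos hy]
    obtain ⟨h1, h2⟩ := affine_prod_degree_coeff (β ^ (-(det2 p g).valuation) *
      (β * (p : L) / α) ^ (g 0 0 * y - g 1 0).valuation)
      (iotaL p L (g 0 0) * (p : L) ^ N) (iotaL p L (g 0 0 * y - g 1 0))
      (iotaL p L (-(g 0 1)) * (p : L) ^ N) (iotaL p L (g 1 1 - g 0 1 * y)) hj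
    rw [topOp_eq h1, h2]
    · have e3 : ((p : L) ^ N) ^ (k - 2) = ((p : L) ^ N) ^ (k - 2 - j) * ((p : L) ^ N) ^ j := by
        rw [← pow_add]; congr 1; omega
      rw [mul_pow, mul_pow, e3]
      have h4 : ((p : L) ^ N) ^ (k - 2 - j) ≠ 0 := pow_ne_zero _ (pow_ne_zero _ hpL)
      have h5 : ((p : L) ^ N) ^ j ≠ 0 := pow_ne_zero _ (pow_ne_zero _ hpL)
      field_simp
    · intro t
      obtain ⟨h3, h4⟩ := hN y _ (hδ t) hy
      rw [if_pos h3, h4]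
      simp only [eval_mul, eval_C, eval_pow, eval_add, eval_X]
      have e1 : iotaL p L (g 0 0 * (y + t * (p : ℚ_[p]) ^ N) - g 1 0) =
          iotaL p L (g 0 0) * (p : L) ^ N * t + iotaL p L (g 0 0 * y - g 1 0) := by
        simp only [iotaL_add, iotaL_mul, iotaL_sub, iotaL_pow, iotaL_p, iotaL_natCast]; ring
      have e2 : iotaL p L (g 1 1 - g 0 1 * (y + t * (p : ℚ_[p]) ^ N)) =
          iotaL p L (-(g 0 1)) * (p : L) ^ N * t + iotaL p L (g 1 1 - g 0 1 * y) := by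
        simp only [iotaL_add, iotaL_mul, iotaL_sub, iotaL_pow, iotaL_p, iotaL_natCast, iotaL_neg]
        ring
      rw [e1, e2]; ring
  · rw [if_neg hy, mul_zero, topOp_apply]
    rw [Finset.sum_eq_zero, mul_zero]
    intro t _
    rw [if_neg, mul_zero, mul_zero]
    intro h3
    have := (hN (y + t * (p : ℚ_[p]) ^ N) (-(t * (p : ℚ_[p]) ^ N)) (by rw [norm_neg]; exact hδ t) h3).1
    rw [add_neg_cancel_right] at this
    exact hy this

/-- The image of `eh` under the intertwining operator. -/
def ihat (k : ℕ) (α β : L) (j : ℕ) : ℚ_[p] → ℚ_[p] → L := fun x y =>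
  if ‖x‖ ≤ ‖y‖ then
    if y = 0 then 0 else (1 - (p : L)⁻¹) / (1 - α / β) *
      ((α * (p : L) / β) ^ y.valuation * iotaL p L y ^ (k - 2 - j) * iotaL p L x ^ j)
  else (α * (p : L) / β) ^ x.valuation * iotaL p L y ^ (k - 2 - j) * iotaL p L x ^ j

/-- The functional computing the value at `(0, 1)` of the intertwining operator at level `N`. -/
def lamN (k : ℕ) (α β : L) (N : ℕ) : (ℚ_[p] → ℚ_[p] → L) →ₗ[L] L :=
  regInt ((1 - (p : L)⁻¹) / (1 - α / β)) N ∘ₗ topOp (k - 2) N ∘ₗ LinearMap.proj (1 : ℚ_[p])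

lemma HypS.one_sub_div_ne_zero (h : HypS p L k α β) : 1 - α / β ≠ 0 := by
  rw [sub_ne_zero, ne_comm, Ne, div_eq_one_iff_eq h.right_ne_zero]; exact h.ne

lemma HypS.eventually_lamN (h : HypS p L k α β) {g : Matrix (Fin 2) (Fin 2) ℚ_[p]}
    (hg : det2 p g ≠ 0) {j : ℕ} (hj : j ≤ k - 2) :
    ∀ᶠ N : ℕ in atTop, lamN k α β N (act β g (eh k β α j)) = act α g (ihat k α β j) 0 1 := by
  have hα := h.left_ne_zero
  have hβ := h.right_ne_zero
  filter_upwards [eventually_topOp_eh (α := α) (β := β) hg hj,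
    eventually_regInt_theta hα hβ (div_mul_cancel₀ _ h.one_sub_div_ne_zero) hg] with N h1 h2
  have e0 : lamN k α β N (act β g (eh k β α j)) = regInt ((1 - (p : L)⁻¹) / (1 - α / β)) N
      (topOp (k - 2) N (fun y => act β g (eh k β α j) 1 y)) := rfl
  have e1 : β ^ (-(det2 p g).valuation) * (β / α) ^ (det2 p g).valuation =
      α ^ (-(det2 p g).valuation) := by
    rw [div_zpow, zpow_neg, zpow_neg]
    have := zpow_ne_zero (det2 p g).valuation hβ
    field_simp
  rw [e0, h1, map_smul, h2, act_apply, mul_zero, mul_one, mul_zero, mul_one, zero_sub, zero_add,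
    smul_eq_mul, ihat, norm_neg, ← e1]
  by_cases hab : ‖g 0 1‖ ≤ ‖g 0 0‖
  · have ha : g 0 0 ≠ 0 := by
      intro h0
      have h1 : g 0 1 = 0 := by rw [h0, norm_zero] at hab; exact norm_le_zero_iff.1 hab
      exact hg (by rw [det2, h0, h1]; ring)
    rw [if_pos hab, if_pos hab, if_neg ha]; ring
  · have hb : g 0 1 ≠ 0 := norm_pos_iff.1 ((norm_nonneg _).trans_lt (not_le.1 hab))
    rw [if_neg hab, if_neg hab, valuation_eq_of_norm_eq (neg_ne_zero.2 hb) (norm_neg _)]; ring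

end Leading

section Intertwiner

set_option linter.unusedSectionVars false

variable {p : ℕ} [hp : Fact p.Prime]
variable {L : Type} [NontriviallyNormedField L] [NormedAlgebra ℚ_[p] L]
variable {k : ℕ} {α β : L}

/-- A family of prescribed values respecting all linear relations extends to a linear map. -/
lemma exists_linearMap_of_relations {K ι V W : Type*} [Field K] [AddCommGroup V] [Module K V]
    [AddCommGroup W] [Module K W] (v : ι → V) (w : ι → W)
    (h : ∀ c : ι →₀ K, Finsupp.linearCombination K v c = 0 → Finsupp.linearCombination K w c = 0) :
    ∃ J : V →ₗ[K] W, ∀ i, J (v i) = w i := by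
  set A := Finsupp.linearCombination K v
  set B := Finsupp.linearCombination K w
  obtain ⟨s, hs⟩ := A.rangeRestrict.exists_rightInverse_of_surjective A.range_rangeRestrict
  obtain ⟨J, hJ⟩ := (B ∘ₗ s).exists_extend
  refine ⟨J, fun i => ?_⟩
  have h1 : A (Finsupp.single i 1) = v i := by simp [A]
  have h2 : B (Finsupp.single i 1) = w i := by simp [B]
  have h3 : J (v i) = B (s (A.rangeRestrict (Finsupp.single i 1))) := by
    rw [← h1]
    exact LinearMap.congr_fun hJ (A.rangeRestrict (Finsupp.single i 1))
  have h4 : A (s (A.rangeRestrict (Finsupp.single i 1))) = A (Finsupp.single i 1) :=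
    congrArg Subtype.val (LinearMap.congr_fun hs (A.rangeRestrict (Finsupp.single i 1)))
  have h5 := h (s (A.rangeRestrict (Finsupp.single i 1)) - Finsupp.single i 1)
    (by rw [map_sub, h4, sub_self])
  rw [h3, ← h2]
  exact sub_eq_zero.1 ((map_sub B _ _).symm.trans h5)

lemma exists_det_one (X Y : ℚ_[p]) (h : ¬ (X = 0 ∧ Y = 0)) :
    ∃ m : Matrix (Fin 2) (Fin 2) ℚ_[p], det2 p m = 1 ∧ m 0 1 = -X ∧ m 0 0 = Y := by
  by_cases hY : Y = 0
  · have hX : X ≠ 0 := fun hX => h ⟨hX, hY⟩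
    exact ⟨!![0, -X; X⁻¹, 0], by simp [det2, hX], by simp, by simp [hY]⟩
  · exact ⟨!![Y, -X; 0, Y⁻¹], by simp [det2, hY], by simp, by simp⟩

lemma act_det_one_apply (α : L) {m : Matrix (Fin 2) (Fin 2) ℚ_[p]} {X Y : ℚ_[p]}
    (h1 : det2 p m = 1) (h2 : m 0 1 = -X) (h3 : m 0 0 = Y) (G : ℚ_[p] → ℚ_[p] → L) :
    act α m G 0 1 = G X Y := by
  rw [act_apply, h1, h2, h3]; simp

theorem HypS.exists_intertwiner (h : HypS p L k α β) :
    ∃ J : (ℚ_[p] → ℚ_[p] → L) →ₗ[L] (ℚ_[p] → ℚ_[p] → L),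
      ∀ g : Matrix (Fin 2) (Fin 2) ℚ_[p], det2 p g ≠ 0 → ∀ j ≤ k - 2,
        J (act β g (eh k β α j)) = act α g (ihat k α β j) := by
  let ι := {q : Matrix (Fin 2) (Fin 2) ℚ_[p] × ℕ // det2 p q.1 ≠ 0 ∧ q.2 ≤ k - 2}
  obtain ⟨J, hJ⟩ := exists_linearMap_of_relations (K := L) (ι := ι)
    (fun q => act β q.1.1 (eh k β α q.1.2)) (fun q => act α q.1.1 (ihat k α β q.1.2)) (by
    intro c hc
    rw [Finsupp.linearCombination_apply, Finsupp.sum] at hc ⊢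
    funext X Y
    have hsum : (∑ q ∈ c.support, c q • act α q.1.1 (ihat k α β q.1.2)) X Y =
        ∑ q ∈ c.support, c q * act α q.1.1 (ihat k α β q.1.2) X Y := by
      simp only [Finset.sum_apply, Pi.smul_apply, smul_eq_mul]
    rw [hsum, Pi.zero_apply, Pi.zero_apply]
    by_cases h0 : X = 0 ∧ Y = 0
    · refine Finset.sum_eq_zero fun q _ => ?_
      rw [act_apply, h0.1, h0.2]; simp [ihat]
    · obtain ⟨m, m1, m2, m3⟩ := exists_det_one X Y h0
      have hm : det2 p m ≠ 0 := by rw [m1]; exact one_ne_zero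
      have hev : ∀ᶠ N : ℕ in atTop, ∀ q ∈ c.support,
          lamN k α β N (act β m (act β q.1.1 (eh k β α q.1.2))) =
            act α q.1.1 (ihat k α β q.1.2) X Y := by
        rw [Filter.eventually_all_finset]
        intro q _
        filter_upwards [h.eventually_lamN (det2_mul_ne_zero hm q.2.1) q.2.2] with N hN
        rw [← act_mul h.right_ne_zero hm q.2.1, hN, act_mul h.left_ne_zero hm q.2.1,
          act_det_one_apply α m1 m2 m3]
      obtain ⟨N, hN⟩ := hev.exists
      have := congrArg (fun H => lamN k α β N (act β m H)) hc
      simp only [map_sum, map_smul, map_zero, smul_eq_mul] at this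
      rw [← this]
      exact Finset.sum_congr rfl fun q hq => by rw [hN q hq])
  exact ⟨J, fun g hg j hj => hJ ⟨(g, j), hg, hj⟩⟩

/-- The intertwining operator on homogeneous functions. -/
def interJ (k : ℕ) (α β : L) : (ℚ_[p] → ℚ_[p] → L) →ₗ[L] (ℚ_[p] → ℚ_[p] → L) :=
  if h : ∃ J : (ℚ_[p] → ℚ_[p] → L) →ₗ[L] (ℚ_[p] → ℚ_[p] → L),
      ∀ g : Matrix (Fin 2) (Fin 2) ℚ_[p], det2 p g ≠ 0 → ∀ j ≤ k - 2,
        J (act β g (eh k β α j)) = act α g (ihat k α β j) then h.choose else 0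

lemma HypS.interJ_act_eh (h : HypS p L k α β) {g : Matrix (Fin 2) (Fin 2) ℚ_[p]}
    (hg : det2 p g ≠ 0) {j : ℕ} (hj : j ≤ k - 2) :
    interJ k α β (act β g (eh k β α j)) = act α g (ihat k α β j) := by
  rw [interJ, dif_pos h.exists_intertwiner]
  exact h.exists_intertwiner.choose_spec g hg j hj

lemma HypS.interJ_eh (h : HypS p L k α β) {j : ℕ} (hj : j ≤ k - 2) :
    interJ k α β (eh k β α j) = (ihat k α β j : ℚ_[p] → ℚ_[p] → L) := by
  have := h.interJ_act_eh isK_one.det_ne_zero hj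
  rwa [act_one, act_one] at this

lemma HypS.ihat_eq (h : HypS p L k α β) {j : ℕ} (hj : j ≤ k - 2) :
    (ihat k α β j : ℚ_[p] → ℚ_[p] → L) = ((1 - (p : L)⁻¹) / (1 - α / β)) • eh k α β j +
      (β * ((p : L) ^ (j + 1))⁻¹) • act α (sw * Dm 1) (eh k α β (k - 2 - j)) := by
  have hα := h.left_ne_zero
  have hβ := h.right_ne_zero
  have hpL : (p : L) ≠ 0 := prime_cast_ne_zero' p
  have hχ := h.chi_ne_zero
  funext x y
  simp only [Pi.add_apply, Pi.smul_apply, smul_eq_mul]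
  rw [act_mul hα det2_sw_ne_zero (det2_Dm_ne_zero 1), act_sw, act_Dm, ihat, eh, eh]
  simp only [pow_one, norm_lt_iff_le_p_mul]
  rw [show k - 2 - (k - 2 - j) = j by omega]
  have hp0 : (p : ℚ_[p]) ≠ 0 := prime_cast_ne_zero
  by_cases hxy : ‖x‖ ≤ ‖y‖
  · rw [if_pos hxy, if_neg (c := (‖y‖ < ‖x‖ ∨ _) ∧ _)]
    · by_cases hy : y = 0
      · rw [if_pos hy, if_neg (by tauto)]; ring
      · rw [if_neg hy, if_pos ⟨hxy, hy⟩]; ring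
    · rintro ⟨h1 | h1, h2⟩
      · exact absurd h1 (not_lt.2 hxy)
      · exact h2 (by rw [h1.1, mul_zero])
  · have hx : x ≠ 0 := norm_pos_iff.1 ((norm_nonneg _).trans_lt (not_le.1 hxy))
    rw [if_neg hxy, if_neg (by tauto), if_pos ⟨Or.inl (not_le.1 hxy), mul_ne_zero hp0 hx⟩,
      Padic.valuation_mul hp0 hx, Padic.valuation_p, zpow_add₀ hχ, zpow_one, iotaL_mul, iotaL_p]
    have := zpow_ne_zero x.valuation hχ
    simp only [Nat.cast_one, zpow_neg, zpow_one, mul_pow, pow_succ, mul_zero, zero_add]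
    field_simp

end Intertwiner

section IntertwinerSpan

set_option linter.unusedSectionVars false

variable {p : ℕ} [hp : Fact p.Prime]
variable {L : Type} [NontriviallyNormedField L] [NormedAlgebra ℚ_[p] L]
variable {k : ℕ} {α β : L}

lemma HypS.SS_induction (h : HypS p L k α β) {P : (ℚ_[p] → ℚ_[p] → L) → Prop}
    (mem : ∀ g : Matrix (Fin 2) (Fin 2) ℚ_[p], det2 p g ≠ 0 → ∀ i ≤ k - 2,
      P (act α g (eh k α β i)))
    (zero : P 0) (hadd : ∀ F G, P F → P G → P (F + G)) (smul : ∀ (c : L) F, P F → P (c • F))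
    {F : ℚ_[p] → ℚ_[p] → L} (hF : F ∈ SS p k α β) : P F := by
  induction hF using Submodule.span_induction with
  | mem a ha =>
    obtain ⟨g, n, i, hg, hi, rfl⟩ := ha
    rw [← act_mul h.left_ne_zero hg.det_ne_zero (det2_Dm_ne_zero n)]
    exact mem _ (det2_mul_ne_zero hg.det_ne_zero (det2_Dm_ne_zero n)) i hi
  | zero => exact zero
  | add F G _ _ hF hG => exact hadd F G hF hG
  | smul c F _ hF => exact smul c F hF

lemma sw_mul_Dm_sq : ((sw * Dm 1) * (sw * Dm 1) : Matrix (Fin 2) (Fin 2) ℚ_[p]) =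
    !![(p : ℚ_[p]), 0; 0, p] := by
  ext i j; fin_cases i <;> fin_cases j <;> simp [Dm, sw]

/-- The scalar by which the composite of the two intertwining operators acts. -/
def interConst (p : ℕ) (α β : L) : L :=
  ((1 - (p : L)⁻¹) / (1 - α / β)) * ((1 - (p : L)⁻¹) / (1 - β / α)) + (p : L)⁻¹

lemma interConst_comm (α β : L) : interConst p α β = interConst p β α := by
  rw [interConst, interConst, mul_comm]

lemma HypS.interConst_ne_zero (h : HypS p L k α β) (h1 : α ≠ p * β) (h2 : β ≠ p * α) :
    interConst p α β ≠ 0 := by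
  have hα := h.left_ne_zero
  have hβ := h.right_ne_zero
  have hpL : (p : L) ≠ 0 := prime_cast_ne_zero' p
  have e1 : β - α ≠ 0 := sub_ne_zero.2 h.ne.symm
  have e2 : α - β ≠ 0 := sub_ne_zero.2 h.ne
  have key : interConst p α β * ((p : L) ^ 2 * (α - β) ^ 2) = -((α - p * β) * (β - p * α)) := by
    have e3 : 1 - α / β ≠ 0 := h.one_sub_div_ne_zero
    have e4 : 1 - β / α ≠ 0 := h.symm.one_sub_div_ne_zero
    have e5 : (1 - (p : L)⁻¹) / (1 - α / β) = (p - 1) * β / (p * (β - α)) := by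
      field_simp
    have e6 : (1 - (p : L)⁻¹) / (1 - β / α) = (p - 1) * α / (p * (α - β)) := by
      field_simp
    rw [interConst, e5, e6, ← neg_sub α β]
    field_simp
    ring
  intro h0
  rw [h0, zero_mul, eq_comm, neg_eq_zero, mul_eq_zero, sub_eq_zero, sub_eq_zero] at key
  tauto

lemma HypS.interJ_ihat (h : HypS p L k α β) {j : ℕ} (hj : j ≤ k - 2) :
    interJ k β α (ihat k α β j) = interConst p α β • (eh k β α j : ℚ_[p] → ℚ_[p] → L) := by
  have hα := h.left_ne_zero
  have hβ := h.right_ne_zero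
  have hpL : (p : L) ≠ 0 := prime_cast_ne_zero' p
  have hS : det2 p (sw * Dm 1) ≠ 0 := det2_mul_ne_zero det2_sw_ne_zero (det2_Dm_ne_zero 1)
  have hp0 : (p : ℚ_[p]) ≠ 0 := prime_cast_ne_zero
  have hsc : act β (sw * Dm 1) (act β (sw * Dm 1) (eh k β α j : ℚ_[p] → ℚ_[p] → L)) =
      ((p : L) ^ (k - 2 + 1) / (α * β)) • (eh k β α j : ℚ_[p] → ℚ_[p] → L) := by
    rw [← act_mul hβ hS hS, sw_mul_Dm_sq, (h.symm.eh_homog hj).act_scalar hp0,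
      Padic.valuation_mul hp0 hp0, Padic.valuation_p, psi, Padic.valuation_p, iotaL_p]
    congr 1
    rw [show -(1 + 1 : ℤ) = -(2 : ℕ) by norm_num, zpow_neg, zpow_natCast]
    field_simp
    ring
  have hcross : ((1 - (p : L)⁻¹) / (1 - α / β)) * α + ((1 - (p : L)⁻¹) / (1 - β / α)) * β = 0 := by
    have e1 : β - α ≠ 0 := sub_ne_zero.2 h.ne.symm
    have e2 : α - β ≠ 0 := sub_ne_zero.2 h.ne
    have e3 : 1 - α / β ≠ 0 := h.one_sub_div_ne_zero
    have e4 : 1 - β / α ≠ 0 := h.symm.one_sub_div_ne_zero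
    have e5 : (1 - (p : L)⁻¹) / (1 - α / β) = (p - 1) * β / (p * (β - α)) := by
      field_simp
    have e6 : (1 - (p : L)⁻¹) / (1 - β / α) = (p - 1) * α / (p * (α - β)) := by
      field_simp
    rw [e5, e6, ← neg_sub α β]
    field_simp
    ring
  rw [h.ihat_eq hj, map_add, map_smul, map_smul, h.symm.interJ_eh hj,
    h.symm.interJ_act_eh hS (Nat.sub_le _ _), h.symm.ihat_eq hj,
    h.symm.ihat_eq (Nat.sub_le (k - 2) j), map_add, map_smul, map_smul,
    show k - 2 - (k - 2 - j) = j by omega, hsc]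
  simp only [smul_add, smul_smul]
  set E := (eh k β α j : ℚ_[p] → ℚ_[p] → L)
  set G := act β (sw * Dm 1) (eh k β α (k - 2 - j) : ℚ_[p] → ℚ_[p] → L)
  set κ := (1 - (p : L)⁻¹) / (1 - α / β)
  set κ' := (1 - (p : L)⁻¹) / (1 - β / α)
  have e1 : β * ((p : L) ^ (j + 1))⁻¹ * (α * ((p : L) ^ (k - 2 - j + 1))⁻¹ *
      ((p : L) ^ (k - 2 + 1) / (α * β))) = (p : L)⁻¹ := by
    rw [show k - 2 + 1 = (k - 2 - j) + j + 1 by omega]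
    simp only [pow_succ, pow_add]
    field_simp
  have e2 : κ * (α * ((p : L) ^ (j + 1))⁻¹) = - (β * ((p : L) ^ (j + 1))⁻¹ * κ') := by
    linear_combination ((p : L) ^ (j + 1))⁻¹ * hcross
  rw [e1, e2, interConst]
  module

lemma HypS.interJ_interJ (h : HypS p L k α β) {F : ℚ_[p] → ℚ_[p] → L} (hF : F ∈ SS p k β α) :
    interJ k β α (interJ k α β F) = interConst p α β • F := by
  have hS : det2 p (sw * Dm 1) ≠ 0 := det2_mul_ne_zero det2_sw_ne_zero (det2_Dm_ne_zero 1)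
  refine h.symm.SS_induction (P := fun F => interJ k β α (interJ k α β F) = interConst p α β • F)
    (fun g hg i hi => ?_) (by simp) (fun F G hF hG => by rw [map_add, map_add, hF, hG, smul_add])
    (fun c F hF => by rw [map_smul, map_smul, hF, smul_comm]) hF
  have key : interJ k β α (act α g (ihat k α β i)) =
      act β g (interJ k β α (ihat k α β i : ℚ_[p] → ℚ_[p] → L)) := by
    rw [h.ihat_eq hi]
    simp only [map_add, map_smul]
    rw [h.symm.interJ_act_eh hg hi, h.symm.interJ_eh hi,
      h.symm.interJ_act_eh hS (Nat.sub_le _ _), ← act_mul h.left_ne_zero hg hS,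
      h.symm.interJ_act_eh (det2_mul_ne_zero hg hS) (Nat.sub_le _ _),
      act_mul h.right_ne_zero hg hS]
  rw [h.interJ_act_eh hg hi, key, h.interJ_ihat hi, map_smul]

lemma HypS.interJ_act (h : HypS p L k α β) {g : Matrix (Fin 2) (Fin 2) ℚ_[p]}
    (hg : det2 p g ≠ 0) {F : ℚ_[p] → ℚ_[p] → L} (hF : F ∈ SS p k β α) :
    interJ k α β (act β g F) = act α g (interJ k α β F) := by
  refine h.symm.SS_induction (P := fun F => interJ k α β (act β g F) = act α g (interJ k α β F))
    (fun m hm i hi => ?_) (by simp) (fun F G hF hG => by simp only [map_add, hF, hG])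
    (fun c F hF => by simp only [map_smul, hF]) hF
  rw [← act_mul h.right_ne_zero hg hm, h.interJ_act_eh (det2_mul_ne_zero hg hm) hi,
    h.interJ_act_eh hm hi, act_mul h.left_ne_zero hg hm]

variable [IsUltrametricDist L] [CompleteSpace L] [Fact (0 < valL p L α)]

lemma HypS.act_eh_mem_SS (h : HypS p L k α β) {g : Matrix (Fin 2) (Fin 2) ℚ_[p]}
    (hg : det2 p g ≠ 0) {i : ℕ} (hi : i ≤ k - 2) : act α g (eh k α β i) ∈ SS p k α β := by
  obtain ⟨A, h1, h2⟩ := exists_pow_bound g hg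
  obtain ⟨C, -, hC⟩ := h.exists_lift_atom A
  obtain ⟨u, hu, -, H, a1, a2⟩ := hC g h1 h2 0 i hi
  have e : act α (Dm 0) (eh k α β i) = (eh k α β i : ℚ_[p] → ℚ_[p] → L) := by
    funext x y; rw [act_Dm]; simp
  rw [e] at hu
  rw [← hu]
  exact h.mem_DD_of_LP a1 a2

lemma HypS.act_mem_SS (h : HypS p L k α β) {g : Matrix (Fin 2) (Fin 2) ℚ_[p]}
    (hg : det2 p g ≠ 0) {F : ℚ_[p] → ℚ_[p] → L} (hF : F ∈ SS p k α β) :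
    act α g F ∈ SS p k α β := by
  refine h.SS_induction (P := fun F => act α g F ∈ SS p k α β)
    (fun m hm i hi => ?_) (by simp) (fun F G hF hG => by rw [map_add]; exact add_mem hF hG)
    (fun c F hF => by rw [map_smul]; exact Submodule.smul_mem _ c hF) hF
  rw [← act_mul h.left_ne_zero hg hm]
  exact h.act_eh_mem_SS (det2_mul_ne_zero hg hm) hi

lemma HypS.eh_mem_SS (h : HypS p L k α β) {i : ℕ} (hi : i ≤ k - 2) :
    (eh k α β i : ℚ_[p] → ℚ_[p] → L) ∈ SS p k α β := by
  have := h.act_eh_mem_SS isK_one.det_ne_zero hi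
  rwa [act_one] at this

lemma HypS.interJ_mem_SS (h : HypS p L k α β) {F : ℚ_[p] → ℚ_[p] → L} (hF : F ∈ SS p k β α) :
    interJ k α β F ∈ SS p k α β := by
  have hS : det2 p (sw * Dm 1) ≠ 0 := det2_mul_ne_zero det2_sw_ne_zero (det2_Dm_ne_zero 1)
  refine h.symm.SS_induction (P := fun F => interJ k α β F ∈ SS p k α β)
    (fun m hm i hi => ?_) (by simp) (fun F G hF hG => by rw [map_add]; exact add_mem hF hG)
    (fun c F hF => by rw [map_smul]; exact Submodule.smul_mem _ c hF) hF
  rw [h.interJ_act_eh hm hi, h.ihat_eq hi]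
  exact h.act_mem_SS hm (add_mem (Submodule.smul_mem _ _ (h.eh_mem_SS hi))
    (Submodule.smul_mem _ _ (h.act_eh_mem_SS hS (Nat.sub_le _ _))))

end IntertwinerSpan

section IntertwinerExtension

set_option linter.unusedSectionVars false

variable {p : ℕ} [hp : Fact p.Prime]
variable {L : Type} [NontriviallyNormedField L] [NormedAlgebra ℚ_[p] L]
variable [IsUltrametricDist L] [CompleteSpace L]
variable {k : ℕ} {α β : L} [Fact (0 < valL p L α)]

lemma exists_descend {E : Type} [NormedAddCommGroup E] [NormedSpace L E]
    (T : BX p L α →L[L] E) (hT : ∀ u ∈ Lsub p k α β, T u = 0) :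
    ∃ T' : QX p k α β →L[L] E, ∀ u, T' (qmk k α β u) = T u := by
  let T₀ : QX p k α β →ₗ[L] E := (Lsub p k α β).liftQ T.toLinearMap hT
  have h0 : ∀ u, T₀ (qmk k α β u) = T u := fun u => (Lsub p k α β).liftQ_apply T.toLinearMap u
  refine ⟨T₀.mkContinuous ‖T‖ fun x => ?_, h0⟩
  refine le_of_forall_pos_le_add fun ε hε => ?_
  obtain ⟨u, rfl, hu⟩ := exists_qmk_lt x (show 0 < ε / (‖T‖ + 1) by positivity)
  rw [h0]
  refine (T.le_opNorm u).trans ?_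
  have : ‖T‖ * (ε / (‖T‖ + 1)) ≤ ε := by
    rw [mul_div_assoc', div_le_iff₀ (by positivity)]; nlinarith [norm_nonneg T]
  nlinarith [mul_le_mul_of_nonneg_left hu.le (norm_nonneg T)]

lemma HypS.exists_rhoQ (h : HypS p L k α β) {g : Matrix (Fin 2) (Fin 2) ℚ_[p]}
    (hg : det2 p g ≠ 0) : ∃ T : QX p k α β →L[L] QX p k α β,
      ∀ u, T (qmk k α β u) = qmk k α β (rho k α β g u) :=
  exists_descend ((qmk k α β).comp (rho k α β g)) fun _ hu =>
    qmk_eq_zero.2 (h.rho_mem_Lsub hg hu)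

lemma QB.smul_norm {H : ℚ_[p] → ℚ_[p] → L} {C : ℝ} (hH : QB p k α β H C) (c : L) :
    QB p k α β (c • H) (‖c‖ * C) := by
  obtain ⟨u, hu, hn⟩ := hH
  refine ⟨c • u, by rw [map_smul, hu], ?_⟩
  rw [map_smul, norm_smul]
  gcongr

lemma HypS.exists_QB_ihat (h : HypS p L k α β) : ∃ C : ℝ, 0 ≤ C ∧
    ∀ g : Matrix (Fin 2) (Fin 2) ℚ_[p], det2 p g ≠ 0 → ∀ j ≤ k - 2,
      QB p k α β (act α g (ihat k α β j)) C := by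
  obtain ⟨C, hC, hb⟩ := h.exists_QB_eh
  have hS : det2 p (sw * Dm 1) ≠ 0 := det2_mul_ne_zero det2_sw_ne_zero (det2_Dm_ne_zero 1)
  set κ := (1 - (p : L)⁻¹) / (1 - α / β) with hκ
  set D : ℝ := ∑ j ∈ Finset.range (k - 2 + 1), ‖β * ((p : L) ^ (j + 1))⁻¹‖
  have hD : 0 ≤ D := Finset.sum_nonneg fun _ _ => norm_nonneg _
  refine ⟨(‖κ‖ + D) * C, by positivity, fun g hg j hj => ?_⟩
  rw [h.ihat_eq hj, map_add, map_smul, map_smul, ← act_mul h.left_ne_zero hg hS]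
  refine QB.add ?_ ?_
  · refine ((hb g hg j hj).smul_norm _).mono ?_
    gcongr
    exact le_add_of_nonneg_right hD
  · refine ((hb _ (det2_mul_ne_zero hg hS) _ (Nat.sub_le _ _)).smul_norm _).mono ?_
    gcongr
    refine le_add_of_nonneg_of_le (norm_nonneg _) ?_
    exact Finset.single_le_sum (f := fun j => ‖β * ((p : L) ^ (j + 1))⁻¹‖)
      (fun _ _ => norm_nonneg _) (Finset.mem_range.2 (by omega))

variable [Fact (0 < valL p L β)]

/-- The intertwining operator extends continuously to the charts. -/
lemma HypS.exists_interB (h : HypS p L k α β) : ∃ T : BX p L β →L[L] QX p k α β,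
    ∀ (u : BX p L β) (v : BX p L α), lift k β α u ∈ SS p k β α →
      lift k α β v = interJ k α β (lift k β α u) → T u = qmk k α β v := by
  obtain ⟨s, hs⟩ := (lift k α β : BX p L α →ₗ[L] _).exists_leftInverse_of_injective
    (LinearMap.ker_eq_bot.2 (lift_injective k α β))
  have hs' : ∀ v : BX p L α, s (lift k α β v) = v := fun v => LinearMap.congr_fun hs v
  let T : DD p k β α →ₗ[L] QX p k α β :=
    (qmk k α β).toLinearMap ∘ₗ s ∘ₗ interJ k α β ∘ₗ lift k β α ∘ₗ (DD p k β α).subtype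
  have hT : ∀ (u : DD p k β α) (v : BX p L α),
      lift k α β v = interJ k α β (lift k β α u.1) → T u = qmk k α β v := by
    intro u v hv
    change qmk k α β (s (interJ k α β (lift k β α u.1))) = _
    rw [← hv, hs']
  obtain ⟨C, hC, hb⟩ := h.exists_QB_ihat
  obtain ⟨C', -, hext⟩ := h.symm.exists_extension
  obtain ⟨T', hT', -⟩ := hext (QX p k α β) T C (by
    rintro u ⟨g, n, i, hg, hi, hu⟩
    have hgn := det2_mul_ne_zero hg.det_ne_zero (det2_Dm_ne_zero n)
    obtain ⟨v, hv, hn⟩ := hb (g * Dm n) hgn i hi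
    rw [hT u v]
    · exact hn
    · rw [hv, ← h.interJ_act_eh hgn hi, hu, act_mul h.right_ne_zero hg.det_ne_zero
        (det2_Dm_ne_zero n)])
  exact ⟨T', fun u v hu hv => (hT' ⟨u, hu⟩).trans (hT ⟨u, hu⟩ v hv)⟩

lemma HypS.exists_lift_interJ (h : HypS p L k α β) {F : ℚ_[p] → ℚ_[p] → L}
    (hF : F ∈ SS p k β α) : ∃ v : BX p L α, lift k α β v = interJ k α β F := by
  obtain ⟨v, hv, -⟩ := h.exists_LP_of_mem_SS (h.interJ_mem_SS hF)
  exact ⟨v, hv⟩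

/-- The intertwining operator extends to the completed quotients. -/
theorem HypS.exists_interQ (h : HypS p L k α β) : ∃ T : QX p k β α →L[L] QX p k α β,
    (∀ (u : BX p L β) (v : BX p L α), lift k β α u ∈ SS p k β α →
      lift k α β v = interJ k α β (lift k β α u) → T (qmk k β α u) = qmk k α β v) ∧
    ∀ g : Matrix (Fin 2) (Fin 2) ℚ_[p], det2 p g ≠ 0 → ∀ (u : BX p L β) (v : BX p L α),
      T (qmk k β α u) = qmk k α β v →
        T (qmk k β α (rho k β α g u)) = qmk k α β (rho k α β g v) := by
  obtain ⟨T, hT⟩ := h.exists_interB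
  have hequiv : ∀ g : Matrix (Fin 2) (Fin 2) ℚ_[p], det2 p g ≠ 0 →
      ∀ (u : BX p L β) (v : BX p L α), T u = qmk k α β v →
        T (rho k β α g u) = qmk k α β (rho k α β g v) := by
    intro g hg u v huv
    obtain ⟨R, hR⟩ := h.exists_rhoQ hg
    have : T.comp (rho k β α g) = R.comp T := by
      refine h.symm.clm_ext fun w hw => ?_
      have hw' : lift k β α w ∈ SS p k β α := Submodule.subset_span hw
      obtain ⟨v, hv⟩ := h.exists_lift_interJ hw'
      change T (rho k β α g w) = R (T w)
      rw [hT w v hw' hv, hR]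
      refine hT _ _ ?_ ?_
      · rw [h.symm.lift_rho hg]; exact h.symm.act_mem_SS hg hw'
      · rw [h.symm.lift_rho hg, h.lift_rho hg, h.interJ_act hg hw', hv]
    have := congrArg (fun S : BX p L β →L[L] QX p k α β => S u) this
    change T (rho k β α g u) = R (T u) at this
    rw [this, huv, hR]
  have hmon : ∀ (j : ℕ) (u : BX p L β), (j : ℝ) < valL p L β → lift k β α u = mon k β α j →
      T u = 0 := by
    intro j u hj hu
    have hβ := h.right_ne_zero
    have hp1 : (1 : ℝ) < p := by exact_mod_cast hp.out.one_lt
    obtain ⟨C, hC, hb⟩ := h.exists_unitary_bound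
    obtain ⟨v, hv⟩ := qmk_surjective (T u)
    have hq : 1 < ‖β⁻¹ * (p : L) ^ j‖ := by
      rw [norm_mul, norm_inv, norm_pow, norm_p_L (p := p), norm_eq_rpow_valL (p := p) hβ,
        ← Real.rpow_neg (by positivity), neg_neg, inv_pow, ← Real.rpow_natCast,
        ← Real.rpow_neg (by positivity), ← Real.rpow_add (by positivity)]
      exact Real.one_lt_rpow hp1 (by linarith)
    by_contra hne
    have hw : 0 < ‖T u‖ := norm_pos_iff.2 hne
    obtain ⟨n, hn⟩ := pow_unbounded_of_one_lt C hq
    have hdet : det2 p !![1, 0; 0, (p : ℚ_[p]) ^ n] = (p : ℚ_[p]) ^ n := by simp [det2]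
    have hg : det2 p !![1, 0; 0, (p : ℚ_[p]) ^ n] ≠ 0 := by
      rw [hdet]; exact pow_ne_zero _ prime_cast_ne_zero
    have e1 : rho k β α !![1, 0; 0, (p : ℚ_[p]) ^ n] u = (β⁻¹ * (p : L) ^ j) ^ n • u := by
      apply lift_injective k β α
      rw [h.symm.lift_rho hg, map_smul, hu]
      funext x y
      rw [act_apply, hdet, valuation_p_pow']
      simp only [mon, Matrix.of_apply, Matrix.cons_val', Matrix.cons_val_zero, Matrix.cons_val_one,
        Matrix.cons_val_fin_one, Pi.smul_apply, smul_eq_mul, zero_mul, sub_zero, neg_zero,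
        zero_add, one_mul, iotaL_mul, iotaL_pow, iotaL_p]
      split_ifs
      · simp
      · rw [zpow_neg, zpow_natCast]; ring
    have e2 := hequiv _ hg u v hv.symm
    rw [e1, map_smul] at e2
    have e3 := hb _ hg v
    rw [← e2, hv, norm_smul, norm_pow] at e3
    nlinarith
  have hker : ∀ u ∈ Lsub p k β α, T u = 0 := by
    have hle : Lsub p k β α ≤ LinearMap.ker T.toLinearMap := by
      refine Submodule.topologicalClosure_minimal _ (Submodule.span_le.2 ?_) T.isClosed_ker
      rintro u ⟨j, g, hj, hg, hu⟩
      obtain ⟨w, hw⟩ := h.symm.exists_lift_mon hj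
      have e : u = rho k β α g w := lift_injective k β α (by rw [h.symm.lift_rho hg, hw, hu])
      have := hequiv g hg w 0 (by rw [hmon j w hj hw, map_zero])
      rw [map_zero, map_zero] at this
      change T u = 0
      rw [e, this]
    exact fun u hu => hle hu
  obtain ⟨T', hT'⟩ := exists_descend T hker
  refine ⟨T', fun u v hu hv => ?_, fun g hg u v huv => ?_⟩
  · rw [hT', hT u v hu hv]
  · rw [hT'] at huv ⊢
    exact hequiv g hg u v huv

lemma HypS.interQ_comp (h : HypS p L k α β) {T : QX p k β α →L[L] QX p k α β}
    {T' : QX p k α β →L[L] QX p k β α}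
    (hT : ∀ (u : BX p L β) (v : BX p L α), lift k β α u ∈ SS p k β α →
      lift k α β v = interJ k α β (lift k β α u) → T (qmk k β α u) = qmk k α β v)
    (hT' : ∀ (u : BX p L α) (v : BX p L β), lift k α β u ∈ SS p k α β →
      lift k β α v = interJ k β α (lift k α β u) → T' (qmk k α β u) = qmk k β α v)
    (x : QX p k β α) : T' (T x) = interConst p α β • x := by
  have key : T'.comp (T.comp (qmk k β α)) = interConst p α β • qmk k β α := by
    refine h.symm.clm_ext fun w hw => ?_
    have hw' : lift k β α w ∈ SS p k β α := Submodule.subset_span hw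
    obtain ⟨v, hv⟩ := h.exists_lift_interJ hw'
    change T' (T (qmk k β α w)) = interConst p α β • qmk k β α w
    rw [hT w v hw' hv, ← map_smul]
    refine hT' _ _ (by rw [hv]; exact h.interJ_mem_SS hw') ?_
    rw [hv, h.interJ_interJ hw', map_smul]
  obtain ⟨u, rfl⟩ := qmk_surjective x
  exact congrArg (fun S : BX p L β →L[L] QX p k β α => S u) key

end IntertwinerExtension

section Transfer

set_option linter.unusedSectionVars false

variable {p : ℕ} [hp : Fact p.Prime]
variable {L : Type} [NontriviallyNormedField L] [NormedAlgebra ℚ_[p] L]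
variable [IsUltrametricDist L] [CompleteSpace L]
variable {k : ℕ} {α β : L} [hα0 : Fact (0 < valL p L α)]

/-- The function on `ℚ_p` attached to a pair of charts. -/
def dehom (k : ℕ) (α β : L) : BX p L α →ₗ[L] (ℚ_[p] → L) where
  toFun u := fun z => lift k α β u z 1
  map_add' u v := by ext z; simp
  map_smul' c u := by ext z; simp

lemma dehom_apply (u : BX p L α) (z : ℚ_[p]) : dehom k α β u z = lift k α β u z 1 := rfl

lemma HypS.lift_eq_psi_mul (h : HypS p L k α β) (u : BX p L α) (x : ℚ_[p]) {y : ℚ_[p]}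
    (hy : y ≠ 0) : lift k α β u x y = psi k α β y * dehom k α β u (x / y) := by
  rw [dehom_apply, ← (h.lift_homog u).1 y hy, mul_div_cancel₀ _ hy, mul_one]

lemma HypS.lift_zero_right (h : HypS p L k α β) (u : BX p L α) {x : ℚ_[p]}
    (hx : x ≠ 0) : lift k α β u x 0 = psi k α β x * u.2.fn 0 := by
  have e := lift_chart₂ k α β u 0
  rw [PadicInt.coe_zero] at e
  rw [← e, ← (h.lift_homog u).1 x hx, mul_one, mul_zero]

lemma HypS.Ext2_dehom (h : HypS p L k α β) (u : BX p L α) :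
    Ext2 p L k α β (dehom k α β u) u.2.fn := by
  refine ⟨u.2.isCr, fun z hz => ?_⟩
  have hz' : (z : ℚ_[p]) ≠ 0 := by
    intro h0; exact hz (PadicInt.ext (by rw [h0, PadicInt.coe_zero]))
  rw [← lift_chart₂ k α β, h.lift_eq_psi_mul u 1 hz', psi, one_div]

lemma continuous_eq_of_ne_zero {f g : ℤ_[p] → L} (hf : Continuous f) (hg : Continuous g)
    (hfg : ∀ z : ℤ_[p], z ≠ 0 → f z = g z) : f = g := by
  funext z
  by_cases hz : z = 0
  · subst hz
    have hp0 : (p : ℤ_[p]) ≠ 0 := by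
      exact_mod_cast hp.out.ne_zero
    have ht : Tendsto (fun n : ℕ => (p : ℤ_[p]) ^ n) atTop (𝓝 0) :=
      tendsto_pow_atTop_nhds_zero_of_norm_lt_one (by
        rw [PadicInt.norm_p]; exact inv_lt_one_of_one_lt₀ (by exact_mod_cast hp.out.one_lt))
    refine tendsto_nhds_unique ((hf.tendsto 0).comp ht) ?_
    refine ((hg.tendsto 0).comp ht).congr fun n => ?_
    exact (hfg _ (pow_ne_zero n hp0)).symm
  · exact hfg z hz

lemma HypS.ext2_dehom (h : HypS p L k α β) (u : BX p L α) :
    ext2 p L k α β (dehom k α β u) = u.2.fn := by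
  have hex : ∃ g, Ext2 p L k α β (dehom k α β u) g := ⟨_, h.Ext2_dehom u⟩
  rw [ext2, dif_pos hex]
  obtain ⟨h1, h2⟩ := hex.choose_spec
  obtain ⟨h3, h4⟩ := h.Ext2_dehom u
  exact continuous_eq_of_ne_zero (h1.continuous hα0.out) (h3.continuous hα0.out)
    fun z hz => (h2 z hz).trans (h4 z hz).symm

lemma dehom_chart₁ (u : BX p L α) :
    (fun z : ℤ_[p] => dehom k α β u ((p : ℚ_[p]) * (z : ℚ_[p]))) = u.1.fn :=
  funext fun z => lift_chart₁ k α β u z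

lemma HypS.memB_dehom (h : HypS p L k α β) (u : BX p L α) : MemB p L k α β (dehom k α β u) :=
  ⟨by rw [dehom_chart₁]; exact u.1.isCr, _, h.Ext2_dehom u⟩

lemma HypS.exists_dehom_eq (h : HypS p L k α β) {f : ℚ_[p] → L} (hf : MemB p L k α β f) :
    ∃ u : BX p L α, dehom k α β u = f := by
  obtain ⟨h1, g, h2, h3⟩ := hf
  refine ⟨(CrSp.mk _ h1, CrSp.mk g h2), ?_⟩
  funext z
  rw [dehom_apply, lift_apply]
  have hp0 : (p : ℚ_[p]) ≠ 0 := prime_cast_ne_zero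
  split_ifs with hz hz0
  · rw [psi_one, one_mul, CrSp.fn_mk, coe_toZ (norm_div_le_one_of_lt hz), mul_one,
      mul_div_cancel₀ _ hp0]
  · rw [hz0] at hz; simp at hz
  · have hz1 : ‖1 / z‖ ≤ 1 := by
      rw [norm_div, norm_one] at *
      exact (div_le_one (norm_pos_iff.2 hz0)).2 (not_lt.1 hz)
    have hne : toZ (1 / z) ≠ 0 := by
      intro h0
      have := coe_toZ hz1
      rw [h0, PadicInt.coe_zero] at this
      exact one_div_ne_zero hz0 this.symm
    rw [CrSp.fn_mk, h3 _ hne, coe_toZ hz1]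
    have e := h.psi_mul hz0 (one_div_ne_zero hz0)
    rw [mul_one_div_cancel hz0, psi_one] at e
    change psi k α β z * (psi k α β (1 / z) * f (1 / z)⁻¹) = f z
    rw [← mul_assoc, ← e, one_mul, one_div, inv_inv]

lemma HypS.dehom_injective (h : HypS p L k α β) :
    Function.Injective (dehom k α β : BX p L α → _) := by
  intro u v huv
  refine Prod.ext (CrSp.fn_injective ?_) (CrSp.fn_injective ?_)
  · rw [← dehom_chart₁ (k := k) (β := β), huv, dehom_chart₁]
  · rw [← h.ext2_dehom, huv, h.ext2_dehom]

lemma HypS.bNorm_dehom (h : HypS p L k α β) (u : BX p L α) :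
    bNorm p L k α β (dehom k α β u) = ‖u‖ := by
  rw [bNorm, dehom_chart₁, h.ext2_dehom, Prod.norm_def, CrSp.norm_def, CrSp.norm_def]

lemma HypS.gAct_dehom (h : HypS p L k α β) {g : Matrix (Fin 2) (Fin 2) ℚ_[p]}
    (hg : det2 p g ≠ 0) (u : BX p L α) :
    gAct p L k α β g (dehom k α β u) = dehom k α β (rho k α β g u) := by
  funext z
  rw [dehom_apply, h.lift_rho hg, act_apply, mul_one, mul_one, gAct]
  split_ifs with hz
  · have hc : g 1 0 ≠ 0 := by
      intro hc
      rw [hc, neg_zero, zero_mul, zero_add] at hz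
      exact hg (by rw [det2, hz, hc]; ring)
    have ha : g 0 0 = g 1 0 * z := by linear_combination hz
    have e : g 1 1 * z - g 0 1 = det2 p g / g 1 0 := by
      rw [det2, ha]; field_simp
    rw [hz, e, h.lift_zero_right u (div_ne_zero hg hc), h.ext2_dehom, psi]
    ring
  · rw [h.lift_eq_psi_mul u _ hz, psi]
    ring

section
open Polynomial

lemma eval_mem_span_lGen {j : ℕ} (hj : (j : ℝ) < valL p L α) {P : L[X]} (hP : P.natDegree ≤ j) :
    (fun z => P.eval (iotaL p L z)) ∈ Submodule.span L (lGen p L k α β) := by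
  have e : (fun z => P.eval (iotaL p L z)) =
      ∑ i ∈ Finset.range (j + 1), P.coeff i • monomialFun p L i := by
    funext z
    rw [eval_eq_sum_range' (Nat.lt_succ_of_le hP)]
    simp [monomialFun]
  rw [e]
  refine Submodule.sum_mem _ fun i hi => Submodule.smul_mem _ _ (Submodule.subset_span ?_)
  have hi' : (i : ℝ) ≤ j := by exact_mod_cast Nat.lt_succ_iff.1 (Finset.mem_range.1 hi)
  exact ⟨i, by linarith, Or.inl rfl⟩

lemma spec_mem_span_lGen {j : ℕ} (hj : (j : ℝ) < valL p L α) (hjk : j ≤ k - 2) (a : ℚ_[p])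
    {P : L[X]} (hP : P.natDegree ≤ j) :
    (fun z => if z = a then 0 else (α * (p : L) / β) ^ (z - a).valuation *
      iotaL p L (z - a) ^ (k - 2 - j) * P.eval (iotaL p L (z - a))) ∈
        Submodule.span L (lGen p L k α β) := by
  have e : (fun z => if z = a then 0 else (α * (p : L) / β) ^ (z - a).valuation *
      iotaL p L (z - a) ^ (k - 2 - j) * P.eval (iotaL p L (z - a))) =
      ∑ i ∈ Finset.range (j + 1), P.coeff i • specFun p L k α β a (j - i) := by
    funext z
    rw [Finset.sum_apply]
    simp only [Pi.smul_apply, smul_eq_mul, specFun]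
    split_ifs with hz
    · simp
    · rw [eval_eq_sum_range' (Nat.lt_succ_of_le hP), Finset.mul_sum]
      refine Finset.sum_congr rfl fun i hi => ?_
      have hi' := Nat.lt_succ_iff.1 (Finset.mem_range.1 hi)
      rw [show k - 2 - (j - i) = k - 2 - j + i by omega, pow_add]
      ring
  rw [e]
  refine Submodule.sum_mem _ fun i hi => Submodule.smul_mem _ _ (Submodule.subset_span ?_)
  have hi' : ((j - i : ℕ) : ℝ) ≤ j := by exact_mod_cast Nat.sub_le j i
  exact ⟨j - i, by linarith, Or.inr ⟨a, rfl⟩⟩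

lemma HypS.dehom_mem_span_lGen (h : HypS p L k α β) {u : BX p L α}
    (hu : u ∈ specSet p k α β) : dehom k α β u ∈ Submodule.span L (lGen p L k α β) := by
  obtain ⟨j, g, hj, hg, hu⟩ := hu
  have hjk := h.le_of_lt_val hj
  have hχ := h.chi_ne_zero
  have hval : ∀ z, dehom k α β u z = α ^ (-(det2 p g).valuation) *
      mon k α β j (g 1 1 * z - g 0 1) (-(g 1 0) * z + g 0 0) := by
    intro z; rw [dehom_apply, hu, act_apply, mul_one, mul_one]
  have hdeg : ∀ s t : L, ((C s * X + C t) ^ j).natDegree ≤ j := fun s t => by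
    refine natDegree_pow_le.trans ?_
    exact (Nat.mul_le_mul_left j natDegree_linear_le).trans (by simp)
  by_cases hc : g 1 0 = 0
  · have ha : g 0 0 ≠ 0 := by
      intro ha; exact hg (by rw [det2, hc, ha]; ring)
    have e : dehom k α β u = (α ^ (-(det2 p g).valuation) *
        ((α * (p : L) / β) ^ (g 0 0).valuation * iotaL p L (g 0 0) ^ (k - 2 - j))) •
        fun z => ((C (iotaL p L (g 1 1)) * X + C (-iotaL p L (g 0 1))) ^ j).eval (iotaL p L z) := by
      funext z
      rw [hval, hc, neg_zero, zero_mul, zero_add, mon, if_neg ha, iotaL_sub, iotaL_mul]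
      simp only [Pi.smul_apply, smul_eq_mul, eval_pow, eval_add, eval_mul, eval_C, eval_X]
      ring
    rw [e]
    exact Submodule.smul_mem _ _ (eval_mem_span_lGen hj (hdeg _ _))
  · have e : dehom k α β u = (α ^ (-(det2 p g).valuation) *
        ((α * (p : L) / β) ^ (-(g 1 0)).valuation * iotaL p L (-(g 1 0)) ^ (k - 2 - j))) •
        fun z => if z = g 0 0 / g 1 0 then 0 else
          (α * (p : L) / β) ^ (z - g 0 0 / g 1 0).valuation *
          iotaL p L (z - g 0 0 / g 1 0) ^ (k - 2 - j) *
          ((C (iotaL p L (g 1 1)) * X + C (iotaL p L (g 1 1 * (g 0 0 / g 1 0) - g 0 1))) ^ j).eval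
            (iotaL p L (z - g 0 0 / g 1 0)) := by
      funext z
      have e1 : -(g 1 0) * z + g 0 0 = -(g 1 0) * (z - g 0 0 / g 1 0) := by field_simp; ring
      rw [hval, mon, e1]
      simp only [Pi.smul_apply, smul_eq_mul]
      by_cases hz : z = g 0 0 / g 1 0
      · rw [if_pos hz, if_pos (by rw [hz, sub_self, mul_zero]), mul_zero, mul_zero]
      · have hz' := sub_ne_zero.2 hz
        rw [if_neg hz, if_neg (mul_ne_zero (neg_ne_zero.2 hc) hz'),
          Padic.valuation_mul (neg_ne_zero.2 hc) hz', zpow_add₀ hχ, iotaL_mul, mul_pow,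
          eval_pow, eval_add, eval_mul, eval_C, eval_X, eval_C, ← iotaL_mul, ← iotaL_add,
          show g 1 1 * (z - g 0 0 / g 1 0) + (g 1 1 * (g 0 0 / g 1 0) - g 0 1) =
            g 1 1 * z - g 0 1 by ring]
        ring
    rw [e]
    exact Submodule.smul_mem _ _ (spec_mem_span_lGen hj hjk _ (hdeg _ _))

end

lemma HypS.exists_mem_specSet (h : HypS p L k α β) {f : ℚ_[p] → L} (hf : f ∈ lGen p L k α β) :
    ∃ u ∈ specSet p k α β, dehom k α β u = f := by
  obtain ⟨j, hj, rfl | ⟨a, rfl⟩⟩ := hf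
  · obtain ⟨u, hu⟩ := h.exists_lift_mon hj
    refine ⟨u, ⟨j, 1, hj, isK_one.det_ne_zero, by rw [hu, act_one]⟩, ?_⟩
    funext z
    rw [dehom_apply, hu, mon, if_neg one_ne_zero, monomialFun]
    simp [iotaL_one]
  · obtain ⟨u, hu⟩ := h.exists_lift_mon hj
    have hd : det2 p !![-a, -1; -1, 0] = -1 := by simp [det2]
    have hg : det2 p !![-a, -1; -1, 0] ≠ 0 := by rw [hd]; simp
    refine ⟨rho k α β !![-a, -1; -1, 0] u, ⟨j, _, hj, hg, by rw [h.lift_rho hg, hu]⟩, ?_⟩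
    funext z
    rw [dehom_apply, h.lift_rho hg, hu, act_apply, hd, valuation_neg_one, mon, specFun]
    have e : (-(!![-a, -1; -1, (0 : ℚ_[p])] 1 0) * z + !![-a, -1; -1, (0 : ℚ_[p])] 0 0 * 1) =
        z - a := by simp [sub_eq_add_neg]
    rw [e]
    by_cases hz : z = a
    · rw [if_pos hz, if_pos (sub_eq_zero.2 hz), mul_zero]
    · rw [if_neg hz, if_neg (sub_ne_zero.2 hz)]
      simp [iotaL_one]

lemma HypS.span_lGen_eq (h : HypS p L k α β) : Submodule.span L (lGen p L k α β) =
    (Submodule.span L (specSet p k α β)).map (dehom k α β) := by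
  rw [Submodule.map_span]
  refine le_antisymm (Submodule.span_le.2 fun f hf => ?_) (Submodule.span_le.2 ?_)
  · obtain ⟨u, hu, rfl⟩ := h.exists_mem_specSet hf
    exact Submodule.subset_span ⟨u, hu, rfl⟩
  · rintro _ ⟨u, hu, rfl⟩
    exact h.dehom_mem_span_lGen hu

lemma HypS.memLalpha_dehom (h : HypS p L k α β) (u : BX p L α) :
    MemLalpha p L k α β (dehom k α β u) ↔ u ∈ Lsub p k α β := by
  rw [Lsub, ← SetLike.mem_coe, Submodule.topologicalClosure_coe, Metric.mem_closure_iff]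
  constructor
  · rintro ⟨-, h1⟩ ε hε
    obtain ⟨g, hg, hn⟩ := h1 ε hε
    rw [h.span_lGen_eq] at hg
    obtain ⟨w, hw, rfl⟩ := hg
    rw [← map_sub, h.bNorm_dehom] at hn
    exact ⟨w, hw, by rwa [dist_eq_norm]⟩
  · intro h1
    refine ⟨h.memB_dehom u, fun ε hε => ?_⟩
    obtain ⟨w, hw, hn⟩ := h1 ε hε
    refine ⟨dehom k α β w, by rw [h.span_lGen_eq]; exact ⟨w, hw, rfl⟩, ?_⟩
    rwa [← map_sub, h.bNorm_dehom, ← dist_eq_norm]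

lemma HypS.memLalpha_dehom' (h : HypS p L k α β) (u : BX p L α) :
    MemLalpha p L k α β (dehom k α β u) ↔ qmk k α β u = 0 := by
  rw [h.memLalpha_dehom, qmk_eq_zero]

lemma HypS.memLalpha_sub (h : HypS p L k α β) (u v : BX p L α) :
    MemLalpha p L k α β (dehom k α β u - dehom k α β v) ↔ qmk k α β u = qmk k α β v := by
  rw [← map_sub, h.memLalpha_dehom', map_sub, sub_eq_zero]

lemma HypS.qNorm_dehom (h : HypS p L k α β) (u : BX p L α) :
    qNorm p L k α β (dehom k α β u) = ‖qmk k α β u‖ := by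
  rw [qNorm]
  have hmem : ∀ w ∈ Lsub p k α β, ‖u - w‖ ∈ {x : ℝ | ∃ g : ℚ_[p] → L, MemLalpha p L k α β g ∧
      x = bNorm p L k α β (dehom k α β u - g)} := fun w hw =>
    ⟨dehom k α β w, (h.memLalpha_dehom w).2 hw, by rw [← map_sub, h.bNorm_dehom]⟩
  have hlow : ∀ x ∈ {x : ℝ | ∃ g : ℚ_[p] → L, MemLalpha p L k α β g ∧
      x = bNorm p L k α β (dehom k α β u - g)}, ‖qmk k α β u‖ ≤ x := by
    rintro _ ⟨g, hg, rfl⟩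
    obtain ⟨w, rfl⟩ := h.exists_dehom_eq hg.1
    rw [h.memLalpha_dehom'] at hg
    rw [← map_sub, h.bNorm_dehom]
    have := norm_qmk_le (k := k) (β := β) (u - w)
    rwa [map_sub, hg, sub_zero] at this
  refine le_antisymm (le_of_forall_pos_le_add fun ε hε => ?_)
    (le_csInf ⟨_, hmem 0 (zero_mem _)⟩ hlow)
  obtain ⟨v, hv, hn⟩ := exists_qmk_lt (qmk k α β u) hε
  refine (csInf_le ⟨_, hlow⟩ (hmem (u - v) ?_)).trans ?_
  · rw [← qmk_eq_zero, map_sub, hv, sub_self]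
  · rw [sub_sub_cancel]; exact hn.le

end Transfer

section LocallyAlgebraic

set_option linter.unusedSectionVars false

variable {p : ℕ} [hp : Fact p.Prime]
variable {L : Type} [NontriviallyNormedField L] [NormedAlgebra ℚ_[p] L]
variable {k : ℕ} {α β : L}

lemma locConst_of_eventually {h : ℚ_[p] → L} (hh : ∀ x, ∀ᶠ y in 𝓝 x, h y = h x) :
    LocConst p L h := by
  intro x
  obtain ⟨ε, hε, hb⟩ := Metric.eventually_nhds_iff.1 (hh x)
  have hp1 : (1 : ℝ) < p := by exact_mod_cast hp.out.one_lt
  obtain ⟨n, hn⟩ := exists_pow_lt_of_lt_one hε (inv_lt_one_of_one_lt₀ hp1)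
  refine ⟨n, fun y hy => hb ?_⟩
  rw [dist_eq_norm]
  refine hy.trans_lt ?_
  rwa [zpow_neg, zpow_natCast, ← inv_pow]

/-- The smooth part of the functions `eh`. -/
def charH (α β : L) (x y : ℚ_[p]) : L :=
  if ‖x‖ ≤ ‖y‖ ∧ y ≠ 0 then (α * (p : L) / β) ^ y.valuation else 0

lemma eventually_charH {m l : ℚ_[p] → ℚ_[p]} {t : ℚ_[p]} (hm : Continuous m) (hl : Continuous l)
    (h0 : ¬ (m t = 0 ∧ l t = 0)) :
    ∀ᶠ s in 𝓝 t, charH α β (m s) (l s) = charH α β (m t) (l t) := by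
  have hev : ∀ {f : ℚ_[p] → ℚ_[p]}, Continuous f → ∀ {ε : ℝ}, 0 < ε →
      ∀ᶠ s in 𝓝 t, ‖f s - f t‖ < ε := fun {f} hf {ε} hε => by
    simpa only [dist_eq_norm] using Metric.tendsto_nhds.1 (hf.tendsto t) ε hε
  by_cases hc : ‖m t‖ ≤ ‖l t‖ ∧ l t ≠ 0
  · have hpos := norm_pos_iff.2 hc.2
    filter_upwards [hev hm hpos, hev hl hpos] with s h1 h2
    have h3 := support_stable hc h1.le h2
    rw [add_sub_cancel, add_sub_cancel] at h3
    rw [charH, charH, if_pos h3.1, if_pos hc, h3.2]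
  · have hlt : ‖l t‖ < ‖m t‖ := by
      by_contra hle
      push Not at hle
      have hl0 : l t = 0 := by tauto
      rw [hl0, norm_zero] at hle
      exact h0 ⟨norm_le_zero_iff.1 hle, hl0⟩
    have hpos : 0 < ‖m t‖ := (norm_nonneg _).trans_lt hlt
    filter_upwards [hev hm hpos, hev hl hpos] with s h1 h2
    have h3 := norm_add_eq_of_lt h1
    rw [add_sub_cancel] at h3
    have h4 : ‖l s‖ < ‖m s‖ := by
      rw [h3]
      have := Padic.nonarchimedean (l t) (l s - l t)
      rw [add_sub_cancel] at this
      exact this.trans_lt (max_lt hlt h2)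
    rw [charH, charH, if_neg hc, if_neg fun h => absurd h.1 (not_le.2 h4)]

section
open Polynomial

lemma HypS.act_eh_mem_piRep (h : HypS p L k α β) {g : Matrix (Fin 2) (Fin 2) ℚ_[p]}
    (hg : det2 p g ≠ 0) {i : ℕ} (hi : i ≤ k - 2) :
    (fun z => act α g (eh k α β i) z 1) ∈ piRep p L k α β := by
  have hχ := h.chi_ne_zero
  let P : L[X] := (C (iotaL p L (g 1 1)) * X + C (-iotaL p L (g 0 1))) ^ i *
    (C (-iotaL p L (g 1 0)) * X + C (iotaL p L (g 0 0))) ^ (k - 2 - i)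
  let H : ℚ_[p] → ℚ_[p] → L := fun x y =>
    charH α β (g 1 1 * x - g 0 1 * y) (-(g 1 0) * x + g 0 0 * y)
  have hne : ∀ x y : ℚ_[p], ¬ (x = 0 ∧ y = 0) →
      ¬ (g 1 1 * x - g 0 1 * y = 0 ∧ -(g 1 0) * x + g 0 0 * y = 0) := by
    rintro x y hxy ⟨h1, h2⟩
    have e1 : det2 p g * x = 0 := by rw [det2]; linear_combination g 0 0 * h1 + g 0 1 * h2
    have e2 : det2 p g * y = 0 := by rw [det2]; linear_combination g 1 0 * h1 + g 1 1 * h2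
    exact hxy ⟨(mul_eq_zero.1 e1).resolve_left hg, (mul_eq_zero.1 e2).resolve_left hg⟩
  have hlc1 : LocConst p L (fun z => H z 1) := locConst_of_eventually fun z =>
    eventually_charH (m := fun z => g 1 1 * z - g 0 1 * 1) (l := fun z => -(g 1 0) * z + g 0 0 * 1)
      (by fun_prop) (by fun_prop) (hne z 1 (by simp))
  have hlc2 : LocConst p L (fun z => H 1 z) := locConst_of_eventually fun z =>
    eventually_charH (m := fun z => g 1 1 * 1 - g 0 1 * z) (l := fun z => -(g 1 0) * 1 + g 0 0 * z)
      (by fun_prop) (by fun_prop) (hne 1 z (by simp))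
  have e : (fun z => act α g (eh k α β i) z 1) = α ^ (-(det2 p g).valuation) •
      fun z => P.eval (iotaL p L z) * H z 1 := by
    funext z
    rw [act_apply, eh]
    simp only [Pi.smul_apply, smul_eq_mul, H, charH, P, eval_mul, eval_pow, eval_add, eval_C,
      eval_X, mul_one]
    split_ifs
    · rw [iotaL_add, iotaL_mul, iotaL_neg, iotaL_sub, iotaL_mul]; ring
    · simp
  rw [e]
  refine Submodule.smul_mem _ _ (Submodule.subset_span ⟨P, fun z => H z 1, ?_,
    ⟨hlc1, fun z => H 1 z, hlc2, fun z hz => ?_⟩, rfl⟩)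
  · refine natDegree_mul_le.trans ((Nat.add_le_add natDegree_pow_le natDegree_pow_le).trans ?_)
    have h1 : (C (iotaL p L (g 1 1)) * X + C (-iotaL p L (g 0 1))).natDegree ≤ 1 :=
      natDegree_linear_le
    have h2 : (C (-iotaL p L (g 1 0)) * X + C (iotaL p L (g 0 0))).natDegree ≤ 1 :=
      natDegree_linear_le
    calc _ ≤ i * 1 + (k - 2 - i) * 1 :=
          Nat.add_le_add (Nat.mul_le_mul_left _ h1) (Nat.mul_le_mul_left _ h2)
      _ = k - 2 := by omega
  · have e1 : g 1 1 * 1 - g 0 1 * z = z * (g 1 1 * z⁻¹ - g 0 1 * 1) := by field_simp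
    have e2 : -(g 1 0) * 1 + g 0 0 * z = z * (-(g 1 0) * z⁻¹ + g 0 0 * 1) := by field_simp
    simp only [H]
    rw [e1, e2]
    set M := g 1 1 * z⁻¹ - g 0 1 * 1
    set N := -(g 1 0) * z⁻¹ + g 0 0 * 1
    have hc : (‖z * M‖ ≤ ‖z * N‖ ∧ z * N ≠ 0) ↔ (‖M‖ ≤ ‖N‖ ∧ N ≠ 0) := by
      rw [norm_mul, norm_mul, mul_le_mul_iff_right₀ (norm_pos_iff.2 hz)]
      simp [hz]
    simp only [charH, hc]
    split_ifs with hMN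
    · rw [Padic.valuation_mul hz hMN.2, zpow_add₀ hχ]
    · simp

lemma exists_uniform_locConst {f : ℤ_[p] → L}
    (hf : ∀ x : ℤ_[p], ∃ n : ℕ, ∀ y : ℤ_[p], ‖y - x‖ ≤ (p : ℝ) ^ (-(n : ℤ)) → f y = f x) :
    ∃ n : ℕ, ∀ x s : ℤ_[p], f (x + (p : ℤ_[p]) ^ n * s) = f x := by
  choose n hn using hf
  have hp1 : (1 : ℝ) < p := by exact_mod_cast hp.out.one_lt
  have hp0 : (0 : ℝ) < p := by linarith
  obtain ⟨t, -, ht⟩ := isCompact_univ.elim_nhds_subcover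
    (fun x : ℤ_[p] => Metric.closedBall x ((p : ℝ) ^ (-(n x : ℤ))))
    (fun x _ => Metric.closedBall_mem_nhds x (zpow_pos hp0 _))
  refine ⟨t.sup n, fun x s => ?_⟩
  obtain ⟨y, hy, hxy⟩ := Set.mem_iUnion₂.1 (ht (Set.mem_univ x))
  rw [Metric.mem_closedBall, dist_eq_norm] at hxy
  rw [hn y x hxy]
  refine hn y _ ?_
  rw [add_sub_right_comm]
  refine (PadicInt.nonarchimedean _ _).trans (max_le hxy ?_)
  rw [norm_mul, norm_pow, PadicInt.norm_p]
  calc ((p : ℝ)⁻¹) ^ t.sup n * ‖s‖ ≤ ((p : ℝ)⁻¹) ^ t.sup n * 1 := by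
        gcongr; exact PadicInt.norm_le_one s
    _ ≤ (p : ℝ) ^ (-(n y : ℤ)) := by
        rw [mul_one, inv_pow, ← zpow_natCast, ← zpow_neg]
        exact zpow_le_zpow_right₀ hp1.le (by
          have := Finset.le_sup (f := n) hy
          omega)

lemma LP_poly_mul {P : L[X]} (hP : P.natDegree < k - 1) {f : ℤ_[p] → L} {n : ℕ}
    (hf : ∀ x s : ℤ_[p], f (x + (p : ℤ_[p]) ^ n * s) = f x) :
    LP (k - 1) n (fun z : ℤ_[p] => P.eval (iotaL p L (z : ℚ_[p])) * f z) := by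
  intro z
  refine ⟨C (f z) * P.comp (C ((p : L) ^ n) * X + C (iotaL p L (z : ℚ_[p]))), ?_, fun s => ?_⟩
  · refine (natDegree_C_mul_le _ _).trans_lt (natDegree_comp_le.trans_lt ?_)
    refine lt_of_le_of_lt ?_ hP
    exact (Nat.mul_le_mul_left _ natDegree_linear_le).trans (by simp)
  · have e := hf z s
    beta_reduce
    rw [e]
    push_cast
    simp only [iotaL_add, iotaL_mul, iotaL_pow, iotaL_p, eval_mul, eval_C, eval_comp, eval_add,
      eval_X]
    ring_nf

variable [IsUltrametricDist L] [CompleteSpace L]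

lemma LP.isCr {r : ℝ} (hr : 0 < r) {e n : ℕ} {f : ℤ_[p] → L} (hf : LP e n f) : IsCr p L r f := by
  have hf' := hf.mono_degree (Nat.le_succ e)
  obtain ⟨C, -, hC⟩ := isCr_of_fwdDiff_eq_zero p L hr (Nat.succ_pos e)
  have hc := hf'.continuous
  obtain ⟨M, hM⟩ := isCompact_univ.exists_bound_of_continuousOn (f := f) hc.continuousOn
  exact (hC n f M hc hf'.fwdDiff_eq_zero fun x => hM x (Set.mem_univ x)).1

variable [hα0 : Fact (0 < valL p L α)]

lemma HypS.piGen_subset (h : HypS p L k α β) {f : ℚ_[p] → L} (hf : f ∈ piGen p L k α β) :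
    ∃ u ∈ DD p k α β, dehom k α β u = f := by
  obtain ⟨P, q, hP, ⟨hq, q', hq', hqq⟩, rfl⟩ := hf
  have hk := h.two_le
  have hp1 : (1 : ℝ) < p := by exact_mod_cast hp.out.one_lt
  have hres : ∀ (Q : L[X]) (w : ℤ_[p] → L), Q.natDegree ≤ k - 2 →
      (∀ x : ℤ_[p], ∃ n : ℕ, ∀ y : ℤ_[p], ‖y - x‖ ≤ (p : ℝ) ^ (-(n : ℤ)) → w y = w x) →
      ∃ n, LP (k - 1) n (fun z : ℤ_[p] => Q.eval (iotaL p L (z : ℚ_[p])) * w z) := by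
    intro Q w hQ hw
    obtain ⟨n, hn⟩ := exists_uniform_locConst hw
    exact ⟨n, LP_poly_mul (by omega) hn⟩
  obtain ⟨n₁, h₁⟩ := hres (P.comp (C (p : L) * X + C 0)) (fun z => q ((p : ℚ_[p]) * (z : ℚ_[p])))
    (natDegree_comp_le.trans ((Nat.mul_le_mul_left _ natDegree_linear_le).trans (by simpa using hP)))
    (fun x => by
      obtain ⟨n, hn⟩ := hq ((p : ℚ_[p]) * (x : ℚ_[p]))
      refine ⟨n, fun y hy => hn _ ?_⟩
      rw [← mul_sub, norm_mul, Padic.norm_p, ← PadicInt.coe_sub]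
      exact (mul_le_of_le_one_left (norm_nonneg _) (inv_lt_one_of_one_lt₀ hp1).le).trans hy)
  let R : L[X] := ∑ i ∈ Finset.range (k - 2 + 1), C (P.coeff i) * X ^ (k - 2 - i)
  obtain ⟨n₂, h₂⟩ := hres R (fun z => q' (z : ℚ_[p]))
    (natDegree_sum_le_of_forall_le _ _ fun i _ =>
      (natDegree_C_mul_X_pow_le _ _).trans (Nat.sub_le _ _))
    (fun x => by
      obtain ⟨n, hn⟩ := hq' (x : ℚ_[p])
      exact ⟨n, fun y hy => hn _ (by rw [← PadicInt.coe_sub]; exact hy)⟩)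
  have c₁ : (fun z : ℤ_[p] => P.eval (iotaL p L ((p : ℚ_[p]) * (z : ℚ_[p]))) *
      q ((p : ℚ_[p]) * (z : ℚ_[p]))) = fun z : ℤ_[p] =>
      (P.comp (C (p : L) * X + C 0)).eval (iotaL p L (z : ℚ_[p])) * q ((p : ℚ_[p]) * (z : ℚ_[p])) := by
    funext z
    simp [eval_comp, iotaL_mul, iotaL_p]
  have c₂ : ∀ z : ℤ_[p], z ≠ 0 → R.eval (iotaL p L (z : ℚ_[p])) * q' (z : ℚ_[p]) =
      (α * (p : L) / β) ^ ((z : ℚ_[p]).valuation) * (iotaL p L (z : ℚ_[p])) ^ (k - 2) *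
        (P.eval (iotaL p L ((z : ℚ_[p])⁻¹)) * q ((z : ℚ_[p])⁻¹)) := by
    intro z hz
    have hz' : (z : ℚ_[p]) ≠ 0 := by
      intro h0; exact hz (PadicInt.ext (by rw [h0, PadicInt.coe_zero]))
    have hz'' : iotaL p L (z : ℚ_[p]) ≠ 0 := by rwa [Ne, iotaL_eq_zero]
    have e : R.eval (iotaL p L (z : ℚ_[p])) =
        (iotaL p L (z : ℚ_[p])) ^ (k - 2) * P.eval (iotaL p L ((z : ℚ_[p])⁻¹)) := by
      rw [eval_eq_sum_range' (Nat.lt_succ_of_le hP), eval_finsetSum, Finset.mul_sum]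
      refine Finset.sum_congr rfl fun i hi => ?_
      have hi' := Nat.lt_succ_iff.1 (Finset.mem_range.1 hi)
      rw [eval_mul, eval_C, eval_pow, eval_X, iotaL_inv, inv_pow]
      rw [show k - 2 = k - 2 - i + i by omega, pow_add]
      simp only [Nat.add_sub_cancel]
      field_simp
    rw [e, hqq _ hz']
    ring
  have hB : MemB p L k α β (fun z => P.eval (iotaL p L z) * q z) :=
    ⟨by rw [c₁]; exact h₁.isCr hα0.out, _, h₂.isCr hα0.out, c₂⟩
  obtain ⟨u, hu⟩ := h.exists_dehom_eq hB
  refine ⟨u, ?_, hu⟩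
  have u₁ : LP (k - 1) n₁ u.1.fn := by
    rw [← dehom_chart₁ (k := k) (β := β), hu, c₁]; exact h₁
  have u₂ : LP (k - 1) n₂ u.2.fn := by
    have e := h.Ext2_dehom u
    rw [hu] at e
    rw [continuous_eq_of_ne_zero (e.1.continuous hα0.out) h₂.continuous
      fun z hz => (e.2 z hz).trans (c₂ z hz).symm]
    exact h₂
  exact h.mem_DD_of_LP (u₁.mono_level (le_max_left n₁ n₂)) (u₂.mono_level (le_max_right n₁ n₂))

end

variable [IsUltrametricDist L] [CompleteSpace L] [hα0 : Fact (0 < valL p L α)]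

/-- The locally algebraic representation is the space of locally polynomial charts. -/
lemma HypS.piRep_eq (h : HypS p L k α β) :
    piRep p L k α β = (DD p k α β).map (dehom k α β) := by
  refine le_antisymm (Submodule.span_le.2 fun f hf => ?_) ?_
  · obtain ⟨u, hu, rfl⟩ := h.piGen_subset hf
    exact ⟨u, hu, rfl⟩
  · rintro _ ⟨u, hu, rfl⟩
    refine h.SS_induction (P := fun F => (fun z => F z 1) ∈ piRep p L k α β)
      (fun g hg i hi => h.act_eh_mem_piRep hg hi) (zero_mem _)
      (fun F G hF hG => add_mem hF hG) (fun c F hF => Submodule.smul_mem _ c hF) hu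

end LocallyAlgebraic

section Assembly

set_option linter.unusedSectionVars false

variable {p : ℕ} [hp : Fact p.Prime] {L : Type} [NontriviallyNormedField L] [NormedAlgebra ℚ_[p] L]
  [IsUltrametricDist L] [CompleteSpace L] {k : ℕ} {α β : L}
  [Fact (0 < valL p L α)]

/-- The element of `BX p L α` attached to a function belonging to `B(α)`. -/
def toBX (k : ℕ) (α β : L) [Fact (0 < valL p L α)] (f : ℚ_[p] → L) : BX p L α :=
  if h : ∃ u : BX p L α, dehom k α β u = f then h.choose else 0

lemma HypS.toBX_dehom (h : HypS p L k α β) (u : BX p L α) :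
    toBX k α β (dehom k α β u) = u := by
  have hex : ∃ v : BX p L α, dehom k α β v = dehom k α β u := ⟨u, rfl⟩
  rw [toBX, dif_pos hex]
  exact h.dehom_injective hex.choose_spec

/-- The supremum of the quotient norms over the orbit of a vector. -/
def orbitNorm (k : ℕ) (α β : L) [Fact (0 < valL p L α)] (u : BX p L α) : ℝ :=
  ⨆ g : {g : Matrix (Fin 2) (Fin 2) ℚ_[p] // det2 p g ≠ 0}, ‖qmk k α β (rho k α β g.1 u)‖

instance : Nonempty {g : Matrix (Fin 2) (Fin 2) ℚ_[p] // det2 p g ≠ 0} :=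
  ⟨⟨1, isK_one.det_ne_zero⟩⟩

lemma HypS.le_orbitNorm (h : HypS p L k α β) {g : Matrix (Fin 2) (Fin 2) ℚ_[p]}
    (hg : det2 p g ≠ 0) (u : BX p L α) :
    ‖qmk k α β (rho k α β g u)‖ ≤ orbitNorm k α β u := by
  obtain ⟨C, -, hC⟩ := h.exists_unitary_bound
  exact le_ciSup (f := fun g : {g : Matrix (Fin 2) (Fin 2) ℚ_[p] // det2 p g ≠ 0} =>
    ‖qmk k α β (rho k α β g.1 u)‖)
    ⟨C * ‖qmk k α β u‖, by rintro _ ⟨g, rfl⟩; exact hC g.1 g.2 u⟩ ⟨g, hg⟩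

lemma HypS.norm_qmk_le_orbitNorm (h : HypS p L k α β) (u : BX p L α) :
    ‖qmk k α β u‖ ≤ orbitNorm k α β u := by
  have := h.le_orbitNorm isK_one.det_ne_zero u
  rwa [h.rho_one] at this

lemma orbitNorm_le {u : BX p L α} {M : ℝ}
    (hM : ∀ g : Matrix (Fin 2) (Fin 2) ℚ_[p], det2 p g ≠ 0 → ‖qmk k α β (rho k α β g u)‖ ≤ M) :
    orbitNorm k α β u ≤ M :=
  ciSup_le fun g => hM g.1 g.2

lemma HypS.orbitNorm_rho_le (h : HypS p L k α β) {m : Matrix (Fin 2) (Fin 2) ℚ_[p]}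
    (hm : det2 p m ≠ 0) (u : BX p L α) :
    orbitNorm k α β (rho k α β m u) ≤ orbitNorm k α β u :=
  orbitNorm_le fun g hg => by
    rw [← h.rho_mul hg hm]
    exact h.le_orbitNorm (det2_mul_ne_zero hg hm) u

lemma HypS.orbitNorm_rho (h : HypS p L k α β) {m : Matrix (Fin 2) (Fin 2) ℚ_[p]}
    (hm : det2 p m ≠ 0) (u : BX p L α) :
    orbitNorm k α β (rho k α β m u) = orbitNorm k α β u := by
  refine le_antisymm (h.orbitNorm_rho_le hm u) ?_
  have hu : IsUnit m.det := by rw [← det2_eq_det]; exact hm.isUnit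
  have hmi : det2 p m⁻¹ ≠ 0 := by
    rw [det2_eq_det]; exact (Matrix.isUnit_nonsing_inv_det m hu).ne_zero
  have := h.orbitNorm_rho_le hmi (rho k α β m u)
  rwa [← h.rho_mul hmi hm, Matrix.nonsing_inv_mul m hu, h.rho_one] at this

/-- The quotient `B(α)/L(α)` carries an equivalent invariant norm. -/
theorem HypS.exists_invariant_norm (h : HypS p L k α β) : ∃ N : (ℚ_[p] → L) → ℝ,
    (∀ f : ℚ_[p] → L, MemB p L k α β f → 0 ≤ N f) ∧
    (∀ f g : ℚ_[p] → L, MemB p L k α β f → MemB p L k α β g → N (f + g) ≤ N f + N g) ∧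
    (∀ (c : L) (f : ℚ_[p] → L), MemB p L k α β f → N (c • f) = ‖c‖ * N f) ∧
    (∀ f : ℚ_[p] → L, MemB p L k α β f → (N f = 0 ↔ MemLalpha p L k α β f)) ∧
    (∀ m : Matrix (Fin 2) (Fin 2) ℚ_[p], det2 p m ≠ 0 →
      ∀ f : ℚ_[p] → L, MemB p L k α β f → N (gAct p L k α β m f) = N f) ∧
    (∃ c₁ : ℝ, 0 < c₁ ∧ ∃ c₂ : ℝ, 0 < c₂ ∧ ∀ f : ℚ_[p] → L, MemB p L k α β f →
      c₁ * qNorm p L k α β f ≤ N f ∧ N f ≤ c₂ * qNorm p L k α β f) := by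
  obtain ⟨C, hC0, hC⟩ := h.exists_unitary_bound
  have hle : ∀ u : BX p L α, orbitNorm k α β u ≤ C * ‖qmk k α β u‖ := fun u =>
    orbitNorm_le fun g hg => hC g hg u
  refine ⟨fun f => orbitNorm k α β (toBX k α β f), ?_, ?_, ?_, ?_, ?_, 1, one_pos, C, hC0, ?_⟩
  · intro f _
    exact (norm_nonneg _).trans (h.norm_qmk_le_orbitNorm _)
  · intro f g hf hg
    obtain ⟨u, rfl⟩ := h.exists_dehom_eq hf
    obtain ⟨v, rfl⟩ := h.exists_dehom_eq hg
    beta_reduce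
    rw [← map_add, h.toBX_dehom, h.toBX_dehom, h.toBX_dehom]
    refine orbitNorm_le fun g hg => ?_
    rw [map_add, map_add]
    exact (norm_add_le _ _).trans (add_le_add (h.le_orbitNorm hg u) (h.le_orbitNorm hg v))
  · intro c f hf
    obtain ⟨u, rfl⟩ := h.exists_dehom_eq hf
    beta_reduce
    rw [← map_smul, h.toBX_dehom, h.toBX_dehom, orbitNorm, orbitNorm,
      Real.mul_iSup_of_nonneg (norm_nonneg c)]
    refine iSup_congr fun g => ?_
    rw [map_smul, map_smul, norm_smul]
  · intro f hf
    obtain ⟨u, rfl⟩ := h.exists_dehom_eq hf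
    beta_reduce
    rw [h.toBX_dehom, h.memLalpha_dehom']
    constructor
    · intro h0
      exact norm_le_zero_iff.1 (h0 ▸ h.norm_qmk_le_orbitNorm u)
    · intro h0
      refine le_antisymm ?_ ((norm_nonneg _).trans (h.norm_qmk_le_orbitNorm u))
      simpa [h0] using hle u
  · intro m hm f hf
    obtain ⟨u, rfl⟩ := h.exists_dehom_eq hf
    beta_reduce
    rw [h.gAct_dehom hm, h.toBX_dehom, h.toBX_dehom, h.orbitNorm_rho hm]
  · intro f hf
    obtain ⟨u, rfl⟩ := h.exists_dehom_eq hf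
    beta_reduce
    rw [h.toBX_dehom, h.qNorm_dehom, one_mul]
    exact ⟨h.norm_qmk_le_orbitNorm u, hle u⟩

variable [Fact (0 < valL p L β)]

/-- The intertwining operator on functions on `ℚ_p`. -/
def interFun (k : ℕ) (α β : L) [Fact (0 < valL p L β)] (f : ℚ_[p] → L) : ℚ_[p] → L := fun z =>
  interJ k α β (lift k β α (toBX k β α f)) z 1

lemma HypS.interFun_dehom (h : HypS p L k α β) {u : BX p L β} {v : BX p L α}
    (hv : lift k α β v = interJ k α β (lift k β α u)) :
    interFun k α β (dehom k β α u) = dehom k α β v := by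
  funext z
  rw [interFun, h.symm.toBX_dehom, dehom_apply, hv]

lemma HypS.exists_inter (h : HypS p L k α β) {u : BX p L β} (hu : u ∈ DD p k β α) :
    ∃ v ∈ DD p k α β, lift k α β v = interJ k α β (lift k β α u) := by
  obtain ⟨v, hv⟩ := h.exists_lift_interJ hu
  exact ⟨v, by rw [mem_DD, hv]; exact h.interJ_mem_SS hu, hv⟩

lemma HypS.mem_piRep (h : HypS p L k α β) {f : ℚ_[p] → L} :
    f ∈ piRep p L k α β ↔ ∃ u ∈ DD p k α β, dehom k α β u = f := by
  rw [h.piRep_eq, Submodule.mem_map]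

lemma dehom_eq_genjFun {k : ℕ} {α β : L} [Fact (0 < valL p L α)] {u : BX p L α} {j : ℕ}
    (hu : lift k α β u = eh k α β j) :
    dehom k α β u = genjFun p L j := by
  funext z
  rw [dehom_apply, hu, eh, genjFun]
  simp [iotaL]

lemma ihat_eq_genjImageFun (k : ℕ) (α β : L) (j : ℕ) (z : ℚ_[p]) :
    ihat k α β j z 1 = genjImageFun p L k α β j z := by
  rw [ihat, genjImageFun]
  simp [iotaL, mul_comm]

lemma HypS.iopOk_interFun (h : HypS p L k α β) : IopOk p L k α β (interFun k α β) := by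
  refine ⟨?_, ?_, ?_, ?_, ?_⟩
  · intro f hf
    obtain ⟨u, hu, rfl⟩ := h.symm.mem_piRep.1 hf
    obtain ⟨v, hv, e⟩ := h.exists_inter hu
    rw [h.interFun_dehom e]
    exact h.mem_piRep.2 ⟨v, hv, rfl⟩
  · intro f hf g hg
    obtain ⟨u, hu, rfl⟩ := h.symm.mem_piRep.1 hf
    obtain ⟨u', hu', rfl⟩ := h.symm.mem_piRep.1 hg
    rw [← map_add]
    funext z
    simp only [interFun, h.symm.toBX_dehom, Pi.add_apply]
    rw [map_add, map_add, Pi.add_apply, Pi.add_apply]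
  · intro c f hf
    obtain ⟨u, hu, rfl⟩ := h.symm.mem_piRep.1 hf
    rw [← map_smul]
    funext z
    simp only [interFun, h.symm.toBX_dehom, Pi.smul_apply]
    rw [map_smul, map_smul, Pi.smul_apply, Pi.smul_apply]
  · intro m hm f hf
    obtain ⟨u, hu, rfl⟩ := h.symm.mem_piRep.1 hf
    obtain ⟨v, hv, e⟩ := h.exists_inter hu
    rw [h.interFun_dehom e, h.gAct_dehom hm, h.symm.gAct_dehom hm]
    refine h.interFun_dehom ?_
    rw [h.lift_rho hm, h.symm.lift_rho hm, h.interJ_act hm hu, e]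
  · intro j hj
    obtain ⟨u, hu, -⟩ := h.symm.exists_LP_of_mem_SS (h.symm.eh_mem_SS hj)
    rw [← dehom_eq_genjFun hu]
    funext z
    rw [interFun, h.symm.toBX_dehom, hu, h.interJ_eh hj, ihat_eq_genjImageFun]

lemma HypS.interFun_injOn (h : HypS p L k α β) (hc : interConst p α β ≠ 0) :
    ∀ f ∈ piRep p L k β α, ∀ g ∈ piRep p L k β α,
      interFun k α β f = interFun k α β g → f = g := by
  intro f hf g hg hfg
  obtain ⟨u, hu, rfl⟩ := h.symm.mem_piRep.1 hf
  obtain ⟨u', hu', rfl⟩ := h.symm.mem_piRep.1 hg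
  obtain ⟨v, -, e⟩ := h.exists_inter hu
  obtain ⟨v', -, e'⟩ := h.exists_inter hu'
  rw [h.interFun_dehom e, h.interFun_dehom e'] at hfg
  rw [h.dehom_injective hfg, e'] at e
  have key := congrArg (interJ k β α) e
  rw [h.interJ_interJ hu, h.interJ_interJ hu'] at key
  rw [lift_injective k β α (smul_right_injective _ hc key)]

lemma HypS.interFun_surjOn (h : HypS p L k α β) (hc : interConst p α β ≠ 0) :
    ∀ F ∈ piRep p L k α β, ∃ f ∈ piRep p L k β α, interFun k α β f = F := by
  intro F hF
  obtain ⟨v, hv, rfl⟩ := h.mem_piRep.1 hF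
  obtain ⟨u, hu, e⟩ := h.symm.exists_inter hv
  refine ⟨dehom k β α ((interConst p α β)⁻¹ • u),
    h.symm.mem_piRep.2 ⟨_, Submodule.smul_mem _ _ hu, rfl⟩, h.interFun_dehom ?_⟩
  rw [map_smul, map_smul, e, h.symm.interJ_interJ hv, interConst_comm β α, inv_smul_smul₀ hc]

/-- A lift to functions of a map between the quotients `B(β)/L(β)` and `B(α)/L(α)`. -/
def liftQ (T : QX p k β α →L[L] QX p k α β) (f : ℚ_[p] → L) : ℚ_[p] → L :=
  dehom k α β (qmk_surjective (T (qmk k β α (toBX k β α f)))).choose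

lemma HypS.exists_liftQ_dehom (h : HypS p L k α β) (T : QX p k β α →L[L] QX p k α β)
    (u : BX p L β) : ∃ v : BX p L α, liftQ T (dehom k β α u) = dehom k α β v ∧
      qmk k α β v = T (qmk k β α u) := by
  refine ⟨_, rfl, ?_⟩
  rw [(qmk_surjective (T (qmk k β α (toBX k β α (dehom k β α u))))).choose_spec,
    h.symm.toBX_dehom]

/-- The intertwining operator extends to the quotients `B(β)/L(β)` and `B(α)/L(α)`. -/
theorem HypS.exists_completed_intertwiner (h : HypS p L k α β) (hβα : β ≠ (p : L) * α) :
    ∃ Iop : (ℚ_[p] → L) → (ℚ_[p] → L), IopOk p L k α β Iop ∧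
      ∃ Φ : (ℚ_[p] → L) → (ℚ_[p] → L),
        (∀ f : ℚ_[p] → L, MemB p L k β α f → MemB p L k α β (Φ f)) ∧
        (∀ f g : ℚ_[p] → L, MemB p L k β α f → MemB p L k β α g →
          MemLalpha p L k α β (Φ (f + g) - Φ f - Φ g)) ∧
        (∀ (c : L) (f : ℚ_[p] → L), MemB p L k β α f →
          MemLalpha p L k α β (Φ (c • f) - c • Φ f)) ∧
        (∀ f g : ℚ_[p] → L, MemB p L k β α f → MemB p L k β α g →
          MemLalpha p L k β α (f - g) → MemLalpha p L k α β (Φ f - Φ g)) ∧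
        (∃ C : ℝ, 0 < C ∧ ∀ f : ℚ_[p] → L, MemB p L k β α f →
          qNorm p L k α β (Φ f) ≤ C * qNorm p L k β α f) ∧
        (∀ m : Matrix (Fin 2) (Fin 2) ℚ_[p], det2 p m ≠ 0 →
          ∀ f : ℚ_[p] → L, MemB p L k β α f →
            MemLalpha p L k α β (Φ (gAct p L k β α m f) - gAct p L k α β m (Φ f))) ∧
        (∀ f ∈ piRep p L k β α, MemLalpha p L k α β (Φ f - Iop f)) ∧
        (α ≠ (p : L) * β →
          (∀ f ∈ piRep p L k β α, ∀ g ∈ piRep p L k β α, Iop f = Iop g → f = g) ∧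
          (∀ F ∈ piRep p L k α β, ∃ f ∈ piRep p L k β α, Iop f = F) ∧
          (∀ F : ℚ_[p] → L, MemB p L k α β F →
            ∃ f : ℚ_[p] → L, MemB p L k β α f ∧ MemLalpha p L k α β (Φ f - F)) ∧
          (∀ f : ℚ_[p] → L, MemB p L k β α f → MemLalpha p L k α β (Φ f) →
            MemLalpha p L k β α f) ∧
          (∃ C' : ℝ, 0 < C' ∧ ∀ f : ℚ_[p] → L, MemB p L k β α f →
            qNorm p L k β α f ≤ C' * qNorm p L k α β (Φ f))) := by
  obtain ⟨T, hT, hTg⟩ := h.exists_interQ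
  obtain ⟨T', hT', -⟩ := h.symm.exists_interQ
  refine ⟨interFun k α β, h.iopOk_interFun, liftQ T, ?_, ?_, ?_, ?_, ⟨‖T‖ + 1, by positivity, ?_⟩,
    ?_, ?_, fun hαβ => ?_⟩
  · intro f _
    exact h.memB_dehom _
  · intro f g hf hg
    obtain ⟨u, rfl⟩ := h.symm.exists_dehom_eq hf
    obtain ⟨u', rfl⟩ := h.symm.exists_dehom_eq hg
    rw [← map_add]
    obtain ⟨v, e, hv⟩ := h.exists_liftQ_dehom T u
    obtain ⟨v', e', hv'⟩ := h.exists_liftQ_dehom T u'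
    obtain ⟨w, ew, hw⟩ := h.exists_liftQ_dehom T (u + u')
    rw [e, e', ew, sub_sub, ← map_add, h.memLalpha_sub, hw, map_add, map_add, map_add, hv, hv']
  · intro c f hf
    obtain ⟨u, rfl⟩ := h.symm.exists_dehom_eq hf
    rw [← map_smul]
    obtain ⟨v, e, hv⟩ := h.exists_liftQ_dehom T u
    obtain ⟨w, ew, hw⟩ := h.exists_liftQ_dehom T (c • u)
    rw [e, ew, ← map_smul, h.memLalpha_sub, hw, map_smul, map_smul, map_smul, hv]
  · intro f g hf hg hfg
    obtain ⟨u, rfl⟩ := h.symm.exists_dehom_eq hf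
    obtain ⟨u', rfl⟩ := h.symm.exists_dehom_eq hg
    obtain ⟨v, e, hv⟩ := h.exists_liftQ_dehom T u
    obtain ⟨v', e', hv'⟩ := h.exists_liftQ_dehom T u'
    rw [h.symm.memLalpha_sub] at hfg
    rw [e, e', h.memLalpha_sub, hv, hv', hfg]
  · intro f hf
    obtain ⟨u, rfl⟩ := h.symm.exists_dehom_eq hf
    obtain ⟨v, e, hv⟩ := h.exists_liftQ_dehom T u
    rw [e, h.qNorm_dehom, h.symm.qNorm_dehom, hv]
    refine (T.le_opNorm _).trans ?_
    gcongr
    linarith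
  · intro m hm f hf
    obtain ⟨u, rfl⟩ := h.symm.exists_dehom_eq hf
    rw [h.symm.gAct_dehom hm]
    obtain ⟨v, e, hv⟩ := h.exists_liftQ_dehom T u
    obtain ⟨w, ew, hw⟩ := h.exists_liftQ_dehom T (rho k β α m u)
    rw [e, ew, h.gAct_dehom hm, h.memLalpha_sub, hw, hTg m hm u v hv.symm]
  · intro f hf
    obtain ⟨u, hu, rfl⟩ := h.symm.mem_piRep.1 hf
    obtain ⟨v, e, hv⟩ := h.exists_liftQ_dehom T u
    obtain ⟨w, -, ew⟩ := h.exists_inter hu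
    rw [e, h.interFun_dehom ew, h.memLalpha_sub, hv, hT u w hu ew]
  · have hc := h.interConst_ne_zero hαβ hβα
    refine ⟨h.interFun_injOn hc, h.interFun_surjOn hc, ?_, ?_,
      ‖(interConst p α β)⁻¹‖ * ‖T'‖ + 1, by positivity, ?_⟩
    · intro F hF
      obtain ⟨w, rfl⟩ := h.exists_dehom_eq hF
      obtain ⟨u, hu⟩ := qmk_surjective ((interConst p α β)⁻¹ • T' (qmk k α β w))
      refine ⟨dehom k β α u, h.symm.memB_dehom u, ?_⟩
      obtain ⟨v, e, hv⟩ := h.exists_liftQ_dehom T u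
      rw [e, h.memLalpha_sub, hv, hu, map_smul, h.symm.interQ_comp hT' hT, interConst_comm β α,
        inv_smul_smul₀ hc]
    · intro f hf hΦ
      obtain ⟨u, rfl⟩ := h.symm.exists_dehom_eq hf
      obtain ⟨v, e, hv⟩ := h.exists_liftQ_dehom T u
      rw [e, h.memLalpha_dehom', hv] at hΦ
      have key := h.interQ_comp hT hT' (qmk k β α u)
      rw [hΦ, map_zero] at key
      rw [h.symm.memLalpha_dehom']
      exact (smul_eq_zero.1 key.symm).resolve_left hc
    · intro f hf
      obtain ⟨u, rfl⟩ := h.symm.exists_dehom_eq hf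
      obtain ⟨v, e, hv⟩ := h.exists_liftQ_dehom T u
      rw [e, h.qNorm_dehom, h.symm.qNorm_dehom, hv]
      have key := h.interQ_comp hT hT' (qmk k β α u)
      have e' : qmk k β α u = (interConst p α β)⁻¹ • T' (T (qmk k β α u)) := by
        rw [key, inv_smul_smul₀ hc]
      calc ‖qmk k β α u‖ = ‖(interConst p α β)⁻¹‖ * ‖T' (T (qmk k β α u))‖ := by
            rw [← norm_smul, ← e']
        _ ≤ ‖(interConst p α β)⁻¹‖ * (‖T'‖ * ‖T (qmk k β α u)‖) := by
            gcongr; exact T'.le_opNorm _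
        _ ≤ (‖(interConst p α β)⁻¹‖ * ‖T'‖ + 1) * ‖T (qmk k β α u)‖ := by
            nlinarith [norm_nonneg (T (qmk k β α u))]

lemma HypS.right_ne_mul_left (h : HypS p L k α β) (hle : valL p L β ≤ valL p L α) :
    β ≠ (p : L) * α := by
  intro e
  have hp1 : (1 : ℝ) < p := by exact_mod_cast hp.out.one_lt
  have hα := norm_pos_iff.2 h.left_ne_zero
  have h1 : ‖β‖ < ‖α‖ := by
    rw [e, norm_mul, norm_p_L (p := p)]
    exact mul_lt_of_lt_one_left hα (inv_lt_one_of_one_lt₀ hp1)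
  have h2 := Real.logb_lt_logb hp1 (norm_pos_iff.2 h.right_ne_zero) h1
  rw [valL, valL] at hle
  linarith

end Assembly

lemma Hyps.toHypS {p : ℕ} [Fact p.Prime] {L : Type} [NontriviallyNormedField L]
    [NormedAlgebra ℚ_[p] L] {k : ℕ} {α β : L} (h : Hyps p L k α β) : HypS p L k α β :=
  ⟨h.1, h.2.1, h.2.2.1, h.2.2.2.1, h.2.2.2.2.1⟩

/-- `B(α)/L(α)` and `B(β)/L(β)` are unitary `GL₂(ℚ_p)`-Banach representations
(they carry invariant norms equivalent to the quotient norm), and there is a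
continuous `GL₂(ℚ_p)`-equivariant map `Î : B(β)/L(β) → B(α)/L(α)` compatible
with the intertwining operator `I : π(β) → π(α)`; if `α ≠ pβ` then `I` and `Î`
are (topological) isomorphisms. -/
theorem statement9 (p : ℕ) [Fact p.Prime] (L : Type) [NontriviallyNormedField L]
    [NormedAlgebra ℚ_[p] L] [FiniteDimensional ℚ_[p] L] [IsUltrametricDist L]
    (k : ℕ) (α β : L) (h : Hyps p L k α β) :
    (∃ N : (ℚ_[p] → L) → ℝ,
      (∀ f : ℚ_[p] → L, MemB p L k α β f → 0 ≤ N f) ∧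
      (∀ f g : ℚ_[p] → L, MemB p L k α β f → MemB p L k α β g → N (f + g) ≤ N f + N g) ∧
      (∀ (c : L) (f : ℚ_[p] → L), MemB p L k α β f → N (c • f) = ‖c‖ * N f) ∧
      (∀ f : ℚ_[p] → L, MemB p L k α β f → (N f = 0 ↔ MemLalpha p L k α β f)) ∧
      (∀ m : Matrix (Fin 2) (Fin 2) ℚ_[p], det2 p m ≠ 0 →
        ∀ f : ℚ_[p] → L, MemB p L k α β f → N (gAct p L k α β m f) = N f) ∧
      (∃ c₁ : ℝ, 0 < c₁ ∧ ∃ c₂ : ℝ, 0 < c₂ ∧ ∀ f : ℚ_[p] → L, MemB p L k α β f →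
        c₁ * qNorm p L k α β f ≤ N f ∧ N f ≤ c₂ * qNorm p L k α β f)) ∧
    (∃ N : (ℚ_[p] → L) → ℝ,
      (∀ f : ℚ_[p] → L, MemB p L k β α f → 0 ≤ N f) ∧
      (∀ f g : ℚ_[p] → L, MemB p L k β α f → MemB p L k β α g → N (f + g) ≤ N f + N g) ∧
      (∀ (c : L) (f : ℚ_[p] → L), MemB p L k β α f → N (c • f) = ‖c‖ * N f) ∧
      (∀ f : ℚ_[p] → L, MemB p L k β α f → (N f = 0 ↔ MemLalpha p L k β α f)) ∧
      (∀ m : Matrix (Fin 2) (Fin 2) ℚ_[p], det2 p m ≠ 0 →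
        ∀ f : ℚ_[p] → L, MemB p L k β α f → N (gAct p L k β α m f) = N f) ∧
      (∃ c₁ : ℝ, 0 < c₁ ∧ ∃ c₂ : ℝ, 0 < c₂ ∧ ∀ f : ℚ_[p] → L, MemB p L k β α f →
        c₁ * qNorm p L k β α f ≤ N f ∧ N f ≤ c₂ * qNorm p L k β α f)) ∧
    (∃ Iop : (ℚ_[p] → L) → (ℚ_[p] → L), IopOk p L k α β Iop ∧
      ∃ Φ : (ℚ_[p] → L) → (ℚ_[p] → L),
        (∀ f : ℚ_[p] → L, MemB p L k β α f → MemB p L k α β (Φ f)) ∧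
        (∀ f g : ℚ_[p] → L, MemB p L k β α f → MemB p L k β α g →
          MemLalpha p L k α β (Φ (f + g) - Φ f - Φ g)) ∧
        (∀ (c : L) (f : ℚ_[p] → L), MemB p L k β α f →
          MemLalpha p L k α β (Φ (c • f) - c • Φ f)) ∧
        (∀ f g : ℚ_[p] → L, MemB p L k β α f → MemB p L k β α g →
          MemLalpha p L k β α (f - g) → MemLalpha p L k α β (Φ f - Φ g)) ∧
        (∃ C : ℝ, 0 < C ∧ ∀ f : ℚ_[p] → L, MemB p L k β α f →
          qNorm p L k α β (Φ f) ≤ C * qNorm p L k β α f) ∧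
        (∀ m : Matrix (Fin 2) (Fin 2) ℚ_[p], det2 p m ≠ 0 →
          ∀ f : ℚ_[p] → L, MemB p L k β α f →
            MemLalpha p L k α β (Φ (gAct p L k β α m f) - gAct p L k α β m (Φ f))) ∧
        (∀ f ∈ piRep p L k β α, MemLalpha p L k α β (Φ f - Iop f)) ∧
        (α ≠ (p : L) * β →
          (∀ f ∈ piRep p L k β α, ∀ g ∈ piRep p L k β α, Iop f = Iop g → f = g) ∧
          (∀ F ∈ piRep p L k α β, ∃ f ∈ piRep p L k β α, Iop f = F) ∧
          (∀ F : ℚ_[p] → L, MemB p L k α β F →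
            ∃ f : ℚ_[p] → L, MemB p L k β α f ∧ MemLalpha p L k α β (Φ f - F)) ∧
          (∀ f : ℚ_[p] → L, MemB p L k β α f → MemLalpha p L k α β (Φ f) →
            MemLalpha p L k β α f) ∧
          (∃ C' : ℝ, 0 < C' ∧ ∀ f : ℚ_[p] → L, MemB p L k β α f →
            qNorm p L k β α f ≤ C' * qNorm p L k α β (Φ f)))) := by
  have hS := h.toHypS
  have : CompleteSpace L := FiniteDimensional.complete ℚ_[p] L
  have : Fact (0 < valL p L α) := ⟨hS.pos_left⟩
  have : Fact (0 < valL p L β) := ⟨hS.pos_right⟩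
  exact ⟨hS.exists_invariant_norm, hS.symm.exists_invariant_norm,
    hS.exists_completed_intertwiner (hS.right_ne_mul_left h.2.2.2.2.2)⟩

end Paper

end
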